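/- Let 1 ≤ α ≤ 3/2, 0 < δ₀ ≤ 1, C₀ ≥ 1, let F ⊂ B_{ℝ³}(0,1) be a finite nonempty set with uniform measure μ satisfying μ(B_{ℝ³}(w,δ)) ≤ C₀·δ^α for all w ∈ ℝ³ and δ ≥ δ₀, let t ≥ 0 and e^t·δ₀ ≤ δ ≤ 1. There exist η₀ > 0 and C₁ ≥ 1 (absolute constants) such that for all 0 < η ≤ η₀ and C ≥ C₁ the following holds. Let F_hm = {w ∈ F : |{r ∈ [1/2, 1] : m^δ(π_{t,r}(w)) ≥ C₀·e^{−t/10}·δ^{α−18η}}| ≥ C·δ^η} and assume μ(F_hm) ≥ C·δ^η. Then there exist b ≥ δ^{1−3η} and a subset F'_hm ⊂ F_hm with μ(F'_hm) ≥ δ^{3η/2} such that for all w ∈ F'_hm: |{r ∈ [1/2, 1] : m^δ(π_{t,r}(w)|D_b(w)) ≥ C₀·e^{−t/10}·δ^{α−7η}}| ≥ δ^{3η/2}. -/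

import Mathlib

open MeasureTheory Real Metric

noncomputable section

abbrev E3 := EuclideanSpace ℝ (Fin 3)
abbrev E2 := EuclideanSpace ℝ (Fin 2)

/-- The projection `π_{t,r} : ℝ³ → ℝ²`. -/
def piProj (t r : ℝ) (w : E3) : E2 :=
  (EuclideanSpace.equiv (Fin 2) ℝ).symm
    ![Real.exp t * (w 0 + r * w 1 + r ^ 2 / 2 * w 2), w 1 + r * w 2]

/-- The uniform (normalized counting) measure of a set `A` with respect to a finite set `F`. -/
def mass {V : Type*} (F : Finset V) (A : Set V) : ℝ :=
  (Nat.card ↥(A ∩ (F : Set V)) : ℝ) / F.card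

/-- The annulus `D_b(w) = {w' : b ≤ ‖w − w'‖ ≤ 2b}`. -/
def annulus (w : E3) (b : ℝ) : Set E3 := {w' | b ≤ ‖w - w'‖ ∧ ‖w - w'‖ ≤ 2 * b}

/-- `m^δ(π_{t,r}(w)) = μ {w' ∈ F : ‖π_{t,r}(w) − π_{t,r}(w')‖ ≤ δ}`. -/
def mDelta (F : Finset E3) (t r δ : ℝ) (w : E3) : ℝ :=
  mass F {w' | ‖piProj t r w - piProj t r w'‖ ≤ δ}

/-- `m^δ(π_{t,r}(w) | B) = μ {w' ∈ B : ‖π_{t,r}(w) − π_{t,r}(w')‖ ≤ δ}`. -/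
def mDeltaRes (F : Finset E3) (t r δ : ℝ) (w : E3) (B : Set E3) : ℝ :=
  mass F {w' | w' ∈ B ∧ ‖piProj t r w - piProj t r w'‖ ≤ δ}

section
open scoped Classical

/-- The quadratic polynomial attached to a vector of `ℝ³`. -/
def quadEval (u : E3) (r : ℝ) : ℝ := u 0 + r * u 1 + r ^ 2 / 2 * u 2

/-- The derivative of `quadEval u`. -/
def quadDeriv (u : E3) (r : ℝ) : ℝ := u 1 + r * u 2

/-- The length of the part of a set contained in `[1/2, 1]`. -/
def len (S : Set ℝ) : ℝ := (volume (S ∩ Set.Icc (1 / 2 : ℝ) 1)).toReal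

theorem abs_coord_le (u : E3) (i : Fin 3) : |u i| ≤ ‖u‖ := by
  simpa using PiLp.norm_apply_le u i

theorem norm_le_abs_coord_sum (u : E3) : ‖u‖ ≤ |u 0| + |u 1| + |u 2| := by
  rw [EuclideanSpace.norm_eq, Fin.sum_univ_three]
  apply Real.sqrt_le_iff.2
  simp only [Real.norm_eq_abs]
  have h0 := abs_nonneg (u 0)
  have h1 := abs_nonneg (u 1)
  have h2 := abs_nonneg (u 2)
  constructor
  · positivity
  · nlinarith [mul_nonneg h0 h1, mul_nonneg h0 h2, mul_nonneg h1 h2]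

theorem quadEval_add (u v : E3) (r : ℝ) : quadEval (u + v) r = quadEval u r + quadEval v r := by
  simp only [quadEval, PiLp.add_apply]; ring

theorem quadDeriv_add (u v : E3) (r : ℝ) :
    quadDeriv (u + v) r = quadDeriv u r + quadDeriv v r := by
  simp only [quadDeriv, PiLp.add_apply]; ring

theorem quadEval_sub (u v : E3) (r : ℝ) : quadEval (u - v) r = quadEval u r - quadEval v r := by
  simp only [quadEval, PiLp.sub_apply]; ring

theorem quadDeriv_sub (u v : E3) (r : ℝ) :
    quadDeriv (u - v) r = quadDeriv u r - quadDeriv v r := by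
  simp only [quadDeriv, PiLp.sub_apply]; ring

theorem continuous_quadEval (u : E3) : Continuous (quadEval u) := by
  unfold quadEval; fun_prop

theorem continuous_quadDeriv (u : E3) : Continuous (quadDeriv u) := by
  unfold quadDeriv; fun_prop

theorem quadEval_sub_eq (u : E3) (r r' : ℝ) :
    quadEval u r - quadEval u r' = (r - r') * quadDeriv u ((r + r') / 2) := by
  simp only [quadEval, quadDeriv]; ring

theorem quadDeriv_sub_eq (u : E3) (r r' : ℝ) :
    quadDeriv u r - quadDeriv u r' = (r - r') * u 2 := by
  simp only [quadDeriv]; ring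

theorem abs_quadEval_le (u : E3) {r : ℝ} (h0 : 0 ≤ r) (h1 : r ≤ 1) :
    |quadEval u r| ≤ |u 0| + |u 1| + |u 2| / 2 := by
  unfold quadEval
  have hr : r ^ 2 ≤ 1 := by nlinarith
  calc |u 0 + r * u 1 + r ^ 2 / 2 * u 2| ≤ |u 0| + |r * u 1| + |r ^ 2 / 2 * u 2| := abs_add_three _ _ _
    _ = |u 0| + r * |u 1| + r ^ 2 / 2 * |u 2| := by
      rw [abs_mul, abs_mul, abs_of_nonneg h0, abs_of_nonneg (by positivity : (0:ℝ) ≤ r ^ 2 / 2)]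
    _ ≤ _ := by nlinarith [abs_nonneg (u 1), abs_nonneg (u 2)]

theorem abs_quadDeriv_le (u : E3) {r : ℝ} (h0 : 0 ≤ r) (h1 : r ≤ 1) :
    |quadDeriv u r| ≤ |u 1| + |u 2| := by
  unfold quadDeriv
  calc |u 1 + r * u 2| ≤ |u 1| + |r * u 2| := abs_add_le _ _
    _ = |u 1| + r * |u 2| := by rw [abs_mul, abs_of_nonneg h0]
    _ ≤ _ := by nlinarith [abs_nonneg (u 2)]

theorem norm_le_of_tangent (u : E3) {r a β : ℝ} (h0 : 0 ≤ r) (h1 : r ≤ 1)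
    (ha : |quadEval u r| ≤ a) (hβ : |quadDeriv u r| ≤ β) :
    ‖u‖ ≤ a + 2 * β + 5 / 2 * |u 2| := by
  have e1 : u 1 = quadDeriv u r - r * u 2 := by unfold quadDeriv; ring
  have e0 : u 0 = quadEval u r - r * quadDeriv u r + r ^ 2 / 2 * u 2 := by
    unfold quadDeriv quadEval; ring
  have b1 : |u 1| ≤ β + |u 2| := by
    rw [e1]
    refine (abs_sub _ _).trans ?_
    rw [abs_mul, abs_of_nonneg h0]
    nlinarith [abs_nonneg (u 2)]
  have b0 : |u 0| ≤ a + β + 1 / 2 * |u 2| := by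
    rw [e0]
    refine (abs_add_le _ _).trans ?_
    have := abs_sub (quadEval u r) (r * quadDeriv u r)
    rw [abs_mul, abs_of_nonneg h0] at this
    rw [abs_mul, abs_of_nonneg (by positivity : (0:ℝ) ≤ r ^ 2 / 2)]
    have g1 : r * |quadDeriv u r| ≤ β := (mul_le_of_le_one_left (abs_nonneg _) h1).trans hβ
    have g2 : r ^ 2 / 2 * |u 2| ≤ 1 / 2 * |u 2| :=
      mul_le_mul_of_nonneg_right (by nlinarith) (abs_nonneg _)
    linarith
  have := norm_le_abs_coord_sum u
  linarith

theorem volume_inter_Icc_lt_top (S : Set ℝ) : volume (S ∩ Set.Icc (1 / 2 : ℝ) 1) < ⊤ :=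
  (measure_mono Set.inter_subset_right).trans_lt (by simp)

theorem len_nonneg (S : Set ℝ) : 0 ≤ len S := ENNReal.toReal_nonneg

theorem len_mono {S T : Set ℝ} (h : S ∩ Set.Icc (1 / 2 : ℝ) 1 ⊆ T) : len S ≤ len T :=
  ENNReal.toReal_mono (volume_inter_Icc_lt_top T).ne
    (measure_mono (fun _ hx => ⟨h hx, hx.2⟩))

theorem len_le_half (S : Set ℝ) : len S ≤ 1 / 2 := by
  have : len S ≤ (volume (Set.Icc (1 / 2 : ℝ) 1)).toReal :=
    ENNReal.toReal_mono (by simp) (measure_mono Set.inter_subset_right)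
  refine this.trans ?_
  rw [Real.volume_Icc, ENNReal.toReal_ofReal (by norm_num)]; norm_num

theorem len_union_le (S T : Set ℝ) : len (S ∪ T) ≤ len S + len T := by
  unfold len
  rw [Set.union_inter_distrib_right,
    ← ENNReal.toReal_add (volume_inter_Icc_lt_top S).ne (volume_inter_Icc_lt_top T).ne]
  exact ENNReal.toReal_mono (ENNReal.add_ne_top.2
    ⟨(volume_inter_Icc_lt_top S).ne, (volume_inter_Icc_lt_top T).ne⟩) (measure_union_le _ _)

theorem len_le_of_abs_sub_le {S : Set ℝ} {D : ℝ} (hD : 0 ≤ D)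
    (h : ∀ r ∈ S, ∀ r' ∈ S, 1 / 2 ≤ r → r ≤ 1 → 1 / 2 ≤ r' → r' ≤ 1 → r - r' ≤ D) :
    len S ≤ D := by
  have h1 : volume (S ∩ Set.Icc (1 / 2 : ℝ) 1) ≤ ENNReal.ofReal D := by
    refine (Real.volume_le_diam _).trans ?_
    refine Metric.ediam_le ?_
    intro r hr r' hr'
    rw [edist_dist, Real.dist_eq]
    apply ENNReal.ofReal_le_ofReal
    rw [abs_le]
    have a1 := h r hr.1 r' hr'.1 hr.2.1 hr.2.2 hr'.2.1 hr'.2.2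
    have a2 := h r' hr'.1 r hr.1 hr'.2.1 hr'.2.2 hr.2.1 hr.2.2
    constructor <;> linarith
  exact ENNReal.toReal_le_of_le_ofReal hD h1

theorem len_tangent_le (u : E3) {a β : ℝ} (hβ : 0 ≤ β) (hu : 0 < ‖u‖)
    (h : a + 2 * β ≤ ‖u‖ / 2) :
    len {r | |quadEval u r| ≤ a ∧ |quadDeriv u r| ≤ β} ≤ 10 * β / ‖u‖ := by
  refine len_le_of_abs_sub_le (by positivity) ?_
  rintro r ⟨hr1, hr2⟩ r' ⟨-, hr2'⟩ h1 h2 h1' h2'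
  have hz := norm_le_of_tangent u (by linarith) h2 hr1 hr2
  have hz' : ‖u‖ / 5 ≤ |u 2| := by linarith
  have hd := quadDeriv_sub_eq u r r'
  have : |r - r'| * |u 2| ≤ 2 * β := by
    rw [← abs_mul, ← hd]
    exact (abs_sub _ _).trans (by linarith)
  rw [le_div_iff₀ hu]
  have hm := mul_le_mul_of_nonneg_left hz' (abs_nonneg (r - r'))
  have := mul_le_mul_of_nonneg_right (le_abs_self (r - r')) hu.le
  linarith

theorem len_steep_le (u : E3) {a β : ℝ} (ha : 0 ≤ a) (hβ : 0 < β) :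
    len {r | |quadEval u r| ≤ a ∧ β ≤ |quadDeriv u r|} ≤ 4 * a / β := by
  have key : ∀ r r' : ℝ, |quadEval u r| ≤ a → |quadEval u r'| ≤ a →
      (β ≤ quadDeriv u r ∧ β ≤ quadDeriv u r' ∨ quadDeriv u r ≤ -β ∧ quadDeriv u r' ≤ -β) →
      r - r' ≤ 2 * a / β := by
    intro r r' h h' hh
    have e := quadEval_sub_eq u r r'
    have em : quadDeriv u ((r + r') / 2) = (quadDeriv u r + quadDeriv u r') / 2 := by
      simp only [quadDeriv]; ring
    rw [abs_le] at h h'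
    rw [le_div_iff₀ hβ]
    by_cases hs : r - r' ≤ 0
    · nlinarith
    push Not at hs
    rw [em] at e
    rcases hh with ⟨g, g'⟩ | ⟨g, g'⟩
    · nlinarith
    · nlinarith
  have h1 : len {r | |quadEval u r| ≤ a ∧ β ≤ quadDeriv u r} ≤ 2 * a / β :=
    len_le_of_abs_sub_le (by positivity)
      (fun r hr r' hr' _ _ _ _ => key r r' hr.1 hr'.1 (Or.inl ⟨hr.2, hr'.2⟩))
  have h2 : len {r | |quadEval u r| ≤ a ∧ quadDeriv u r ≤ -β} ≤ 2 * a / β :=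
    len_le_of_abs_sub_le (by positivity)
      (fun r hr r' hr' _ _ _ _ => key r r' hr.1 hr'.1 (Or.inr ⟨hr.2, hr'.2⟩))
  calc _ ≤ len ({r | |quadEval u r| ≤ a ∧ β ≤ quadDeriv u r} ∪
        {r | |quadEval u r| ≤ a ∧ quadDeriv u r ≤ -β}) := by
        apply len_mono
        rintro r ⟨⟨g1, g2⟩, -⟩
        rcases le_abs.1 g2 with g | g
        · exact Or.inl ⟨g1, g⟩
        · exact Or.inr ⟨g1, by linarith⟩
    _ ≤ 2 * a / β + 2 * a / β := (len_union_le _ _).trans (add_le_add h1 h2)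
    _ = 4 * a / β := by ring

theorem exists_flat_of_len (u : E3) {a β : ℝ} (ha : 0 ≤ a) (hβ : 0 < β)
    (h : 4 * a / β < len {r | |quadEval u r| ≤ a}) :
    ∃ r, 1 / 2 ≤ r ∧ r ≤ 1 ∧ |quadEval u r| ≤ a ∧ |quadDeriv u r| ≤ β := by
  by_contra! hc
  refine absurd h (not_lt.2 (le_trans (len_mono ?_) (len_steep_le u ha hβ)))
  rintro r ⟨h1, h2, h3⟩
  exact ⟨h1, (hc r h2 h3 h1).le⟩

theorem len_sublevel_le (u : E3) {a : ℝ} (ha : 0 < a) (hu : 0 < ‖u‖) :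
    len {r | |quadEval u r| ≤ a} ≤ 14 * √(a / ‖u‖) := by
  by_cases hs : a ≤ ‖u‖ / 36
  · set β := √(a * ‖u‖) with hβ
    have hβ0 : 0 < β := Real.sqrt_pos.2 (by positivity)
    have hβ2 : β ^ 2 = a * ‖u‖ := Real.sq_sqrt (by positivity)
    have hq : √(a / ‖u‖) = β / ‖u‖ := by
      rw [hβ, eq_div_iff hu.ne']
      nth_rewrite 2 [← Real.sqrt_sq hu.le]
      rw [← Real.sqrt_mul (by positivity)]
      congr 1
      field_simp
    have h6 : β ≤ ‖u‖ / 6 := abs_le_of_sq_le_sq' (by nlinarith) (by positivity) |>.2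
    have h1 := len_steep_le u ha.le hβ0
    have h2 := len_tangent_le u (a := a) hβ0.le hu (by linarith)
    have h3 : 4 * a / β = 4 * (β / ‖u‖) := by
      field_simp
      linarith
    calc _ ≤ len ({r | |quadEval u r| ≤ a ∧ β ≤ |quadDeriv u r|} ∪
          {r | |quadEval u r| ≤ a ∧ |quadDeriv u r| ≤ β}) := by
          apply len_mono
          rintro r ⟨g, -⟩
          rcases le_total β |quadDeriv u r| with g' | g'
          · exact Or.inl ⟨g, g'⟩
          · exact Or.inr ⟨g, g'⟩
      _ ≤ 4 * a / β + 10 * β / ‖u‖ := (len_union_le _ _).trans (add_le_add h1 h2)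
      _ = _ := by rw [h3, hq]; ring
  · push Not at hs
    refine (len_le_half _).trans ?_
    have : (1 / 6 : ℝ) ≤ √(a / ‖u‖) := by
      apply Real.le_sqrt_of_sq_le
      rw [le_div_iff₀ hu]; nlinarith
    linarith

theorem norm_le_of_quadEval_le (u : E3) {r₁ r₂ r₃ τ M : ℝ} (hτ : 0 < τ) (hτ1 : τ ≤ 1)
    (hr₁ : 1 / 2 ≤ r₁) (hr₁' : r₁ ≤ 1) (hr₂ : 1 / 2 ≤ r₂) (hr₂' : r₂ ≤ 1)
    (h12 : τ ≤ |r₂ - r₁|) (h13 : τ ≤ |r₃ - r₁|) (h23 : τ ≤ |r₃ - r₂|)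
    (h₁ : |quadEval u r₁| ≤ M) (h₂ : |quadEval u r₂| ≤ M) (h₃ : |quadEval u r₃| ≤ M) :
    ‖u‖ ≤ 30 * M / τ ^ 2 := by
  have hM : 0 ≤ M := (abs_nonneg _).trans h₁
  have e21 := quadEval_sub_eq u r₂ r₁
  have e31 := quadEval_sub_eq u r₃ r₁
  have d21 : |quadDeriv u ((r₂ + r₁) / 2)| * τ ≤ 2 * M := by
    calc _ ≤ |quadDeriv u ((r₂ + r₁) / 2)| * |r₂ - r₁| := by gcongr
      _ = |quadEval u r₂ - quadEval u r₁| := by rw [e21, abs_mul, mul_comm]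
      _ ≤ _ := (abs_sub _ _).trans (by linarith)
  have d31 : |quadDeriv u ((r₃ + r₁) / 2)| * τ ≤ 2 * M := by
    calc _ ≤ |quadDeriv u ((r₃ + r₁) / 2)| * |r₃ - r₁| := by gcongr
      _ = |quadEval u r₃ - quadEval u r₁| := by rw [e31, abs_mul, mul_comm]
      _ ≤ _ := (abs_sub _ _).trans (by linarith)
  have d2 : |u 2| * τ ≤ 2 * (|quadDeriv u ((r₃ + r₁) / 2)| + |quadDeriv u ((r₂ + r₁) / 2)|) := by
    have e := quadDeriv_sub_eq u ((r₃ + r₁) / 2) ((r₂ + r₁) / 2)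
    have e' : (r₃ - r₂) * u 2
        = 2 * (quadDeriv u ((r₃ + r₁) / 2) - quadDeriv u ((r₂ + r₁) / 2)) := by
      rw [e]; ring
    calc _ ≤ |u 2| * |r₃ - r₂| := by gcongr
      _ = |(r₃ - r₂) * u 2| := by rw [abs_mul, mul_comm]
      _ ≤ _ := by
        rw [e', abs_mul, abs_two]
        gcongr
        exact abs_sub _ _
  have hz : |u 2| * τ ^ 2 ≤ 8 * M := by nlinarith
  have hd : |quadDeriv u ((r₂ + r₁) / 2)| * τ ^ 2 ≤ 2 * M := by
    nlinarith [abs_nonneg (quadDeriv u ((r₂ + r₁) / 2))]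
  have b1 : |u 1| ≤ |quadDeriv u ((r₂ + r₁) / 2)| + |u 2| := by
    have e1 : u 1 = quadDeriv u ((r₂ + r₁) / 2) - ((r₂ + r₁) / 2) * u 2 := by unfold quadDeriv; ring
    have g : |(r₂ + r₁) / 2 * u 2| ≤ |u 2| := by
      rw [abs_mul, abs_of_nonneg (by linarith : 0 ≤ (r₂ + r₁) / 2)]
      exact mul_le_of_le_one_left (abs_nonneg _) (by linarith)
    calc |u 1| = |quadDeriv u ((r₂ + r₁) / 2) - ((r₂ + r₁) / 2) * u 2| := by rw [← e1]
      _ ≤ _ := (abs_sub _ _).trans (by linarith)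
  have b0 : |u 0| ≤ M + |quadDeriv u ((r₂ + r₁) / 2)| + |u 2| := by
    have e0 : u 0 = quadEval u r₁ - r₁ * quadDeriv u ((r₂ + r₁) / 2) + r₁ * r₂ / 2 * u 2 := by
      unfold quadDeriv quadEval; ring
    have g1 : |r₁ * quadDeriv u ((r₂ + r₁) / 2)| ≤ |quadDeriv u ((r₂ + r₁) / 2)| := by
      rw [abs_mul, abs_of_nonneg (by linarith : 0 ≤ r₁)]
      exact mul_le_of_le_one_left (abs_nonneg _) hr₁'
    have g2 : |r₁ * r₂ / 2 * u 2| ≤ |u 2| := by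
      rw [abs_mul, abs_of_nonneg (by positivity : 0 ≤ r₁ * r₂ / 2)]
      exact mul_le_of_le_one_left (abs_nonneg _) (by nlinarith)
    rw [e0]
    refine (abs_add_le _ _).trans ?_
    have := abs_sub (quadEval u r₁) (r₁ * quadDeriv u ((r₂ + r₁) / 2))
    linarith
  rw [le_div_iff₀ (by positivity)]
  have hn : ‖u‖ ≤ M + 2 * |quadDeriv u ((r₂ + r₁) / 2)| + 3 * |u 2| :=
    (norm_le_abs_coord_sum u).trans (by linarith)
  have hτ2 : τ ^ 2 ≤ 1 := by nlinarith
  nlinarith [mul_le_mul_of_nonneg_right hn (sq_nonneg τ)]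

theorem measurable_count {ι : Type*} (H : Finset ι) (S : ι → Set ℝ)
    (hS : ∀ i ∈ H, MeasurableSet (S i)) :
    Measurable (fun r => ((H.filter (fun i => r ∈ S i)).card : ℝ)) := by
  have : (fun r => ((H.filter (fun i => r ∈ S i)).card : ℝ))
      = fun r => ∑ i ∈ H, (S i).indicator (fun _ => (1 : ℝ)) r := by
    ext r
    rw [Finset.card_filter]
    push_cast
    exact Finset.sum_congr rfl fun i _ => by simp [Set.indicator_apply]
  rw [this]
  exact Finset.measurable_sum _ fun i hi => measurable_const.indicator (hS i hi)

theorem mul_len_le_sum_len {ι : Type*} (H : Finset ι) (S : ι → Set ℝ)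
    (hS : ∀ i ∈ H, MeasurableSet (S i)) {R : Set ℝ} (hR : MeasurableSet R) {c : ℝ}
    (hc : ∀ r ∈ R, 1 / 2 ≤ r → r ≤ 1 → c ≤ (H.filter (fun i => r ∈ S i)).card) :
    c * len R ≤ ∑ i ∈ H, len (R ∩ S i) := by
  set R' := R ∩ Set.Icc (1 / 2 : ℝ) 1 with hR'
  have hmR : MeasurableSet R' := hR.inter measurableSet_Icc
  have hfin : volume R' < ⊤ := volume_inter_Icc_lt_top R
  have : IsFiniteMeasure (volume.restrict R') := ⟨by simpa using hfin⟩
  have hInt : ∀ i ∈ H, Integrable ((S i).indicator (fun _ => (1 : ℝ))) (volume.restrict R') :=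
    fun i hi => (integrable_const (1 : ℝ)).indicator (hS i hi)
  have h1 : c * len R = ∫ _ in R', c := by
    rw [setIntegral_const, smul_eq_mul, mul_comm]; rfl
  have h2 : ∑ i ∈ H, len (R ∩ S i)
      = ∫ r in R', ∑ i ∈ H, (S i).indicator (fun _ => (1 : ℝ)) r := by
    rw [integral_finsetSum _ hInt]
    refine Finset.sum_congr rfl fun i hi => ?_
    rw [integral_indicator (hS i hi), setIntegral_const, smul_eq_mul, mul_one,
      measureReal_def, Measure.restrict_apply' hmR]
    unfold len
    congr 2
    ext r; simp only [hR', Set.mem_inter_iff]; tauto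
  rw [h1, h2]
  refine setIntegral_mono_on (integrable_const _) (integrable_finsetSum _ hInt) hmR ?_
  intro r hr
  refine (hc r hr.1 hr.2.1 hr.2.2).trans (le_of_eq ?_)
  rw [Finset.card_filter]
  push_cast
  exact Finset.sum_congr rfl fun i _ => by simp [Set.indicator_apply]

theorem mul_len_le_card_mul {ι : Type*} (H : Finset ι) (S : ι → Set ℝ)
    (hS : ∀ i ∈ H, MeasurableSet (S i)) {R : Set ℝ} (hR : MeasurableSet R) {c D : ℝ}
    (hc : ∀ r ∈ R, 1 / 2 ≤ r → r ≤ 1 → c ≤ (H.filter (fun i => r ∈ S i)).card)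
    (hD : ∀ i ∈ H, len (S i) ≤ D) :
    c * len R ≤
      (H.filter (fun i => ∃ r ∈ R, 1 / 2 ≤ r ∧ r ≤ 1 ∧ r ∈ S i)).card * D := by
  refine (mul_len_le_sum_len H S hS hR hc).trans ?_
  rw [← nsmul_eq_mul, ← Finset.sum_const, Finset.sum_filter]
  refine Finset.sum_le_sum fun i hi => ?_
  split_ifs with h
  · exact (len_mono (fun r hr => hr.1.2)).trans (hD i hi)
  · refine (len_mono (T := ∅) ?_).trans (by simp [len])
    rintro r ⟨⟨h1, h2⟩, h3, h4⟩
    exact h ⟨r, h1, h3, h4, h2⟩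

theorem measurableSet_sublevel (u : E3) (a : ℝ) : MeasurableSet {r | |quadEval u r| ≤ a} :=
  (isClosed_le (continuous_quadEval u).abs continuous_const).measurableSet

theorem measurableSet_flat (u : E3) (β : ℝ) : MeasurableSet {r | |quadDeriv u r| ≤ β} :=
  (isClosed_le (continuous_quadDeriv u).abs continuous_const).measurableSet

theorem sum_len_sublevel_le (A : Finset E3) (w : E3) {a Cn α : ℝ} (ha : 0 < a) (hCn : 0 ≤ Cn)
    (hα : 1 ≤ α)
    (hA : ∀ ρ, a ≤ ρ → ((A.filter (fun w' => ‖w - w'‖ ≤ ρ)).card : ℝ) ≤ Cn * ρ ^ α)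
    {e : ℝ} (he : a ≤ e) :
    ∑ w' ∈ A.filter (fun w' => ‖w - w'‖ ≤ e), len {r | |quadEval (w - w') r| ≤ a}
      ≤ 80 * Cn * √a * e ^ (α - 1 / 2) := by
  have main : ∀ n : ℕ, ∀ e, a ≤ e → e ≤ 2 ^ (n + 1) * a →
      ∑ w' ∈ A.filter (fun w' => ‖w - w'‖ ≤ e), len {r | |quadEval (w - w') r| ≤ a}
      ≤ 80 * Cn * √a * e ^ (α - 1 / 2) := by
    intro n
    induction n with
    | zero =>
      intro e he he2
      have he0 : 0 < e := ha.trans_le he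
      have h1 : e ^ α = e ^ (α - 1 / 2) * √e := by
        rw [Real.sqrt_eq_rpow, ← Real.rpow_add he0]; ring_nf
      have h2 : √e ≤ 2 * √a := by
        rw [show (2:ℝ) = √4 by rw [show (4:ℝ) = 2 ^ 2 by norm_num, Real.sqrt_sq (by norm_num)],
          ← Real.sqrt_mul (by norm_num)]
        exact Real.sqrt_le_sqrt (by norm_num at he2; linarith)
      calc _ ≤ ∑ w' ∈ A.filter (fun w' => ‖w - w'‖ ≤ e), (1 : ℝ) / 2 :=
            Finset.sum_le_sum fun _ _ => len_le_half _
        _ = ((A.filter (fun w' => ‖w - w'‖ ≤ e)).card : ℝ) * (1 / 2) := by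
            rw [Finset.sum_const, nsmul_eq_mul]
        _ ≤ Cn * (e ^ (α - 1 / 2) * (2 * √a)) * (1 / 2) := by
            refine mul_le_mul_of_nonneg_right ((hA e he).trans ?_) (by norm_num)
            rw [h1]
            gcongr
        _ ≤ _ := by
            have : 0 ≤ Cn * √a * e ^ (α - 1 / 2) := by positivity
            nlinarith
    | succ n ih =>
      intro e he he2
      by_cases hs : e ≤ 2 ^ (n + 1) * a
      · exact ih e he hs
      push Not at hs
      have he0 : 0 < e := ha.trans_le he
      have h2a : 2 * a ≤ e := by
        have : (2:ℝ) ^ 1 ≤ 2 ^ (n + 1) := pow_le_pow_right₀ (by norm_num) (by omega)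
        nlinarith
      have hi := ih (e / 2) (by linarith) (by rw [pow_succ] at he2; linarith)
      have hhalf : (e / 2) ^ (α - 1 / 2) ≤ e ^ (α - 1 / 2) * (0.7072 : ℝ) := by
        rw [div_eq_mul_inv, Real.mul_rpow he0.le (by norm_num)]
        gcongr
        calc ((2:ℝ)⁻¹) ^ (α - 1 / 2) ≤ ((2:ℝ)⁻¹) ^ ((1:ℝ) / 2) :=
              Real.rpow_le_rpow_of_exponent_ge (by norm_num) (by norm_num) (by linarith)
          _ = √(2⁻¹) := by rw [Real.sqrt_eq_rpow]
          _ ≤ _ := by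
            rw [Real.sqrt_le_iff]; norm_num
      have h1 : e ^ α = e ^ (α - 1 / 2) * √e := by
        rw [Real.sqrt_eq_rpow, ← Real.rpow_add he0]; ring_nf
      have hq : √(a / (e / 2)) * √e ≤ 1.4143 * √a := by
        rw [← Real.sqrt_mul (by positivity)]
        rw [show a / (e / 2) * e = 2 * a by field_simp, Real.sqrt_mul (by norm_num)]
        gcongr
        rw [Real.sqrt_le_iff]; norm_num
      have hsub : A.filter (fun w' => ‖w - w'‖ ≤ e) =
          A.filter (fun w' => ‖w - w'‖ ≤ e / 2) ∪
          A.filter (fun w' => e / 2 < ‖w - w'‖ ∧ ‖w - w'‖ ≤ e) := by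
        ext w'
        simp only [Finset.mem_filter, Finset.mem_union]
        constructor
        · rintro ⟨h, h'⟩
          rcases le_or_gt ‖w - w'‖ (e / 2) with g | g
          · exact Or.inl ⟨h, g⟩
          · exact Or.inr ⟨h, g, h'⟩
        · rintro (⟨h, h'⟩ | ⟨h, h', h''⟩)
          · exact ⟨h, by linarith⟩
          · exact ⟨h, h''⟩
      rw [hsub, Finset.sum_union]
      · have hfar : ∑ w' ∈ A.filter (fun w' => e / 2 < ‖w - w'‖ ∧ ‖w - w'‖ ≤ e),
            len {r | |quadEval (w - w') r| ≤ a} ≤ 20 * Cn * √a * e ^ (α - 1 / 2) := by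
          calc _ ≤ ∑ w' ∈ A.filter (fun w' => e / 2 < ‖w - w'‖ ∧ ‖w - w'‖ ≤ e),
                14 * √(a / (e / 2)) := by
                refine Finset.sum_le_sum fun w' hw' => ?_
                have hw := (Finset.mem_filter.1 hw').2.1
                refine (len_sublevel_le _ ha (by linarith)).trans ?_
                gcongr
            _ = ((A.filter (fun w' => e / 2 < ‖w - w'‖ ∧ ‖w - w'‖ ≤ e)).card : ℝ)
                  * (14 * √(a / (e / 2))) := by rw [Finset.sum_const, nsmul_eq_mul]
            _ ≤ (Cn * e ^ α) * (14 * √(a / (e / 2))) := by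
                gcongr
                refine le_trans ?_ (hA e he)
                refine Nat.cast_le.2 (Finset.card_le_card fun w' hw' => ?_)
                simp only [Finset.mem_filter] at hw' ⊢
                exact ⟨hw'.1, hw'.2.2⟩
            _ = 14 * (Cn * e ^ (α - 1 / 2)) * (√(a / (e / 2)) * √e) := by rw [h1]; ring
            _ ≤ 14 * (Cn * e ^ (α - 1 / 2)) * (1.4143 * √a) := by gcongr
            _ ≤ _ := by
                have : 0 ≤ Cn * √a * e ^ (α - 1 / 2) := by positivity
                nlinarith
        have hnear : 80 * Cn * √a * (e / 2) ^ (α - 1 / 2)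
            ≤ 80 * Cn * √a * (e ^ (α - 1 / 2) * (0.7072 : ℝ)) := by gcongr
        have : 0 ≤ Cn * √a * e ^ (α - 1 / 2) := by positivity
        nlinarith
      · refine Finset.disjoint_filter.2 ?_
        rintro w' - h1 ⟨h2, -⟩
        linarith
  obtain ⟨n, hn⟩ := pow_unbounded_of_one_lt (e / a) (one_lt_two (α := ℝ))
  refine main n e he ?_
  rw [div_lt_iff₀ ha] at hn
  rw [pow_succ]
  nlinarith

/-- The vector `u` has norm in `[d₁, d₂]` and its quadratic polynomial is `(a, β)`-small, together
with its derivative, at `r`. -/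
def Tangent (a β d₁ d₂ : ℝ) (u : E3) (r : ℝ) : Prop :=
  |quadEval u r| ≤ a ∧ |quadDeriv u r| ≤ β ∧ d₁ ≤ ‖u‖ ∧ ‖u‖ ≤ d₂

theorem norm_sq_E3 (u : E3) : ‖u‖ ^ 2 = u 0 ^ 2 + u 1 ^ 2 + u 2 ^ 2 := by
  rw [EuclideanSpace.norm_sq_eq, Fin.sum_univ_three]
  simp only [Real.norm_eq_abs, sq_abs]

theorem abs_quadDeriv_le_norm (u : E3) {r : ℝ} (h0 : 0 ≤ r) (h1 : r ≤ 1) :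
    |quadDeriv u r| ≤ 2 * ‖u‖ := by
  have := abs_quadDeriv_le u h0 h1
  have := abs_coord_le u 1
  have := abs_coord_le u 2
  linarith

theorem Tangent.abs_disc_le {a β d₁ d₂ : ℝ} {u : E3} {r : ℝ} (h : Tangent a β d₁ d₂ u r) :
    |u 1 ^ 2 - 2 * u 0 * u 2| ≤ β ^ 2 + 2 * d₂ * a := by
  have e : u 1 ^ 2 - 2 * u 0 * u 2 = quadDeriv u r ^ 2 - 2 * (u 2 * quadEval u r) := by
    unfold quadEval quadDeriv; ring
  rw [e]
  refine (abs_sub _ _).trans ?_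
  rw [abs_pow, abs_mul 2, abs_mul, abs_two]
  have h1 : |quadDeriv u r| ^ 2 ≤ β ^ 2 := pow_le_pow_left₀ (abs_nonneg _) h.2.1 2
  have h2 : |u 2| * |quadEval u r| ≤ d₂ * a :=
    mul_le_mul ((abs_coord_le u 2).trans h.2.2.2) h.1 (abs_nonneg _)
      ((norm_nonneg _).trans h.2.2.2)
  linarith

theorem Tangent.abs_quadEval_le {a β d₁ d₂ : ℝ} {D u : E3} {r r' : ℝ} (hd : 0 < d₁)
    (h0 : 0 ≤ r) (h1 : r ≤ 1) (h : Tangent a β d₁ d₂ D r) (h' : Tangent a β d₁ d₂ (D + u) r')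
    (hs : a + 2 * β ≤ d₁ / 2) :
    |quadEval u r| ≤ 5 / d₁ * (β ^ 2 + 2 * d₂ * a + (‖u‖ + 2 * β + a) * ‖u‖) := by
  have hD2 : d₁ / 5 ≤ |D 2| := by
    have := norm_le_of_tangent D h0 h1 h.1 h.2.1
    have := h.2.2.1
    linarith
  have e : 2 * (D 2 * quadEval u r) = (D 1 ^ 2 - 2 * D 0 * D 2) + (u 1 ^ 2 - 2 * u 0 * u 2)
      - ((D + u) 1 ^ 2 - 2 * (D + u) 0 * (D + u) 2)
      + 2 * (quadDeriv u r * quadDeriv D r - u 2 * quadEval D r) := by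
    simp only [quadEval, quadDeriv, PiLp.add_apply]; ring
  have hu : |u 1 ^ 2 - 2 * u 0 * u 2| ≤ ‖u‖ ^ 2 := by
    rw [norm_sq_E3, abs_le]
    constructor <;> nlinarith [sq_nonneg (u 0 - u 2), sq_nonneg (u 0 + u 2), sq_nonneg (u 1)]
  have hβ : 0 ≤ β := (abs_nonneg _).trans h.2.1
  have hx : |quadDeriv u r * quadDeriv D r| ≤ 2 * ‖u‖ * β := by
    rw [abs_mul]
    exact mul_le_mul (abs_quadDeriv_le_norm u h0 h1) h.2.1 (abs_nonneg _) (by positivity)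
  have hy : |u 2 * quadEval D r| ≤ ‖u‖ * a := by
    rw [abs_mul]
    exact mul_le_mul (abs_coord_le u 2) h.1 (abs_nonneg _) (by positivity)
  have hQ := h.abs_disc_le
  have hQ' := h'.abs_disc_le
  have key : |D 2 * quadEval u r| ≤ β ^ 2 + 2 * d₂ * a + (‖u‖ + 2 * β + a) * ‖u‖ := by
    rw [abs_le] at *
    constructor <;> nlinarith [sq_nonneg ‖u‖]
  rw [abs_mul] at key
  have := mul_le_mul_of_nonneg_right hD2 (abs_nonneg (quadEval u r))
  rw [div_mul_eq_mul_div, le_div_iff₀ hd]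
  linarith

theorem Tangent.norm_le {a β d₁ d₂ τ η : ℝ} {D₁ D₂ D₃ u : E3} {r₁ r₂ r₃ s₁ s₂ s₃ : ℝ}
    (hd : 0 < d₁) (hτ : 0 < τ) (hτ1 : τ ≤ 1)
    (hr₁ : 1 / 2 ≤ r₁) (hr₁' : r₁ ≤ 1) (hr₂ : 1 / 2 ≤ r₂) (hr₂' : r₂ ≤ 1)
    (hr₃ : 1 / 2 ≤ r₃) (hr₃' : r₃ ≤ 1)
    (h12 : τ ≤ |r₂ - r₁|) (h13 : τ ≤ |r₃ - r₁|) (h23 : τ ≤ |r₃ - r₂|)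
    (h₁ : Tangent a β d₁ d₂ D₁ r₁) (h₂ : Tangent a β d₁ d₂ D₂ r₂) (h₃ : Tangent a β d₁ d₂ D₃ r₃)
    (g₁ : Tangent a β d₁ d₂ (D₁ + u) s₁) (g₂ : Tangent a β d₁ d₂ (D₂ + u) s₂)
    (g₃ : Tangent a β d₁ d₂ (D₃ + u) s₃)
    (hs : a + 2 * β ≤ d₁ / 2) (hu : ‖u‖ ≤ η) (hη : 300 * (η + 2 * β + a) ≤ τ ^ 2 * d₁) :
    ‖u‖ ≤ 300 * (β ^ 2 + 2 * d₂ * a) / (τ ^ 2 * d₁) := by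
  have b₁ := h₁.abs_quadEval_le hd (by linarith) hr₁' g₁ hs
  have b₂ := h₂.abs_quadEval_le hd (by linarith) hr₂' g₂ hs
  have b₃ := h₃.abs_quadEval_le hd (by linarith) hr₃' g₃ hs
  have := norm_le_of_quadEval_le u hτ hτ1 hr₁ hr₁' hr₂ hr₂' h12 h13 h23 b₁ b₂ b₃
  have e : 30 * (5 / d₁ * (β ^ 2 + 2 * d₂ * a + (‖u‖ + 2 * β + a) * ‖u‖)) / τ ^ 2
      = 150 * (β ^ 2 + 2 * d₂ * a + (‖u‖ + 2 * β + a) * ‖u‖) / (τ ^ 2 * d₁) := by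
    field_simp; ring
  rw [e, le_div_iff₀ (by positivity)] at this
  rw [le_div_iff₀ (by positivity)]
  have : 300 * (‖u‖ + 2 * β + a) * ‖u‖ ≤ τ ^ 2 * d₁ * ‖u‖ := by
    refine mul_le_mul_of_nonneg_right ?_ (norm_nonneg _)
    linarith
  linarith

theorem pow_three_le_sum_ite {ι : Type*} (H : Finset ι) (n : ℝ) (hn : 0 ≤ n)
    (P : ι → ℝ → Prop) (τ : ℝ)
    (h : ∀ r₁ r₂ : ℝ, n ≤ (H.filter (fun i => ∃ r, P i r ∧ τ ≤ |r - r₁| ∧ τ ≤ |r - r₂|)).card) :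
    n ^ 3 ≤ ∑ i ∈ H, ∑ j ∈ H, ∑ k ∈ H,
      if ∃ r₁ r₂ r₃, P i r₁ ∧ P j r₂ ∧ P k r₃ ∧ τ ≤ |r₂ - r₁| ∧ τ ≤ |r₃ - r₁| ∧ τ ≤ |r₃ - r₂|
      then (1 : ℝ) else 0 := by
  have nested : ∀ (Q : ι → Prop) (f : ι → ℝ) (c : ℝ), 0 ≤ c → (∀ i ∈ H, 0 ≤ f i) →
      (∀ i, Q i → c ≤ f i) → n ≤ (H.filter Q).card → n * c ≤ ∑ i ∈ H, f i := by
    intro Q f c hc hf hQ hcard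
    calc n * c ≤ (H.filter Q).card * c := by gcongr
      _ = ∑ i ∈ H.filter Q, c := by rw [Finset.sum_const, nsmul_eq_mul]
      _ ≤ ∑ i ∈ H.filter Q, f i := Finset.sum_le_sum fun i hi => hQ i (Finset.mem_filter.1 hi).2
      _ ≤ _ := Finset.sum_le_sum_of_subset_of_nonneg (Finset.filter_subset _ _)
        fun i hi _ => hf i hi
  have nn : ∀ p : Prop, (0 : ℝ) ≤ if p then 1 else 0 := fun p => by split_ifs <;> norm_num
  rw [show n ^ 3 = n * (n * (n * 1)) by ring]
  refine nested _ _ _ (by positivity) (fun i _ => Finset.sum_nonneg fun _ _ =>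
    Finset.sum_nonneg fun _ _ => nn _) ?_ (h 0 0)
  rintro i ⟨r₁, hr₁, -⟩
  refine nested _ _ _ (by positivity) (fun _ _ => Finset.sum_nonneg fun _ _ => nn _) ?_ (h r₁ r₁)
  rintro j ⟨r₂, hr₂, h12, -⟩
  refine nested _ _ _ (by positivity) (fun _ _ => nn _) ?_ (h r₁ r₂)
  rintro k ⟨r₃, hr₃, h13, h23⟩
  rw [if_pos ⟨r₁, r₂, r₃, hr₁, hr₂, hr₃, h12, h13, h23⟩]

theorem sum_weight_mul_pow_three_le (G H : Finset E3) (ω n : E3 → ℝ) (R : E3 → Set ℝ)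
    {a β d₁ d₂ τ η V : ℝ} (hω : ∀ w ∈ G, 0 ≤ ω w) (hn : ∀ w ∈ G, 0 ≤ n w) (hV : 0 ≤ V)
    (hd : 0 < d₁) (hτ : 0 < τ) (hτ1 : τ ≤ 1)
    (hs : a + 2 * β ≤ d₁ / 2) (hη : 300 * (η + 2 * β + a) ≤ τ ^ 2 * d₁)
    (hG : ∀ w ∈ G, ∀ w' ∈ G, ‖w' - w‖ ≤ η)
    (hcard : ∀ w ∈ G, ∀ r₁ r₂ : ℝ, n w ≤ (H.filter (fun w' => ∃ r, (r ∈ R w ∧ 1 / 2 ≤ r ∧ r ≤ 1 ∧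
      Tangent a β d₁ d₂ (w - w') r) ∧ τ ≤ |r - r₁| ∧ τ ≤ |r - r₂|)).card)
    (hball : ∀ w ∈ G, ∑ w' ∈ G.filter
      (fun w' => ‖w' - w‖ ≤ 300 * (β ^ 2 + 2 * d₂ * a) / (τ ^ 2 * d₁)), ω w' ≤ V) :
    ∑ w ∈ G, ω w * n w ^ 3 ≤ V * (H.card : ℝ) ^ 3 := by
  set P : E3 → E3 → ℝ → Prop := fun w w' r => r ∈ R w ∧ 1 / 2 ≤ r ∧ r ≤ 1 ∧
      Tangent a β d₁ d₂ (w - w') r with hP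
  set T : E3 → E3 → E3 → E3 → Prop := fun w i j k => ∃ r₁ r₂ r₃, P w i r₁ ∧ P w j r₂ ∧ P w k r₃ ∧
    τ ≤ |r₂ - r₁| ∧ τ ≤ |r₃ - r₁| ∧ τ ≤ |r₃ - r₂| with hT
  have h1 : ∀ w ∈ G, n w ^ 3 ≤ ∑ i ∈ H, ∑ j ∈ H, ∑ k ∈ H, if T w i j k then (1 : ℝ) else 0 :=
    fun w hw => pow_three_le_sum_ite H (n w) (hn w hw) (P w) τ (hcard w hw)
  calc ∑ w ∈ G, ω w * n w ^ 3
      ≤ ∑ w ∈ G, ω w * ∑ i ∈ H, ∑ j ∈ H, ∑ k ∈ H, if T w i j k then (1 : ℝ) else 0 :=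
        Finset.sum_le_sum fun w hw => mul_le_mul_of_nonneg_left (h1 w hw) (hω w hw)
    _ = ∑ i ∈ H, ∑ j ∈ H, ∑ k ∈ H, ∑ w ∈ G.filter (fun w => T w i j k), ω w := by
        simp_rw [Finset.mul_sum, mul_ite, mul_one, mul_zero]
        rw [Finset.sum_comm]
        refine Finset.sum_congr rfl fun i _ => ?_
        rw [Finset.sum_comm]
        refine Finset.sum_congr rfl fun j _ => ?_
        rw [Finset.sum_comm]
        refine Finset.sum_congr rfl fun k _ => ?_
        rw [Finset.sum_filter]
    _ ≤ ∑ i ∈ H, ∑ j ∈ H, ∑ k ∈ H, V := by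
        refine Finset.sum_le_sum fun i _ => Finset.sum_le_sum fun j _ =>
          Finset.sum_le_sum fun k _ => ?_
        rcases (G.filter (fun w => T w i j k)).eq_empty_or_nonempty with he | ⟨w, hw⟩
        · rw [he, Finset.sum_empty]; exact hV
        obtain ⟨hw, r₁, r₂, r₃, p₁, p₂, p₃, h12, h13, h23⟩ := Finset.mem_filter.1 hw
        refine le_trans (Finset.sum_le_sum_of_subset_of_nonneg ?_ ?_) (hball w hw)
        · intro w' hw'
          obtain ⟨hw', s₁, s₂, s₃, q₁, q₂, q₃, -⟩ := Finset.mem_filter.1 hw'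
          refine Finset.mem_filter.2 ⟨hw', ?_⟩
          have e : ∀ v : E3, w' - v = (w - v) + (w' - w) := fun v => by abel
          refine Tangent.norm_le hd hτ hτ1 p₁.2.1 p₁.2.2.1 p₂.2.1 p₂.2.2.1 p₃.2.1 p₃.2.2.1
            h12 h13 h23 p₁.2.2.2 p₂.2.2.2 p₃.2.2.2 (s₁ := s₁) (s₂ := s₂) (s₃ := s₃)
            ?_ ?_ ?_ hs (hG w hw w' hw') hη
          · rw [← e]; exact q₁.2.2.2
          · rw [← e]; exact q₂.2.2.2
          · rw [← e]; exact q₃.2.2.2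
        · intro w' hw' _
          exact hω w' (Finset.mem_filter.1 hw').1
    _ = V * (H.card : ℝ) ^ 3 := by
        simp only [Finset.sum_const, nsmul_eq_mul]; ring

/-- The index of the half-open cube of side `ℓ` containing `w`. -/
def cell (ℓ : ℝ) (w : E3) : Fin 3 → ℤ := fun i => ⌊w i / ℓ⌋

theorem abs_coord_sub_le_of_cell_eq {ℓ : ℝ} (hℓ : 0 < ℓ) {w w' : E3} (h : cell ℓ w = cell ℓ w')
    (i : Fin 3) : |(w - w') i| ≤ ℓ := by
  have := Int.abs_sub_lt_one_of_floor_eq_floor (congrFun h i)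
  rw [← sub_div, abs_div, abs_of_pos hℓ, div_lt_one hℓ] at this
  simpa using this.le

theorem norm_sub_le_of_cell_eq {ℓ : ℝ} (hℓ : 0 < ℓ) {w w' : E3} (h : cell ℓ w = cell ℓ w') :
    ‖w - w'‖ ≤ 2 * ℓ := by
  have h0 := abs_le.1 (abs_coord_sub_le_of_cell_eq hℓ h 0)
  have h1 := abs_le.1 (abs_coord_sub_le_of_cell_eq hℓ h 1)
  have h2 := abs_le.1 (abs_coord_sub_le_of_cell_eq hℓ h 2)
  refine abs_le_of_sq_le_sq' ?_ (by positivity) |>.2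
  rw [norm_sq_E3]
  nlinarith

theorem card_image_cell_le (A : Finset E3) (w₀ : E3) {ℓ D : ℝ} (hℓ : 0 < ℓ) (hD : 0 ≤ D)
    (hA : ∀ w ∈ A, ‖w - w₀‖ ≤ D) : ((A.image (cell ℓ)).card : ℝ) ≤ (2 * D / ℓ + 2) ^ 3 := by
  set T : Finset (Fin 3 → ℤ) :=
    Fintype.piFinset fun i => Finset.Icc ⌊(w₀ i - D) / ℓ⌋ ⌊(w₀ i + D) / ℓ⌋ with hT
  have hsub : A.image (cell ℓ) ⊆ T := by
    intro c hc
    obtain ⟨w, hw, rfl⟩ := Finset.mem_image.1 hc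
    rw [hT, Fintype.mem_piFinset]
    intro i
    have h1 := abs_le.1 ((abs_coord_le (w - w₀) i).trans (hA w hw))
    simp only [PiLp.sub_apply] at h1
    rw [Finset.mem_Icc]
    exact ⟨Int.floor_le_floor (by gcongr; linarith), Int.floor_le_floor (by gcongr; linarith)⟩
  refine (Nat.cast_le.2 (Finset.card_le_card hsub)).trans ?_
  rw [hT, Fintype.card_piFinset, Nat.cast_prod, Fin.prod_univ_three]
  have hi : ∀ i, ((Finset.Icc ⌊(w₀ i - D) / ℓ⌋ ⌊(w₀ i + D) / ℓ⌋).card : ℝ) ≤ 2 * D / ℓ + 2 := by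
    intro i
    rw [Int.card_Icc]
    have hle : ⌊(w₀ i - D) / ℓ⌋ ≤ ⌊(w₀ i + D) / ℓ⌋ := Int.floor_le_floor (by gcongr; linarith)
    have : (((⌊(w₀ i + D) / ℓ⌋ + 1 - ⌊(w₀ i - D) / ℓ⌋).toNat : ℤ) : ℝ)
        = (⌊(w₀ i + D) / ℓ⌋ + 1 - ⌊(w₀ i - D) / ℓ⌋ : ℝ) := by
      rw [Int.toNat_of_nonneg (by omega)]; push_cast; ring
    rw [← Int.cast_natCast, this]
    have h1 := Int.floor_le ((w₀ i + D) / ℓ)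
    have h2 := Int.lt_floor_add_one ((w₀ i - D) / ℓ)
    have h3 : 2 * D / ℓ = (w₀ i + D) / ℓ - (w₀ i - D) / ℓ := by ring
    rw [h3]; linarith
  calc _ ≤ (2 * D / ℓ + 2) * (2 * D / ℓ + 2) * (2 * D / ℓ + 2) := by
        gcongr <;> exact hi _
    _ = _ := by ring

theorem card_le_card_image_mul {ι κ : Type*} [DecidableEq κ] (A : Finset ι) (f : ι → κ) {V : ℝ}
    (h : ∀ i ∈ A, ((A.filter (fun j => f j = f i)).card : ℝ) ≤ V) :
    (A.card : ℝ) ≤ (A.image f).card * V := by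
  rw [Finset.card_eq_sum_card_image f A, Nat.cast_sum, ← nsmul_eq_mul, ← Finset.sum_const]
  refine Finset.sum_le_sum fun c hc => ?_
  obtain ⟨i, hi, rfl⟩ := Finset.mem_image.1 hc
  exact h i hi

theorem exists_card_le_mul_card_fiber {ι κ : Type*} [DecidableEq κ] {A : Finset ι} (hA : A.Nonempty) (f : ι → κ)
    {N : ℝ} (hN : ((A.image f).card : ℝ) ≤ N) :
    ∃ i ∈ A, (A.card : ℝ) ≤ N * (A.filter (fun j => f j = f i)).card := by
  obtain ⟨i, hi, hmax⟩ := Finset.exists_max_image A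
    (fun i => ((A.filter (fun j => f j = f i)).card : ℝ)) hA
  exact ⟨i, hi, (card_le_card_image_mul A f hmax).trans (by gcongr)⟩

theorem sum_inv_card_fiber_le {ι κ : Type*} [DecidableEq κ] (G A : Finset ι) (hAG : A ⊆ G) (f : ι → κ) :
    ∑ i ∈ A, (1 : ℝ) / (G.filter (fun j => f j = f i)).card ≤ (A.image f).card := by
  rw [← Finset.sum_fiberwise_of_maps_to (t := A.image f) (g := f)
    (fun i hi => Finset.mem_image_of_mem f hi)]
  rw [← nsmul_one, ← Finset.sum_const]
  refine Finset.sum_le_sum fun c hc => ?_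
  have : ∀ i ∈ A.filter (fun i => f i = c), (1 : ℝ) / (G.filter (fun j => f j = f i)).card
      = 1 / (G.filter (fun j => f j = c)).card := by
    intro i hi
    rw [(Finset.mem_filter.1 hi).2]
  rw [Finset.sum_congr rfl this, Finset.sum_const, nsmul_eq_mul, mul_one_div]
  refine div_le_one_of_le₀ ?_ (by positivity)
  exact Nat.cast_le.2 (Finset.card_le_card (Finset.filter_subset_filter _ hAG))

theorem card_sq_le_card_image_mul {ι κ : Type*} [DecidableEq κ] (A : Finset ι) (f : ι → κ) :
    (A.card : ℝ) ^ 2 ≤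
      (A.image f).card * ∑ i ∈ A, ((A.filter (fun j => f j = f i)).card : ℝ) := by
  have h1 : ∑ i ∈ A, ((A.filter (fun j => f j = f i)).card : ℝ)
      = ∑ c ∈ A.image f, ((A.filter (fun j => f j = c)).card : ℝ) ^ 2 := by
    rw [← Finset.sum_fiberwise_of_maps_to (t := A.image f) (g := f)
      (fun i hi => Finset.mem_image_of_mem f hi)]
    refine Finset.sum_congr rfl fun c _ => ?_
    rw [Finset.sum_congr rfl (g := fun _ => ((A.filter (fun j => f j = c)).card : ℝ)), Finset.sum_const,
      nsmul_eq_mul, sq]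
    intro i hi
    rw [(Finset.mem_filter.1 hi).2]
  rw [h1, Finset.card_eq_sum_card_image f A, Nat.cast_sum]
  exact sq_sum_le_card_mul_sum_sq

/-- The `J`-th interval in the partition of `[1/2, 1)` into intervals of length `ρ`. -/
def slab (ρ : ℝ) (J : ℕ) : Set ℝ := Set.Ico (1 / 2 + J * ρ) (1 / 2 + (J + 1) * ρ)

theorem len_biUnion_le {ι : Type*} (s : Finset ι) (S : ι → Set ℝ) :
    len (⋃ i ∈ s, S i) ≤ ∑ i ∈ s, len (S i) := by
  induction s using Finset.induction_on with
  | empty => simp [len]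
  | insert i s hi ih =>
    rw [Finset.set_biUnion_insert, Finset.sum_insert hi]
    exact (len_union_le _ _).trans (by gcongr)

theorem slab_index {ρ : ℝ} {M : ℕ} (hM : 0 < M) (hρ : ρ = 1 / (2 * M)) {r : ℝ} (h1 : 1 / 2 ≤ r)
    (h2 : r < 1) : ∃ J ∈ Finset.range M, r ∈ slab ρ J := by
  have hM' : (0 : ℝ) < M := by exact_mod_cast hM
  have hρ0 : 0 < ρ := by rw [hρ]; positivity
  have hMρ : M * ρ = 1 / 2 := by rw [hρ]; field_simp
  refine ⟨⌊(r - 1 / 2) / ρ⌋₊, ?_, ?_, ?_⟩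
  · rw [Finset.mem_range, Nat.floor_lt (div_nonneg (by linarith) hρ0.le), div_lt_iff₀ hρ0]
    linarith
  · have := Nat.floor_le (div_nonneg (by linarith : 0 ≤ r - 1 / 2) hρ0.le)
    rw [le_div_iff₀ hρ0] at this
    linarith
  · have := Nat.lt_floor_add_one ((r - 1 / 2) / ρ)
    rw [div_lt_iff₀ hρ0] at this
    linarith

theorem slab_bounds {ρ : ℝ} {M J : ℕ} (hM : 0 < M) (hρ : ρ = 1 / (2 * M)) (hJ : J < M) :
    (1 / 2 : ℝ) ≤ 1 / 2 + J * ρ ∧ 1 / 2 + (J + 1) * ρ ≤ 1 := by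
  have hM' : (0 : ℝ) < M := by exact_mod_cast hM
  have hρ0 : 0 < ρ := by rw [hρ]; positivity
  have hMρ : M * ρ = 1 / 2 := by rw [hρ]; field_simp
  have : ((J : ℝ) + 1) ≤ M := by exact_mod_cast hJ
  constructor
  · have : 0 ≤ (J : ℝ) * ρ := by positivity
    linarith
  · nlinarith

theorem len_le_sum_slab {ρ : ℝ} {M : ℕ} (hM : 0 < M) (hρ : ρ = 1 / (2 * M)) (S : Set ℝ) :
    len S ≤ ∑ J ∈ Finset.range M, len (S ∩ slab ρ J) := by
  have h1 : len ({1} : Set ℝ) ≤ 0 := by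
    refine len_le_of_abs_sub_le le_rfl ?_
    rintro r hr r' hr' - - - -
    rw [hr, hr', sub_self]
  calc len S ≤ len ({1} ∪ ⋃ J ∈ Finset.range M, (S ∩ slab ρ J)) := by
        apply len_mono
        rintro r ⟨hr, hr1, hr2⟩
        rcases hr2.eq_or_lt with h | h
        · exact Or.inl h
        · obtain ⟨J, hJ, hrJ⟩ := slab_index hM hρ hr1 h
          exact Or.inr (Set.mem_biUnion hJ ⟨hr, hrJ⟩)
    _ ≤ _ := by
        have := len_union_le {1} (⋃ J ∈ Finset.range M, (S ∩ slab ρ J))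
        have := len_biUnion_le (Finset.range M) (fun J => S ∩ slab ρ J)
        linarith

theorem slab_disjoint {ρ : ℝ} (hρ : 0 < ρ) : Pairwise (Function.onFun Disjoint (slab ρ)) := by
  have key : ∀ i j : ℕ, i < j → Disjoint (slab ρ i) (slab ρ j) := by
    intro i j hij
    rw [Set.disjoint_left]
    rintro r ⟨-, h1⟩ ⟨h2, -⟩
    have : ((i : ℝ) + 1) ≤ j := by exact_mod_cast hij
    nlinarith
  intro i j hij
  rcases lt_or_gt_of_ne hij with h | h
  · exact key i j h
  · exact (key j i h).symm

theorem sum_slab_le_len {ρ : ℝ} {M : ℕ} (hρ : 0 < ρ) {S : Set ℝ} (hS : MeasurableSet S) :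
    ∑ J ∈ Finset.range M, len (S ∩ slab ρ J) ≤ len S := by
  unfold len
  rw [← ENNReal.toReal_sum (fun J _ => (volume_inter_Icc_lt_top _).ne),
    ← measure_biUnion_finset]
  · refine ENNReal.toReal_mono (volume_inter_Icc_lt_top S).ne (measure_mono ?_)
    intro r hr
    obtain ⟨J, -, hr⟩ := Set.mem_iUnion₂.1 hr
    exact ⟨hr.1.1, hr.2⟩
  · intro i _ j _ hij
    exact (slab_disjoint hρ hij).mono (fun r hr => hr.1.2) (fun r hr => hr.1.2)
  · intro i _
    exact (hS.inter measurableSet_Ico).inter measurableSet_Icc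

theorem len_slab_of_subset {ρ : ℝ} {M J : ℕ} (hM : 0 < M) (hρ : ρ = 1 / (2 * M)) (hJ : J < M)
    {S : Set ℝ} (hS : slab ρ J ⊆ S) : ρ ≤ len (S ∩ slab ρ J) := by
  have hb := slab_bounds hM hρ hJ
  have hρ0 : 0 < ρ := by rw [hρ]; positivity
  have : S ∩ slab ρ J ∩ Set.Icc (1 / 2 : ℝ) 1 = slab ρ J := by
    ext r
    constructor
    · exact fun h => h.1.2
    · exact fun h => ⟨⟨hS h, h⟩, hb.1.trans h.1, h.2.le.trans hb.2⟩
  rw [len, this, slab, Real.volume_Ico, ENNReal.toReal_ofReal] <;> nlinarith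

theorem len_inter_slab_le {ρ : ℝ} (hρ : 0 < ρ) (J : ℕ) (S : Set ℝ) : len (S ∩ slab ρ J) ≤ ρ := by
  refine len_le_of_abs_sub_le hρ.le ?_
  rintro r ⟨-, h1, h2⟩ r' ⟨-, h3, h4⟩ - - - -
  nlinarith

theorem measurableSet_tangent (a β d₁ d₂ : ℝ) (u : E3) :
    MeasurableSet {r | Tangent a β d₁ d₂ u r} :=
  (measurableSet_sublevel u a).inter ((measurableSet_flat u β).inter
    ((MeasurableSet.const _).inter (MeasurableSet.const _)))

theorem len_setOf_tangent_le {a β d₁ d₂ : ℝ} (hd : 0 < d₁) (hβ : 0 ≤ β) (hs : a + 2 * β ≤ d₁ / 2)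
    (u : E3) : len {r | Tangent a β d₁ d₂ u r} ≤ 10 * β / d₁ := by
  by_cases hu : d₁ ≤ ‖u‖
  · refine (len_mono ?_).trans ((len_tangent_le u (a := a) hβ (hd.trans_le hu) (by linarith)).trans ?_)
    · exact fun r hr => ⟨hr.1.1, hr.1.2.1⟩
    · gcongr
  · refine (len_mono (T := ∅) fun r hr => hu hr.1.2.2.1).trans ?_
    simp only [len, Set.empty_inter, measure_empty, ENNReal.toReal_zero]
    positivity

theorem natCast_card_le_of_sub_le (T : Finset ℕ) {B : ℝ} (hB : 0 ≤ B)
    (h : ∀ i ∈ T, ∀ j ∈ T, (i : ℝ) - j ≤ B) : (T.card : ℝ) ≤ B + 1 := by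
  rcases T.eq_empty_or_nonempty with rfl | hT
  · simp; linarith
  have hsub : T ⊆ Finset.Icc (T.min' hT) (T.min' hT + ⌊B⌋₊) := by
    intro i hi
    rw [Finset.mem_Icc]
    refine ⟨Finset.min'_le _ _ hi, ?_⟩
    have h1 := h i hi _ (T.min'_mem hT)
    have hle := Finset.min'_le T i hi
    have : i - T.min' hT ≤ ⌊B⌋₊ := by
      apply Nat.le_floor
      rw [Nat.cast_sub hle]
      exact h1
    omega
  have := Finset.card_le_card hsub
  rw [Nat.card_Icc] at this
  have h2 : T.card ≤ ⌊B⌋₊ + 1 := by omega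
  have h3 : (T.card : ℝ) ≤ ⌊B⌋₊ + 1 := by exact_mod_cast h2
  linarith [Nat.floor_le hB]

theorem Tangent.of_close (w : E3) {r r₀ ρ a β : ℝ} (hρ : 0 ≤ ρ)
    (h0 : |r - r₀| ≤ ρ) {d₁ d₂ : ℝ} (h : Tangent a β d₁ d₂ w r) :
    Tangent (a + ρ * (β + ρ * d₂)) (β + ρ * d₂) d₁ d₂ w r₀ := by
  obtain ⟨h1, h2, h3, h4⟩ := h
  have hu2 : |w 2| ≤ d₂ := (abs_coord_le w 2).trans h4
  have hd : ∀ s : ℝ, |s - r| ≤ ρ → |quadDeriv w s| ≤ β + ρ * d₂ := by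
    intro s hs
    have e : quadDeriv w s = quadDeriv w r + (s - r) * w 2 := by unfold quadDeriv; ring
    rw [e]
    refine (abs_add_le _ _).trans (add_le_add h2 ?_)
    rw [abs_mul]
    exact mul_le_mul hs hu2 (abs_nonneg _) hρ
  refine ⟨?_, hd r₀ (by rwa [abs_sub_comm]), h3, h4⟩
  have e : quadEval w r₀ = quadEval w r - (r - r₀) * quadDeriv w ((r + r₀) / 2) := by
    rw [← quadEval_sub_eq]; ring
  rw [e]
  refine (abs_sub _ _).trans (add_le_add h1 ?_)
  rw [abs_mul]
  refine mul_le_mul h0 (hd _ ?_) (abs_nonneg _) hρ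
  rw [show (r + r₀) / 2 - r = -((r - r₀) / 2) by ring, abs_neg, abs_div, abs_two]
  linarith [abs_nonneg (r - r₀)]

theorem mul_len_slab_le_card (H : Finset E3) (w : E3) {E : Set ℝ} (hE : MeasurableSet E)
    {δ ρ c q : ℝ} (hδ : 0 < δ) (hρ : 0 ≤ ρ) (hδρ : δ ≤ ρ ^ 2) (hρ1 : ρ ≤ 1 / 10) (J : ℕ)
    (hc : ∀ r ∈ E, 1 / 2 ≤ r → r ≤ 1 →
      c ≤ (H.filter (fun w' => Tangent δ δ 1 2 (w - w') r)).card)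
    (hc0 : 0 ≤ c) (hq : q ≤ len (E ∩ slab ρ J)) :
    c * q ≤ (H.filter (fun w' => Tangent (4 * ρ ^ 2) (4 * ρ) 1 2 (w - w')
      (1 / 2 + J * ρ))).card * (10 * δ) := by
  have hδ1 : δ ≤ 1 / 100 := by nlinarith
  have h1 := mul_len_le_card_mul H (fun w' => {r | Tangent δ δ 1 2 (w - w') r})
    (fun w' _ => measurableSet_tangent _ _ _ _ _) (R := E ∩ slab ρ J)
    (hE.inter measurableSet_Ico) (c := c) (D := 10 * δ)
    (fun r hr h1 h2 => hc r hr.1 h1 h2)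
    (fun w' _ => (len_setOf_tangent_le one_pos hδ.le (by linarith) _).trans (by simp))
  refine (mul_le_mul_of_nonneg_left hq hc0).trans (h1.trans ?_)
  refine mul_le_mul_of_nonneg_right (Nat.cast_le.2 (Finset.card_le_card ?_)) (by positivity)
  intro w' hw'
  obtain ⟨hw', r, ⟨-, hr1, hr2⟩, -, -, ht⟩ := Finset.mem_filter.1 hw'
  refine Finset.mem_filter.2 ⟨hw', ?_⟩
  have hclose : |r - (1 / 2 + J * ρ)| ≤ ρ := by
    rw [abs_le]; constructor <;> linarith
  have := Tangent.of_close (w - w') hρ hclose ht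
  exact ⟨this.1.trans (by nlinarith), this.2.1.trans (by nlinarith), this.2.2⟩

theorem card_slab_tangent_le (u : E3) {ρ : ℝ} {M : ℕ} (hM : 0 < M) (hρ : ρ = 1 / (2 * M))
    (hρ1 : ρ ≤ 1 / 100) (T : Finset ℕ) (hT : ∀ J ∈ T, J < M) :
    ((T.filter (fun J : ℕ => Tangent (8 * ρ) (8 * ρ) (1 / 2) 3 u (1 / 2 + J * ρ))).card : ℝ)
      ≤ 161 := by
  have hM' : (0 : ℝ) < M := by exact_mod_cast hM
  have hρ0 : 0 < ρ := by rw [hρ]; positivity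
  rw [show (161 : ℝ) = 160 + 1 by norm_num]
  refine natCast_card_le_of_sub_le _ (by norm_num) ?_
  intro i hi j hj
  obtain ⟨hi, h1⟩ := Finset.mem_filter.1 hi
  obtain ⟨hj, h2⟩ := Finset.mem_filter.1 hj
  have bi := slab_bounds hM hρ (hT i hi)
  have hz := norm_le_of_tangent u (by linarith) (by nlinarith) h1.1 h1.2.1
  have hz' : 1 / 10 ≤ |u 2| := by linarith [h1.2.2.1]
  have hd := quadDeriv_sub_eq u (1 / 2 + i * ρ) (1 / 2 + j * ρ)
  have h3 : |(1 / 2 + i * ρ) - (1 / 2 + j * ρ)| * |u 2| ≤ 16 * ρ := by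
    rw [← abs_mul, ← hd]
    exact (abs_sub _ _).trans (by linarith [h1.2.1, h2.2.1])
  have h4 := mul_le_mul_of_nonneg_left hz' (abs_nonneg ((1 / 2 + i * ρ) - (1 / 2 + j * ρ)))
  have h5 := le_abs_self ((1 / 2 + i * ρ) - (1 / 2 + j * ρ))
  have h6 : ((i : ℝ) - j) * ρ ≤ 160 * ρ := by linarith
  exact le_of_mul_le_mul_right h6 hρ0

theorem card_mul_le_of_incidence {ι κ : Type*} (T : Finset ι) (H : Finset κ) (P : ι → κ → Prop)
    {c K : ℝ} (hT : ∀ i ∈ T, c ≤ (H.filter (P i)).card)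
    (hH : ∀ j ∈ H, ((T.filter (fun i => P i j)).card : ℝ) ≤ K) :
    T.card * c ≤ (H.filter (fun j => ∃ i ∈ T, P i j)).card * K := by
  calc (T.card : ℝ) * c = ∑ i ∈ T, c := by rw [Finset.sum_const, nsmul_eq_mul]
    _ ≤ ∑ i ∈ T, ((H.filter (P i)).card : ℝ) := Finset.sum_le_sum hT
    _ = ∑ i ∈ T, ∑ j ∈ H, if P i j then (1 : ℝ) else 0 := by
        refine Finset.sum_congr rfl fun i _ => ?_
        rw [Finset.card_filter]; push_cast; rfl
    _ = ∑ j ∈ H, ∑ i ∈ T, if P i j then (1 : ℝ) else 0 := Finset.sum_comm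
    _ = ∑ j ∈ H, ((T.filter (fun i => P i j)).card : ℝ) := by
        refine Finset.sum_congr rfl fun i _ => ?_
        rw [Finset.card_filter]; push_cast; rfl
    _ ≤ ∑ j ∈ H, if (∃ i ∈ T, P i j) then K else 0 := by
        refine Finset.sum_le_sum fun j hj => ?_
        split_ifs with h
        · exact hH j hj
        · push Not at h
          rw [Finset.filter_false_of_mem h]; simp
    _ = _ := by rw [← Finset.sum_filter, Finset.sum_const, nsmul_eq_mul]

theorem card_bad_le (G H : Finset E3) {ρ x y : ℝ} {M : ℕ} (hM : 0 < M) (hρ : ρ = 1 / (2 * M))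
    (hy : 100000 ≤ y) (hyx : y ≤ x) (hρy : ρ * y ^ 5 ≤ 1)
    (hG : ∀ w ∈ G, ∀ w' ∈ G, ‖w' - w‖ * y ^ 5 ≤ 1) (hH : H.Nonempty) (θ : E3 → ℝ)
    (hθ0 : ∀ w ∈ G, 0 < θ w)
    (hθ : ∀ w ∈ G, H.card * θ w ^ 3 = (G.filter (fun w' => cell ρ w' = cell ρ w)).card) :
    ((G.filter (fun w => M / (2 * y) ≤ ((Finset.range M).filter (fun J : ℕ =>
      x ^ 8 * ρ * H.card * θ w ≤ (H.filter (fun w' =>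
        Tangent (8 * ρ) (8 * ρ) (1 / 2) 3 (w - w') (1 / 2 + J * ρ))).card)).card)).card : ℝ)
      * x ^ 2 ≤ H.card := by
  have hM' : (0 : ℝ) < M := by exact_mod_cast hM
  have hρ0 : 0 < ρ := by rw [hρ]; positivity
  have hMρ : M * ρ = 1 / 2 := by rw [hρ]; field_simp
  have hy0 : 0 < y := by linarith
  have hx0 : 0 < x := by linarith
  have hh : (0 : ℝ) < H.card := by exact_mod_cast hH.card_pos
  have hy5 : (100000 : ℝ) ^ 5 ≤ y ^ 5 := pow_le_pow_left₀ (by norm_num) hy 5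
  have hρ1 : ρ ≤ 1 / 100 := by
    have : ρ * 100000 ^ 5 ≤ 1 := (mul_le_mul_of_nonneg_left hy5 hρ0.le).trans hρy
    linarith
  set h : ℝ := (H.card : ℝ) with hh_def
  set B := G.filter (fun w : E3 => M / (2 * y) ≤ (((Finset.range M).filter (fun J : ℕ =>
      x ^ 8 * ρ * h * θ w ≤ (H.filter (fun w' =>
        Tangent (8 * ρ) (8 * ρ) (1 / 2) 3 (w - w') (1 / 2 + J * ρ))).card)).card : ℝ)) with hB
  have hBG : B ⊆ G := Finset.filter_subset _ _
  set ω : E3 → ℝ := fun w => 1 / (G.filter (fun w' => cell ρ w' = cell ρ w)).card with hω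
  have hMy : 16 * y ≤ M := by
    have h1 : y ^ 5 ≤ 2 * M := by
      have : y ^ 5 * ρ ≤ (2 * M) * ρ := by linarith
      exact le_of_mul_le_mul_right this hρ0
    have h2 : (100000:ℝ) ^ 4 ≤ y ^ 4 := pow_le_pow_left₀ (by norm_num) hy 4
    nlinarith
  have kst := sum_weight_mul_pow_three_le B H ω (fun w => x ^ 8 * h * θ w / (1288 * y))
    (fun w => {r | ∃ J ∈ Finset.range M, x ^ 8 * ρ * h * θ w ≤ (H.filter (fun w' =>
        Tangent (8 * ρ) (8 * ρ) (1 / 2) 3 (w - w') (1 / 2 + J * ρ))).card ∧ r = 1 / 2 + J * ρ})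
    (a := 8 * ρ) (β := 8 * ρ) (d₁ := 1 / 2) (d₂ := 3) (τ := 1 / y ^ 2) (η := 1 / y ^ 5)
    (V := y ^ 16) (fun w _ => by positivity)
    (fun w hw => by have := hθ0 w (hBG hw); positivity) (by positivity) (by norm_num)
    (by positivity) ?_ (by linarith) ?_ ?_ ?_ ?_
  · have e : ∀ w ∈ B, ω w * (x ^ 8 * h * θ w / (1288 * y)) ^ 3
        = x ^ 24 * h ^ 2 / (1288 * y) ^ 3 := by
      intro w hw
      have h1 := hθ w (hBG hw)
      have h2 := hθ0 w (hBG hw)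
      rw [hω]; simp only
      rw [← h1]
      field_simp
    rw [Finset.sum_congr rfl e, Finset.sum_const, nsmul_eq_mul, mul_div_assoc', div_le_iff₀ (by positivity)] at kst
    have h19 : y ^ 16 * (1288 * y) ^ 3 ≤ x ^ 22 := by
      have : y ^ 16 * (1288 * y) ^ 3 = y ^ 19 * (1288 ^ 3) := by ring
      rw [this]
      calc y ^ 19 * (1288 ^ 3) ≤ y ^ 19 * y ^ 3 := by
            gcongr; linarith
        _ = y ^ 22 := by ring
        _ ≤ x ^ 22 := by gcongr
    have h20 : (B.card : ℝ) * x ^ 2 * (x ^ 22 * h ^ 2) ≤ h * (x ^ 22 * h ^ 2) := by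
      calc (B.card : ℝ) * x ^ 2 * (x ^ 22 * h ^ 2) = B.card * (x ^ 24 * h ^ 2) := by ring
        _ ≤ y ^ 16 * h ^ 3 * (1288 * y) ^ 3 := kst
        _ = (y ^ 16 * (1288 * y) ^ 3) * h ^ 3 := by ring
        _ ≤ x ^ 22 * h ^ 3 := by gcongr
        _ = _ := by ring
    exact le_of_mul_le_mul_right h20 (by positivity)
  · rw [div_le_one (by positivity)]
    nlinarith
  · have h1 : ρ ≤ 1 / y ^ 5 := by rw [le_div_iff₀ (by positivity)]; exact hρy
    calc 300 * (1 / y ^ 5 + 2 * (8 * ρ) + 8 * ρ) ≤ 300 * (25 * (1 / y ^ 5)) := by linarith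
      _ ≤ (1 / y ^ 2) ^ 2 * (1 / 2) := by
        rw [show (1 / y ^ 2) ^ 2 * (1 / 2) = y * (1 / 2) / y ^ 5 by field_simp,
          show 300 * (25 * (1 / y ^ 5)) = 7500 / y ^ 5 by ring]
        exact div_le_div_of_nonneg_right (by linarith) (by positivity)
  · intro w hw w' hw'
    rw [le_div_iff₀ (by positivity)]
    exact hG w (hBG hw) w' (hBG hw')
  · intro w hw r₁ r₂
    obtain ⟨hwG, hwB⟩ := Finset.mem_filter.1 hw
    set T := (Finset.range M).filter (fun J : ℕ =>
      x ^ 8 * ρ * h * θ w ≤ (H.filter (fun w' =>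
        Tangent (8 * ρ) (8 * ρ) (1 / 2) 3 (w - w') (1 / 2 + J * ρ))).card) with hT
    set T' := T.filter (fun J : ℕ => 1 / y ^ 2 ≤ |(1 / 2 + J * ρ) - r₁| ∧
      1 / y ^ 2 ≤ |(1 / 2 + J * ρ) - r₂|) with hT'
    have close : ∀ s : ℝ,
        ((T.filter (fun J : ℕ => |(1 / 2 + J * ρ) - s| < 1 / y ^ 2)).card : ℝ)
          ≤ 2 * (1 / y ^ 2) / ρ + 1 := by
      intro s
      refine natCast_card_le_of_sub_le _ (by positivity) ?_
      intro i hi j hj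
      have h1 := abs_lt.1 (Finset.mem_filter.1 hi).2
      have h2 := abs_lt.1 (Finset.mem_filter.1 hj).2
      rw [le_div_iff₀ hρ0]
      linarith
    have hTT : T ⊆ T' ∪ (T.filter (fun J : ℕ => |(1 / 2 + J * ρ) - r₁| < 1 / y ^ 2) ∪
        T.filter (fun J : ℕ => |(1 / 2 + J * ρ) - r₂| < 1 / y ^ 2)) := by
      intro J hJ
      simp only [hT', Finset.mem_union, Finset.mem_filter, hJ, true_and]
      by_cases g1 : 1 / y ^ 2 ≤ |(1 / 2 + J * ρ) - r₁|
      · by_cases g2 : 1 / y ^ 2 ≤ |(1 / 2 + J * ρ) - r₂|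
        · exact Or.inl ⟨g1, g2⟩
        · exact Or.inr (Or.inr (not_le.1 g2))
      · exact Or.inr (Or.inl (not_le.1 g1))
    have hcT' : M / (4 * y) ≤ (T'.card : ℝ) := by
      have h1 := (Finset.card_le_card hTT).trans ((Finset.card_union_le _ _).trans
        (Nat.add_le_add_left (Finset.card_union_le _ _) _))
      have h2 : (T.card : ℝ) ≤ T'.card + (((T.filter (fun J : ℕ => |(1 / 2 + J * ρ) - r₁| < 1 / y ^ 2)).card : ℝ) +
        ((T.filter (fun J : ℕ => |(1 / 2 + J * ρ) - r₂| < 1 / y ^ 2)).card : ℝ)) := by exact_mod_cast h1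
      have c1 := close r₁
      have c2 := close r₂
      have e : 2 * (1 / y ^ 2) / ρ = 4 * M / y ^ 2 := by
        rw [hρ]; field_simp; ring
      have e2 : 4 * M / y ^ 2 ≤ M / (16 * y) := by
        rw [div_le_div_iff₀ (by positivity) (by positivity)]
        nlinarith [mul_pos hM' hy0]
      have e3 : 1 ≤ M / (16 * y) := by
        rw [le_div_iff₀ (by positivity)]; linarith
      have e4 : M / (2 * y) = 8 * (M / (16 * y)) := by field_simp; norm_num
      have e5 : M / (4 * y) = 4 * (M / (16 * y)) := by field_simp; norm_num
      rw [e] at c1 c2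
      linarith
    have inc := card_mul_le_of_incidence T' H (fun (J : ℕ) w' =>
        Tangent (8 * ρ) (8 * ρ) (1 / 2) 3 (w - w') (1 / 2 + J * ρ))
      (c := x ^ 8 * ρ * h * θ w) (K := 161)
      (fun J hJ => (Finset.mem_filter.1 (Finset.mem_filter.1 hJ).1).2)
      (fun w' _ => card_slab_tangent_le _ hM hρ hρ1 T' fun J hJ =>
        Finset.mem_range.1 (Finset.mem_filter.1 (Finset.mem_filter.1 hJ).1).1)
    have hle : ((H.filter (fun w' => ∃ J ∈ T',
        Tangent (8 * ρ) (8 * ρ) (1 / 2) 3 (w - w') (1 / 2 + J * ρ))).card : ℝ) ≤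
        (H.filter (fun w' => ∃ r, ((∃ J ∈ Finset.range M, x ^ 8 * ρ * h * θ w ≤ (H.filter (fun w' =>
          Tangent (8 * ρ) (8 * ρ) (1 / 2) 3 (w - w') (1 / 2 + J * ρ))).card ∧ r = 1 / 2 + J * ρ) ∧
          1 / 2 ≤ r ∧ r ≤ 1 ∧ Tangent (8 * ρ) (8 * ρ) (1 / 2) 3 (w - w') r) ∧
          1 / y ^ 2 ≤ |r - r₁| ∧ 1 / y ^ 2 ≤ |r - r₂|)).card := by
      refine Nat.cast_le.2 (Finset.card_le_card ?_)
      intro w' hw'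
      obtain ⟨hw', J, hJ, ht⟩ := Finset.mem_filter.1 hw'
      obtain ⟨hJT, hJ1, hJ2⟩ := Finset.mem_filter.1 hJ
      obtain ⟨hJM, hJA⟩ := Finset.mem_filter.1 hJT
      have b := slab_bounds hM hρ (Finset.mem_range.1 hJM)
      exact Finset.mem_filter.2 ⟨hw', _, ⟨⟨J, hJM, hJA, rfl⟩, b.1, by linarith [b.2], ht⟩, hJ1, hJ2⟩
    have hθw := hθ0 w hwG
    have hfin : x ^ 8 * h * θ w / (1288 * y) * 161 ≤ T'.card * (x ^ 8 * ρ * h * θ w) := by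
      calc x ^ 8 * h * θ w / (1288 * y) * 161 = (1 / (8 * y)) * (x ^ 8 * h * θ w) := by
            field_simp; norm_num
        _ = (M / (4 * y)) * (x ^ 8 * ρ * h * θ w) := by
            rw [show (M / (4 * y)) * (x ^ 8 * ρ * h * θ w) = (M * ρ) / (4 * y) * (x ^ 8 * h * θ w) by ring, hMρ]
            congr 1; field_simp; norm_num
        _ ≤ _ := by gcongr
    have := hfin.trans inc
    exact (le_of_mul_le_mul_right this (by norm_num)).trans hle
  · intro w hw
    set A := B.filter (fun w' => ‖w' - w‖ ≤
      300 * ((8 * ρ) ^ 2 + 2 * 3 * (8 * ρ)) / ((1 / y ^ 2) ^ 2 * (1 / 2))) with hA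
    have h1 := sum_inv_card_fiber_le G A ((Finset.filter_subset _ _).trans hBG) (cell ρ)
    refine h1.trans ?_
    have h2 := card_image_cell_le A w (ℓ := ρ) (D := y ^ 5 * ρ) hρ0 (by positivity) ?_
    · refine h2.trans ?_
      rw [show 2 * (y ^ 5 * ρ) / ρ + 2 = 2 * y ^ 5 + 2 by field_simp]
      calc (2 * y ^ 5 + 2) ^ 3 ≤ (3 * y ^ 5) ^ 3 := by gcongr; linarith
        _ = 27 * y ^ 15 := by ring
        _ ≤ y * y ^ 15 := by gcongr; linarith
        _ = _ := by ring
    · intro w' hw'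
      refine (Finset.mem_filter.1 hw').2.trans ?_
      rw [div_le_iff₀ (by positivity)]
      rw [show y ^ 5 * ρ * ((1 / y ^ 2) ^ 2 * (1 / 2)) = y / 2 * ρ by field_simp]
      nlinarith

theorem sum_card_filter_comm {ι κ : Type*} (T : Finset ι) (H : Finset κ) (P : ι → κ → Prop)
    [∀ i, DecidablePred (P i)] [∀ j, DecidablePred (fun i => P i j)] :
    ∑ i ∈ T, ((H.filter (P i)).card : ℝ) = ∑ j ∈ H, ((T.filter (fun i => P i j)).card : ℝ) := by
  simp_rw [Finset.card_filter]
  push_cast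
  exact Finset.sum_comm

theorem card_image_floor_mul_le (U H : Finset E3) {ρ r₀ σ Λ : ℝ} (hρ : 0 < ρ) (hρ1 : ρ ≤ 1 / 10)
    (h0 : 0 ≤ r₀) (h1 : r₀ ≤ 1)
    (hU : ∀ w ∈ U, ∀ w' ∈ U, ∀ i, |(w - w') i| ≤ ρ)
    (hσ : ∀ w ∈ U, σ ≤ (H.filter (fun w' => Tangent (4 * ρ ^ 2) (4 * ρ) 1 2 (w - w') r₀)).card)
    (hΛ : ∀ w ∈ U, ((H.filter (fun w' => Tangent (8 * ρ) (8 * ρ) (1 / 2) 3 (w - w') r₀)).card : ℝ)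
      ≤ Λ) (hne : U.Nonempty) :
    ((U.image (fun w => ⌊quadEval w r₀ / (8 * ρ ^ 2)⌋)).card : ℝ) * σ ≤ 2 * Λ := by
  set k : E3 → ℤ := fun w => ⌊quadEval w r₀ / (8 * ρ ^ 2)⌋ with hk
  have hrep : ∀ c : ℤ, ∃ w, c ∈ U.image k → w ∈ U ∧ k w = c := by
    intro c
    by_cases hc : c ∈ U.image k
    · obtain ⟨w, hw, e⟩ := Finset.mem_image.1 hc
      exact ⟨w, fun _ => ⟨hw, e⟩⟩
    · exact ⟨0, fun h => absurd h hc⟩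
  choose rep hrep using hrep
  have inc := card_mul_le_of_incidence (U.image k) H
    (fun c w' => Tangent (4 * ρ ^ 2) (4 * ρ) 1 2 (rep c - w') r₀) (c := σ) (K := 2)
    (fun c hc => hσ _ (hrep c hc).1) ?_
  · refine inc.trans ?_
    rw [mul_comm]
    refine mul_le_mul_of_nonneg_left ?_ (by norm_num)
    obtain ⟨w₀, hw₀⟩ := hne
    refine le_trans (Nat.cast_le.2 (Finset.card_le_card ?_)) (hΛ w₀ hw₀)
    intro w' hw'
    obtain ⟨hw', c, hc, t1, t2, t3, t4⟩ := Finset.mem_filter.1 hw'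
    refine Finset.mem_filter.2 ⟨hw', ?_⟩
    have hco := hU w₀ hw₀ _ (hrep c hc).1
    have e : w₀ - w' = (w₀ - rep c) + (rep c - w') := by abel
    have q1 := abs_quadEval_le (w₀ - rep c) h0 h1
    have q2 := abs_quadDeriv_le (w₀ - rep c) h0 h1
    have c0 := hco 0
    have c1 := hco 1
    have c2 := hco 2
    have hn : ‖w₀ - rep c‖ ≤ 3 * ρ := (norm_le_abs_coord_sum _).trans (by linarith)
    rw [e]
    refine ⟨?_, ?_, ?_, ?_⟩
    · rw [quadEval_add]
      exact (abs_add_le _ _).trans (by nlinarith)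
    · rw [quadDeriv_add]
      exact (abs_add_le _ _).trans (by linarith)
    · have := norm_sub_le ((w₀ - rep c) + (rep c - w')) (w₀ - rep c)
      rw [add_sub_cancel_left] at this
      linarith
    · exact (norm_add_le _ _).trans (by linarith)
  · intro w' _
    set n := ⌊(quadEval w' r₀ - 4 * ρ ^ 2) / (8 * ρ ^ 2)⌋ with hn
    have hsub : (U.image k).filter (fun c => Tangent (4 * ρ ^ 2) (4 * ρ) 1 2 (rep c - w') r₀)
        ⊆ {n, n + 1} := by
      intro c hc
      obtain ⟨hc, t, -⟩ := Finset.mem_filter.1 hc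
      have e := (hrep c hc).2
      rw [quadEval_sub, abs_le] at t
      have h8 : 0 < 8 * ρ ^ 2 := by positivity
      have l1 : n ≤ c := by
        rw [← e]
        apply Int.floor_le_floor
        gcongr
        linarith
      have l2 : c ≤ n + 1 := by
        rw [← e, hn, ← Int.floor_add_one]
        apply Int.floor_le_floor
        rw [div_add_one h8.ne']
        gcongr
        linarith
      rw [Finset.mem_insert, Finset.mem_singleton]
      omega
    have := (Finset.card_le_card hsub).trans Finset.card_le_two
    exact_mod_cast this

theorem slab_subset_sublevel {ρ : ℝ} {M J : ℕ} (hM : 0 < M) (hρ : ρ = 1 / (2 * M)) (hJ : J < M)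
    {u : E3} (hu : ∀ i, |u i| ≤ ρ) (h : |quadEval u (1 / 2 + J * ρ)| ≤ 8 * ρ ^ 2) :
    slab ρ J ⊆ {r | |quadEval u r| ≤ 12 * ρ ^ 2} := by
  rintro r ⟨hr1, hr2⟩
  have b := slab_bounds hM hρ hJ
  have hρ0 : 0 ≤ ρ := (abs_nonneg _).trans (hu 0)
  have e : quadEval u r = quadEval u (1 / 2 + J * ρ)
      + (r - (1 / 2 + J * ρ)) * quadDeriv u ((r + (1 / 2 + J * ρ)) / 2) := by
    rw [← quadEval_sub_eq]; ring
  have hd := abs_quadDeriv_le u (r := (r + (1 / 2 + J * ρ)) / 2) (by linarith) (by linarith)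
  have h1 := hu 1
  have h2 := hu 2
  change |quadEval u r| ≤ 12 * ρ ^ 2
  rw [e]
  refine (abs_add_le _ _).trans ?_
  rw [abs_mul, abs_of_nonneg (by linarith : 0 ≤ r - (1 / 2 + J * ρ))]
  have : (r - (1 / 2 + J * ρ)) * |quadDeriv u ((r + (1 / 2 + J * ρ)) / 2)| ≤ ρ * (2 * ρ) :=
    mul_le_mul (by linarith) (by linarith) (abs_nonneg _) hρ0
  nlinarith

theorem card_good_slab {ρ y : ℝ} {M : ℕ} (hM : 0 < M) (hρ : ρ = 1 / (2 * M)) (hy : 0 < y)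
    {E : Set ℝ} (hE : 1 / y ≤ len E) :
    M / y ≤ (((Finset.range M).filter (fun J => ρ / y ≤ len (E ∩ slab ρ J))).card : ℝ) := by
  have hM' : (0 : ℝ) < M := by exact_mod_cast hM
  have hρ0 : 0 < ρ := by rw [hρ]; positivity
  have hMρ : M * ρ = 1 / 2 := by rw [hρ]; field_simp
  have h1 := hE.trans (len_le_sum_slab hM hρ E)
  rw [← Finset.sum_filter_add_sum_filter_not (Finset.range M)
    (fun J => ρ / y ≤ len (E ∩ slab ρ J))] at h1
  set K := (Finset.range M).filter (fun J => ρ / y ≤ len (E ∩ slab ρ J))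
  have h2 : ∑ J ∈ K, len (E ∩ slab ρ J) ≤ K.card * ρ := by
    rw [← nsmul_eq_mul, ← Finset.sum_const]
    exact Finset.sum_le_sum fun J _ => len_inter_slab_le hρ0 J E
  have h3 : ∑ J ∈ (Finset.range M).filter (fun J => ¬ρ / y ≤ len (E ∩ slab ρ J)),
      len (E ∩ slab ρ J) ≤ M * (ρ / y) := by
    calc _ ≤ ∑ J ∈ (Finset.range M).filter (fun J => ¬ρ / y ≤ len (E ∩ slab ρ J)), ρ / y :=
          Finset.sum_le_sum fun J hJ => (not_le.1 (Finset.mem_filter.1 hJ).2).le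
      _ ≤ ∑ J ∈ Finset.range M, ρ / y := Finset.sum_le_sum_of_subset_of_nonneg
          (Finset.filter_subset _ _) fun _ _ _ => by positivity
      _ = _ := by rw [Finset.sum_const, Finset.card_range, nsmul_eq_mul]
  have h4 : M * (ρ / y) = 1 / 2 * (1 / y) := by rw [← mul_div_assoc, hMρ]; ring
  have h5 : 1 / 2 * (1 / y) ≤ K.card * ρ := by linarith
  have h6 : M / y * ρ ≤ K.card * ρ := by
    calc M / y * ρ = M * ρ * (1 / y) := by ring
      _ ≤ _ := by rw [hMρ]; exact h5
  exact le_of_mul_le_mul_right h6 hρ0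

theorem energy_aux₁ (h d ρ : ℝ) {x y : ℝ} (hx : x ≠ 0) (hy : y ≠ 0) :
    h * d ^ 3 / x * (ρ / y) = ρ * h * d / (10 * x * y) * (10 * d ^ 2) := by
  field_simp

theorem energy_aux₂ (h d ρ g M : ℝ) {x y : ℝ} (hx : x ≠ 0) (hy : y ≠ 0) :
    ρ * (ρ * h * d / (10 * x * y)) * (g / 4 * (M / (2 * y))) ^ 2
        = (M * ρ) * d * g ^ 2 * (M * ρ * h / (640 * x * y ^ 3)) := by
  field_simp
  ring

theorem energy_aux₃ (h ρ M θ Q : ℝ) {x y : ℝ} (hx : x ≠ 0) (hy : y ≠ 0) :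
    M * (2 * (x ^ 8 * ρ * h * θ) * Q)
      = (1280 * x ^ 9 * y ^ 3 * θ * Q) * (M * ρ * h / (640 * x * y ^ 3)) := by
  field_simp
  ring

theorem energy_aux₄ {ρ σ u N s Λ S : ℝ} (hρ : 0 ≤ ρ) (hσ : 0 ≤ σ) (hΛ : 0 ≤ Λ) (hs : 0 ≤ s)
    (h₁ : u ^ 2 ≤ N * s) (h₂ : N * σ ≤ 2 * Λ) (h₃ : ρ * s ≤ S) : ρ * σ * u ^ 2 ≤ 2 * Λ * S := by
  calc ρ * σ * u ^ 2 ≤ ρ * σ * (N * s) := by gcongr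
    _ = (N * σ) * (ρ * s) := by ring
    _ ≤ (2 * Λ) * (ρ * s) := by gcongr
    _ ≤ _ := by gcongr

set_option maxHeartbeats 1000000 in
theorem cell_energy (Gc G₁ H : Finset E3) (E : E3 → Set ℝ) {ρ x y d θ : ℝ} {M : ℕ} (hM : 0 < M)
    (hρ : ρ = 1 / (2 * M)) (hρ1 : ρ ≤ 1 / 10) (hy : 100000 ≤ y) (hyx : y ≤ x) (hd : 0 < d)
    (hdρ : d ≤ ρ) (hθ0 : 0 < θ) (hH : H.Nonempty) (hθ : H.card * θ ^ 3 = Gc.card)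
    (hGc : ∀ w ∈ Gc, ∀ w' ∈ Gc, ∀ i, |(w - w') i| ≤ ρ) (hsub : G₁ ⊆ Gc)
    (hG₁ : (Gc.card : ℝ) / 4 ≤ G₁.card)
    (hEm : ∀ w ∈ G₁, MeasurableSet (E w)) (hEl : ∀ w ∈ G₁, 1 / y ≤ len (E w))
    (hEc : ∀ w ∈ G₁, ∀ r ∈ E w, 1 / 2 ≤ r → r ≤ 1 → H.card * d ^ 3 / x ≤
      (H.filter (fun w' => Tangent (d ^ 2) (d ^ 2) 1 2 (w - w') r)).card)
    (hbad : ∀ w ∈ G₁, (((Finset.range M).filter (fun J : ℕ =>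
      x ^ 8 * ρ * H.card * θ ≤ (H.filter (fun w' =>
        Tangent (8 * ρ) (8 * ρ) (1 / 2) 3 (w - w') (1 / 2 + J * ρ))).card)).card : ℝ)
      < M / (2 * y)) :
    d * H.card * Gc.card * θ ^ 2 ≤ x ^ 13 * ∑ w ∈ Gc, ∑ w' ∈ Gc,
      len {r | |quadEval (w - w') r| ≤ 12 * ρ ^ 2} := by
  have hM' : (0 : ℝ) < M := by exact_mod_cast hM
  have hρ0 : 0 < ρ := by rw [hρ]; positivity
  have hMρ : M * ρ = 1 / 2 := by rw [hρ]; field_simp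
  have hy0 : 0 < y := by linarith
  have hx0 : 0 < x := by linarith
  have hh : (0 : ℝ) < H.card := by exact_mod_cast hH.card_pos
  set h : ℝ := (H.card : ℝ) with hh_def
  set g : ℝ := (Gc.card : ℝ) with hg_def
  set Λ := x ^ 8 * ρ * h * θ with hΛ
  set σ := ρ * h * d / (10 * x * y) with hσ
  set A : E3 → ℕ → ℝ := fun w J => ((H.filter (fun w' =>
        Tangent (8 * ρ) (8 * ρ) (1 / 2) 3 (w - w') (1 / 2 + J * ρ))).card : ℝ) with hA
  set U : ℕ → Finset E3 := fun J => G₁.filter (fun w => ρ / y ≤ len (E w ∩ slab ρ J) ∧ A w J < Λ)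
    with hU
  set S : ℕ → ℝ := fun J => ∑ w ∈ Gc, ∑ w' ∈ Gc,
      len ({r | |quadEval (w - w') r| ≤ 12 * ρ ^ 2} ∩ slab ρ J) with hS
  have hUG : ∀ J, U J ⊆ Gc := fun J => (Finset.filter_subset _ _).trans hsub
  have hd2 : 0 < d ^ 2 := by positivity
  have hdρ2 : d ^ 2 ≤ ρ ^ 2 := by gcongr
  have hcc : 0 ≤ h * d ^ 3 / x := by positivity
  have h8 : 0 < 8 * ρ ^ 2 := by positivity
  have hΛ0 : 0 ≤ Λ := by positivity
  have hσ0 : 0 ≤ σ := by positivity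
  have hsum : g / 4 * (M / (2 * y)) ≤ ∑ J ∈ Finset.range M, ((U J).card : ℝ) := by
    have hcomm := sum_card_filter_comm (Finset.range M) G₁
      (fun J w => ρ / y ≤ len (E w ∩ slab ρ J) ∧ A w J < Λ)
    refine le_trans ?_ hcomm.ge
    calc g / 4 * (M / (2 * y)) ≤ G₁.card * (M / (2 * y)) := by gcongr
      _ = ∑ w ∈ G₁, M / (2 * y) := by rw [Finset.sum_const, nsmul_eq_mul]
      _ ≤ _ := by
        refine Finset.sum_le_sum fun w hw => ?_
        have h1 := card_good_slab hM hρ hy0 (hEl w hw)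
        have h2 := hbad w hw
        have h3 : (Finset.range M).filter (fun J => ρ / y ≤ len (E w ∩ slab ρ J)) ⊆
            (Finset.range M).filter (fun J => ρ / y ≤ len (E w ∩ slab ρ J) ∧ A w J < Λ) ∪
            (Finset.range M).filter (fun J => Λ ≤ A w J) := by
          intro J hJ
          simp only [Finset.mem_union, Finset.mem_filter] at hJ ⊢
          rcases lt_or_ge (A w J) Λ with hh | hh
          · exact Or.inl ⟨hJ.1, hJ.2, hh⟩
          · exact Or.inr ⟨hJ.1, hh⟩
        have h4 := (Finset.card_le_card h3).trans (Finset.card_union_le _ _)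
        have h5 : (((Finset.range M).filter (fun J => ρ / y ≤ len (E w ∩ slab ρ J))).card : ℝ) ≤
          ((Finset.range M).filter (fun J => ρ / y ≤ len (E w ∩ slab ρ J) ∧ A w J < Λ)).card +
            ((Finset.range M).filter (fun J => Λ ≤ A w J)).card := by exact_mod_cast h4
        have h6 : M / y = 2 * (M / (2 * y)) := by field_simp
        linarith
  have hJ : ∀ J ∈ Finset.range M, ρ * σ * ((U J).card : ℝ) ^ 2 ≤ 2 * Λ * S J := by
    intro J hJ
    have hJ := Finset.mem_range.1 hJ
    have b := slab_bounds hM hρ hJ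
    rcases (U J).eq_empty_or_nonempty with he | hne
    · rw [he]
      have : 0 ≤ S J := Finset.sum_nonneg fun _ _ => Finset.sum_nonneg fun _ _ => len_nonneg _
      simp only [Finset.card_empty, Nat.cast_zero, ne_eq, OfNat.ofNat_ne_zero, not_false_eq_true,
        zero_pow, mul_zero]
      positivity
    have hcl := card_image_floor_mul_le (U J) H (r₀ := 1 / 2 + J * ρ) (σ := σ) (Λ := Λ) hρ0 hρ1
      (by linarith) (by linarith) (fun w hw w' hw' => hGc w (hUG J hw) w' (hUG J hw')) ?_
      (fun w hw => (Finset.mem_filter.1 hw).2.2.le) hne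
    · have hcs := card_sq_le_card_image_mul (U J)
        (fun w => ⌊quadEval w (1 / 2 + J * ρ) / (8 * ρ ^ 2)⌋)
      set N : ℝ := (((U J).image (fun w => ⌊quadEval w (1 / 2 + J * ρ) / (8 * ρ ^ 2)⌋)).card : ℝ)
      set Sf := ∑ i ∈ U J, (((U J).filter (fun j => ⌊quadEval j (1 / 2 + J * ρ) / (8 * ρ ^ 2)⌋
        = ⌊quadEval i (1 / 2 + J * ρ) / (8 * ρ ^ 2)⌋)).card : ℝ) with hf
      have hfS : ρ * Sf ≤ S J := by
        rw [hf, Finset.mul_sum]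
        refine le_trans (Finset.sum_le_sum (g := fun w => ∑ w' ∈ Gc,
          len ({r | |quadEval (w - w') r| ≤ 12 * ρ ^ 2} ∩ slab ρ J)) fun w hw => ?_)
          (Finset.sum_le_sum_of_subset_of_nonneg (hUG J)
            fun _ _ _ => Finset.sum_nonneg fun _ _ => len_nonneg _)
        rw [mul_comm, ← nsmul_eq_mul, ← Finset.sum_const]
        refine le_trans (Finset.sum_le_sum (g := fun w' =>
          len ({r | |quadEval (w - w') r| ≤ 12 * ρ ^ 2} ∩ slab ρ J)) fun w' hw' => ?_)
          (Finset.sum_le_sum_of_subset_of_nonneg ((Finset.filter_subset _ _).trans (hUG J))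
            fun _ _ _ => len_nonneg _)
        obtain ⟨hw', e⟩ := Finset.mem_filter.1 hw'
        refine len_slab_of_subset hM hρ hJ (slab_subset_sublevel hM hρ hJ
          (hGc w (hUG J hw) w' (hUG J hw')) ?_)
        have := Int.abs_sub_lt_one_of_floor_eq_floor e
        rw [← sub_div, abs_div, abs_of_pos h8, div_lt_one h8] at this
        rw [quadEval_sub, abs_sub_comm]
        exact this.le
      have hN : 0 ≤ Sf := Finset.sum_nonneg fun _ _ => by positivity
      exact energy_aux₄ hρ0.le hσ0 hΛ0 hN hcs hcl hfS
    · intro w hw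
      obtain ⟨hwG, hw1, -⟩ := Finset.mem_filter.1 hw
      have := mul_len_slab_le_card H w (hEm w hwG) (δ := d ^ 2) (ρ := ρ) (c := h * d ^ 3 / x) (q := ρ / y)
        hd2 hρ0.le hdρ2 hρ1 J (hEc w hwG) hcc hw1
      have e : h * d ^ 3 / x * (ρ / y) = σ * (10 * d ^ 2) := energy_aux₁ h d ρ hx0.ne' hy0.ne'
      rw [e] at this
      exact le_of_mul_le_mul_right this (mul_pos (by norm_num) hd2)
  have hSS : ∑ J ∈ Finset.range M, S J ≤ ∑ w ∈ Gc, ∑ w' ∈ Gc,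
      len {r | |quadEval (w - w') r| ≤ 12 * ρ ^ 2} := by
    simp only [hS]
    rw [Finset.sum_comm]
    refine Finset.sum_le_sum fun w _ => ?_
    rw [Finset.sum_comm]
    exact Finset.sum_le_sum fun w' _ => sum_slab_le_len hρ0 (measurableSet_sublevel _ _)
  set Q := ∑ w ∈ Gc, ∑ w' ∈ Gc, len {r | |quadEval (w - w') r| ≤ 12 * ρ ^ 2}
  have hQ : 0 ≤ Q := Finset.sum_nonneg fun _ _ => Finset.sum_nonneg fun _ _ => len_nonneg _
  have hcs : (∑ J ∈ Finset.range M, ((U J).card : ℝ)) ^ 2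
      ≤ M * ∑ J ∈ Finset.range M, ((U J).card : ℝ) ^ 2 := by
    have := sq_sum_le_card_mul_sum_sq (s := Finset.range M) (f := fun J => ((U J).card : ℝ))
    rwa [Finset.card_range] at this
  have h1 : ρ * σ * (g / 4 * (M / (2 * y))) ^ 2 ≤ M * (2 * Λ * Q) := by
    calc ρ * σ * (g / 4 * (M / (2 * y))) ^ 2
        ≤ ρ * σ * (∑ J ∈ Finset.range M, ((U J).card : ℝ)) ^ 2 := by gcongr
      _ ≤ ρ * σ * (M * ∑ J ∈ Finset.range M, ((U J).card : ℝ) ^ 2) := by gcongr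
      _ = M * ∑ J ∈ Finset.range M, ρ * σ * ((U J).card : ℝ) ^ 2 := by
          rw [← Finset.mul_sum]; ring
      _ ≤ M * ∑ J ∈ Finset.range M, 2 * Λ * S J := by
          exact mul_le_mul_of_nonneg_left (Finset.sum_le_sum hJ) hM'.le
      _ = M * (2 * Λ * ∑ J ∈ Finset.range M, S J) := by rw [← Finset.mul_sum]
      _ ≤ _ := by gcongr
  have h2 : d * g ^ 2 ≤ 2560 * x ^ 9 * y ^ 3 * θ * Q := by
    have e1 : ρ * σ * (g / 4 * (M / (2 * y))) ^ 2
        = (M * ρ) * d * g ^ 2 * (M * ρ * h / (640 * x * y ^ 3)) :=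
      energy_aux₂ h d ρ g M hx0.ne' hy0.ne'
    have e2 : M * (2 * Λ * Q) = (1280 * x ^ 9 * y ^ 3 * θ * Q) * (M * ρ * h / (640 * x * y ^ 3)) :=
      energy_aux₃ h ρ M θ Q hx0.ne' hy0.ne'
    rw [e1, e2, hMρ] at h1
    have := le_of_mul_le_mul_right h1 (by positivity)
    linarith
  have h3 : d * g ^ 2 = (d * h * g * θ ^ 2) * θ := by
    rw [sq g]; nth_rewrite 1 [← hθ]; ring
  rw [h3] at h2
  have h4 : 2560 * x ^ 9 * y ^ 3 * θ * Q ≤ x ^ 13 * Q * θ := by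
    have : 2560 * x ^ 9 * y ^ 3 ≤ x ^ 13 := by
      calc 2560 * x ^ 9 * y ^ 3 ≤ x * x ^ 9 * x ^ 3 := by gcongr; linarith
        _ = x ^ 13 := by ring
    calc 2560 * x ^ 9 * y ^ 3 * θ * Q = (2560 * x ^ 9 * y ^ 3) * (Q * θ) := by ring
      _ ≤ x ^ 13 * (Q * θ) := by gcongr
      _ = _ := by ring
  exact le_of_mul_le_mul_right (h2.trans h4) hθ0

theorem exists_fiber_of_card {ι κ : Type*} [DecidableEq ι] [DecidableEq κ] (G B : Finset ι) (f : ι → κ) {c : ℝ}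
    (hG : G.Nonempty) (hB : 3 * (B.card : ℝ) ≤ G.card)
    (hc : (G.image f).card * c ≤ G.card) :
    ∃ i ∈ G, ((G.filter (fun j => f j = f i)).card : ℝ) / 4 + c / 4 ≤
      ((G.filter (fun j => f j = f i)) \ B).card := by
  by_contra! hcon
  have hG0 : (0 : ℝ) < G.card := by exact_mod_cast hG.card_pos
  have h1 := Finset.card_eq_sum_card_image f G
  have h2 : (G \ B).card = ∑ b ∈ G.image f, ((G.filter (fun j => f j = b)) \ B).card := by
    rw [Finset.card_eq_sum_card_fiberwise (f := f) (t := G.image f)]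
    · refine Finset.sum_congr rfl fun b _ => congrArg _ ?_
      ext j
      simp only [Finset.mem_filter, Finset.mem_sdiff]
      tauto
    · intro j hj
      exact Finset.mem_image_of_mem _ (Finset.mem_sdiff.1 hj).1
  have h3 : ((G \ B).card : ℝ) ≤
      ∑ b ∈ G.image f, (((G.filter (fun j => f j = b)).card : ℝ) / 4 + c / 4) := by
    rw [h2]
    push_cast
    refine Finset.sum_le_sum fun b hb => ?_
    obtain ⟨i, hi, rfl⟩ := Finset.mem_image.1 hb
    exact (hcon i hi).le
  rw [Finset.sum_add_distrib, ← Finset.sum_div, Finset.sum_const, nsmul_eq_mul,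
    ← Nat.cast_sum, ← h1] at h3
  have h4 : (G.card : ℝ) ≤ (G \ B).card + B.card := by
    have := Finset.le_card_sdiff B G
    have h5 : G.card ≤ (G \ B).card + B.card := by omega
    exact_mod_cast h5
  linarith

theorem exists_cell_energy (G H : Finset E3) (E : E3 → Set ℝ) {ρ x y d : ℝ} {M : ℕ} (hM : 0 < M)
    (hρ : ρ = 1 / (2 * M)) (hy : 100000 ≤ y) (hyx : y ≤ x) (hρy : ρ * y ^ 5 ≤ 1) (hd : 0 < d)
    (hdρ : d ≤ ρ) (hG : ∀ w ∈ G, ∀ w' ∈ G, ‖w' - w‖ * y ^ 5 ≤ 1) (hH : H.Nonempty)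
    (hGH : H.card ≤ G.card * x)
    (hEm : ∀ w ∈ G, MeasurableSet (E w)) (hEl : ∀ w ∈ G, 1 / y ≤ len (E w))
    (hEc : ∀ w ∈ G, ∀ r ∈ E w, 1 / 2 ≤ r → r ≤ 1 → H.card * d ^ 3 / x ≤
      (H.filter (fun w' => Tangent (d ^ 2) (d ^ 2) 1 2 (w - w') r)).card) :
    ∃ w₀ ∈ G, ∃ θ : ℝ, 0 < θ ∧
      H.card * θ ^ 3 = (G.filter (fun w => cell ρ w = cell ρ w₀)).card ∧
      ρ ^ 3 * G.card ≤ 4 * (G.filter (fun w => cell ρ w = cell ρ w₀)).card ∧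
      d * H.card * (G.filter (fun w => cell ρ w = cell ρ w₀)).card * θ ^ 2 ≤
        x ^ 13 * ∑ w ∈ G.filter (fun w => cell ρ w = cell ρ w₀),
          ∑ w' ∈ G.filter (fun w => cell ρ w = cell ρ w₀),
            len {r | |quadEval (w - w') r| ≤ 12 * ρ ^ 2} := by
  have hM' : (0 : ℝ) < M := by exact_mod_cast hM
  have hρ0 : 0 < ρ := by rw [hρ]; positivity
  have hy5 : (100000 : ℝ) ^ 5 ≤ y ^ 5 := by gcongr
  have hρ1 : ρ ≤ 1 / 10 := by nlinarith
  have hh : (0 : ℝ) < H.card := by exact_mod_cast hH.card_pos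
  have hx0 : 0 < x := by linarith
  have hg0 : (0 : ℝ) < G.card := by
    by_contra hcon
    have : (G.card : ℝ) * x ≤ 0 := mul_nonpos_of_nonpos_of_nonneg (not_lt.1 hcon) hx0.le
    linarith
  have hGne : G.Nonempty := Finset.card_pos.1 (by exact_mod_cast hg0)
  set θ : E3 → ℝ := fun w =>
    (((G.filter (fun w' => cell ρ w' = cell ρ w)).card : ℝ) / H.card) ^ (1 / 3 : ℝ) with hθ_def
  have hq0 : ∀ w ∈ G, (0 : ℝ) < (G.filter (fun w' => cell ρ w' = cell ρ w)).card := by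
    intro w hw
    have : 0 < (G.filter (fun w' => cell ρ w' = cell ρ w)).card :=
      Finset.card_pos.2 ⟨w, Finset.mem_filter.2 ⟨hw, rfl⟩⟩
    exact_mod_cast this
  have hθ0 : ∀ w ∈ G, 0 < θ w := fun w hw => Real.rpow_pos_of_pos (div_pos (hq0 w hw) hh) _
  have hθ : ∀ w ∈ G, H.card * θ w ^ 3 = (G.filter (fun w' => cell ρ w' = cell ρ w)).card := by
    intro w hw
    rw [hθ_def]
    simp only
    rw [← Real.rpow_natCast, ← Real.rpow_mul (div_pos (hq0 w hw) hh).le]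
    norm_num
    field_simp
  set B := G.filter (fun w => M / (2 * y) ≤ ((Finset.range M).filter (fun J : ℕ =>
      x ^ 8 * ρ * H.card * θ w ≤ (H.filter (fun w' =>
        Tangent (8 * ρ) (8 * ρ) (1 / 2) 3 (w - w') (1 / 2 + J * ρ))).card)).card) with hBdef
  have hbad : (B.card : ℝ) * x ^ 2 ≤ H.card := card_bad_le G H hM hρ hy hyx hρy hG hH θ hθ0 hθ
  have hB : 3 * (B.card : ℝ) ≤ G.card := by
    have h1 : (B.card : ℝ) * x * x ≤ G.card * x := by nlinarith
    have h2 := le_of_mul_le_mul_right h1 hx0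
    have : (B.card : ℝ) * 3 ≤ B.card * x := by gcongr; linarith
    linarith
  have hcells : ((G.image (cell ρ)).card : ℝ) * (ρ ^ 3 * G.card) ≤ G.card := by
    obtain ⟨w₁, hw₁⟩ := hGne
    have h0 : (0 : ℝ) < y ^ 5 := by linarith [hy5, show (0 : ℝ) < 100000 ^ 5 by norm_num]
    have h1 := card_image_cell_le G w₁ hρ0 (D := 1 / y ^ 5) (by positivity)
      (fun w hw => by rw [le_div_iff₀ h0]; exact hG _ hw₁ _ hw)
    have h2 : (2 * (1 / y ^ 5) / ρ + 2) * ρ ≤ 1 := by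
      have : (2 * (1 / y ^ 5) / ρ + 2) * ρ = 2 * (1 / y ^ 5) + 2 * ρ := by field_simp
      rw [this]
      have : 1 / y ^ 5 ≤ 1 / 100000 ^ 5 := by gcongr
      have : (1 : ℝ) / 100000 ^ 5 ≤ 1 / 10 := by norm_num
      linarith
    calc ((G.image (cell ρ)).card : ℝ) * (ρ ^ 3 * G.card)
        ≤ (2 * (1 / y ^ 5) / ρ + 2) ^ 3 * (ρ ^ 3 * G.card) := by gcongr
      _ = ((2 * (1 / y ^ 5) / ρ + 2) * ρ) ^ 3 * G.card := by ring
      _ ≤ 1 ^ 3 * G.card := by gcongr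
      _ = G.card := by ring
  obtain ⟨w₀, hw₀, h4⟩ := exists_fiber_of_card G B (cell ρ) hGne hB hcells
  refine ⟨w₀, hw₀, θ w₀, hθ0 w₀ hw₀, hθ w₀ hw₀, ?_, ?_⟩
  · have : (((G.filter (fun j => cell ρ j = cell ρ w₀)) \ B).card : ℝ) ≤
        (G.filter (fun j => cell ρ j = cell ρ w₀)).card := by
      exact_mod_cast Finset.card_le_card Finset.sdiff_subset
    have := hq0 w₀ hw₀
    linarith
  · set Gc := G.filter (fun j => cell ρ j = cell ρ w₀) with hGc
    have hc : ∀ w ∈ Gc, cell ρ w = cell ρ w₀ := fun w hw => (Finset.mem_filter.1 hw).2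
    have hsub : ∀ w ∈ Gc \ B, w ∈ G := fun w hw =>
      (Finset.mem_filter.1 (Finset.mem_sdiff.1 hw).1).1
    refine cell_energy Gc (Gc \ B) H E hM hρ hρ1 hy hyx hd hdρ (hθ0 w₀ hw₀) hH (hθ w₀ hw₀)
      (fun w hw w' hw' => abs_coord_sub_le_of_cell_eq hρ0 ((hc w hw).trans (hc w' hw').symm))
      Finset.sdiff_subset ?_ (fun w hw => hEm w (hsub w hw)) (fun w hw => hEl w (hsub w hw))
      (fun w hw => hEc w (hsub w hw)) ?_
    · have : 0 ≤ ρ ^ 3 * G.card / 4 := by positivity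
      linarith
    · intro w hw
      have hwB := (Finset.mem_sdiff.1 hw).2
      have hwc := hc w (Finset.mem_sdiff.1 hw).1
      rw [hBdef, Finset.mem_filter, not_and, not_le] at hwB
      have := hwB (hsub w hw)
      have e : θ w = θ w₀ := by rw [hθ_def]; simp only [hwc]
      rwa [e] at this

theorem exists_scale {D : ℝ} (h0 : 0 < D) (h1 : D ≤ 1 / 2) :
    ∃ M : ℕ, 0 < M ∧ D ≤ 1 / (2 * M) ∧ (1 : ℝ) / (2 * M) ≤ 2 * D := by
  have h2 : 1 ≤ 1 / (2 * D) := by rw [le_div_iff₀ (by positivity)]; linarith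
  have hM : 0 < ⌊1 / (2 * D)⌋₊ := Nat.floor_pos.2 h2
  have hM' : (1 : ℝ) ≤ ⌊1 / (2 * D)⌋₊ := by exact_mod_cast hM
  have f1 := Nat.floor_le (zero_le_one.trans h2)
  have f2 := Nat.lt_floor_add_one (1 / (2 * D))
  refine ⟨_, hM, ?_, ?_⟩
  · rw [le_div_iff₀ (by positivity)] at f1 ⊢
    linarith
  · rw [div_lt_iff₀ (by positivity)] at f2
    rw [div_le_iff₀ (by positivity)]
    nlinarith

theorem card_le_of_card_cell_le (A G : Finset E3) (hAG : A ⊆ G) (w₀ : E3) {ℓ D V : ℝ} (hℓ : 0 < ℓ)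
    (hD : 0 ≤ D) (hV : 0 ≤ V) (hA : ∀ w ∈ A, ‖w - w₀‖ ≤ D)
    (hG : ∀ w ∈ G, ((G.filter (fun w' => cell ℓ w' = cell ℓ w)).card : ℝ) ≤ V) :
    (A.card : ℝ) ≤ (2 * D / ℓ + 2) ^ 3 * V := by
  refine (card_le_card_image_mul A (cell ℓ) (V := V) fun w hw => ?_).trans
    (mul_le_mul_of_nonneg_right (card_image_cell_le A w₀ hℓ hD hA) hV)
  refine le_trans ?_ (hG w (hAG hw))
  exact_mod_cast Finset.card_le_card (Finset.filter_subset_filter _ hAG)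

theorem false_of_light_cells (G H : Finset E3) (E : E3 → Set ℝ) {x y d X B ρ₁ : ℝ}
    (hy : 100000 ≤ y) (hyx : y ≤ x) (hd : 0 < d) (hX : 1 ≤ X) (hB0 : 0 < B)
    (hB : x ^ 20 * X ≤ B ^ 2)
    (hdB : d * B ^ 8 ≤ 1) (hρ₁ : d ≤ ρ₁)
    (hG : ∀ w ∈ G, ∀ w' ∈ G, ‖w' - w‖ * y ^ 5 ≤ 1) (hH : H.Nonempty)
    (hGH : H.card ≤ G.card * x)
    (hcell : ∀ w ∈ G, ((G.filter (fun w' => cell ρ₁ w' = cell ρ₁ w)).card : ℝ)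
      ≤ X * H.card * d ^ 3)
    (hEm : ∀ w ∈ G, MeasurableSet (E w)) (hEl : ∀ w ∈ G, 1 / y ≤ len (E w))
    (hEc : ∀ w ∈ G, ∀ r ∈ E w, 1 / 2 ≤ r → r ≤ 1 → H.card * d ^ 3 / x ≤
      (H.filter (fun w' => Tangent (d ^ 2) (d ^ 2) 1 2 (w - w') r)).card) : False := by
  have hy0 : 0 < y := by linarith
  have hx : 100000 ≤ x := hy.trans hyx
  have hx0 : 0 < x := by linarith
  have hx1 : 1 ≤ x := by linarith
  have hBx : x ^ 10 ≤ B := by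
    refine le_of_sq_le_sq ?_ hB0.le
    calc (x ^ 10) ^ 2 = x ^ 20 * 1 := by ring
      _ ≤ x ^ 20 * X := by gcongr
      _ ≤ _ := hB
  have hB1 : 1 ≤ B := (one_le_pow₀ hx1).trans hBx
  have hBd : 2 * (B * d) * y ^ 5 ≤ 1 := by
    have h1 : y ^ 5 ≤ B := by
      calc y ^ 5 ≤ x ^ 5 := by gcongr
        _ ≤ x ^ 10 := pow_le_pow_right₀ hx1 (by norm_num)
        _ ≤ B := hBx
    have h2 : 2 ≤ B := by
      calc (2 : ℝ) ≤ x := by linarith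
        _ = x ^ 1 := (pow_one x).symm
        _ ≤ x ^ 10 := pow_le_pow_right₀ hx1 (by norm_num)
        _ ≤ B := hBx
    calc 2 * (B * d) * y ^ 5 ≤ B * (B * d) * B := by gcongr
      _ = d * B ^ 3 := by ring
      _ ≤ d * B ^ 8 := by gcongr <;> norm_num [hB1]
      _ ≤ 1 := hdB
  have hy5 : 1 ≤ y ^ 5 := one_le_pow₀ (by linarith)
  have hBd0 : 0 < B * d := by positivity
  obtain ⟨M, hM, hρl, hρu⟩ := exists_scale hBd0 (by nlinarith)
  obtain ⟨ρ, hρ⟩ : ∃ ρ : ℝ, ρ = 1 / (2 * M) := ⟨_, rfl⟩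
  rw [← hρ] at hρl hρu
  have hρ0 : 0 < ρ := hBd0.trans_le hρl
  have hρ₁0 : 0 < ρ₁ := hd.trans_le hρ₁
  have hh : (0 : ℝ) < H.card := by exact_mod_cast hH.card_pos
  obtain ⟨w₀, hw₀, θ, hθ0, hθ, hgl, hen⟩ := exists_cell_energy G H E hM hρ hy hyx
    (le_trans (by gcongr) hBd) hd (by nlinarith) hG hH hGH hEm hEl hEc
  set Gc := G.filter (fun w => cell ρ w = cell ρ w₀) with hGc
  set V := X * H.card * d ^ 3 with hV
  have hV0 : 0 < V := by positivity
  have hGcG : Gc ⊆ G := Finset.filter_subset _ _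
  have hρρ : ρ / ρ₁ ≤ 2 * B := by
    rw [div_le_iff₀ hρ₁0]
    nlinarith
  have hgu : (Gc.card : ℝ) ≤ 1000 * B ^ 3 * V := by
    have := card_le_of_card_cell_le Gc G hGcG w₀ hρ₁0 (D := 2 * ρ) (by positivity) hV0.le
      (fun w hw => norm_sub_le_of_cell_eq hρ0 (Finset.mem_filter.1 hw).2) hcell
    refine this.trans ?_
    gcongr
    have : (2 * (2 * ρ) / ρ₁ + 2) ^ 3 ≤ (10 * B) ^ 3 := by
      gcongr
      have : 2 * (2 * ρ) / ρ₁ = 4 * (ρ / ρ₁) := by ring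
      rw [this]
      linarith
    linarith [this, show (10 * B) ^ 3 = 1000 * B ^ 3 by ring]
  have hper : ∀ w ∈ Gc, ∑ w' ∈ Gc, len {r | |quadEval (w - w') r| ≤ 12 * ρ ^ 2} ≤ 100000 * V := by
    intro w hw
    rw [← Finset.sum_filter_add_sum_filter_not Gc (fun w' => ‖w' - w‖ ≤ ρ₁)]
    have h1 : ∑ w' ∈ Gc.filter (fun w' => ‖w' - w‖ ≤ ρ₁),
        len {r | |quadEval (w - w') r| ≤ 12 * ρ ^ 2} ≤ 64 * V * (1 / 2) := by
      have hc := card_le_of_card_cell_le (Gc.filter (fun w' => ‖w' - w‖ ≤ ρ₁)) G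
        ((Finset.filter_subset _ _).trans hGcG) w hρ₁0 (D := ρ₁) hρ₁0.le hV0.le
        (fun w' hw' => (Finset.mem_filter.1 hw').2) hcell
      have e : (2 * ρ₁ / ρ₁ + 2) ^ 3 = 64 := by field_simp; norm_num
      rw [e] at hc
      refine (Finset.sum_le_sum fun w' _ => len_le_half _).trans ?_
      rw [Finset.sum_const, nsmul_eq_mul]
      gcongr
    have h2 : ∑ w' ∈ Gc.filter (fun w' => ¬‖w' - w‖ ≤ ρ₁),
        len {r | |quadEval (w - w') r| ≤ 12 * ρ ^ 2} ≤ 1000 * B ^ 3 * V * (98 / B ^ 3) := by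
      refine (Finset.sum_le_sum (g := fun _ => 98 / B ^ 3) fun w' hw' => ?_).trans ?_
      · have hn := not_le.1 (Finset.mem_filter.1 hw').2
        rw [← norm_sub_rev] at hn
        have hn0 : 0 < ‖w - w'‖ := hρ₁0.trans hn
        refine (len_sublevel_le _ (by positivity) hn0).trans ?_
        have : √(12 * ρ ^ 2 / ‖w - w'‖) ≤ 7 / B ^ 3 := by
          rw [Real.sqrt_le_left (by positivity), div_pow, div_le_div_iff₀ hn0 (by positivity)]
          calc 12 * ρ ^ 2 * (B ^ 3) ^ 2 ≤ 12 * (2 * (B * d)) ^ 2 * (B ^ 3) ^ 2 := by gcongr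
            _ = 48 * d * (d * B ^ 8) := by ring
            _ ≤ 48 * d * 1 := by gcongr
            _ ≤ 7 ^ 2 * ‖w - w'‖ := by linarith
        calc 14 * √(12 * ρ ^ 2 / ‖w - w'‖) ≤ 14 * (7 / B ^ 3) := by gcongr
          _ = 98 / B ^ 3 := by ring
      · rw [Finset.sum_const, nsmul_eq_mul]
        gcongr
        refine le_trans ?_ hgu
        exact_mod_cast Finset.card_le_card (Finset.filter_subset _ _)
    have e : 1000 * B ^ 3 * V * (98 / B ^ 3) = 98000 * V := by field_simp; norm_num
    linarith
  have hg0 : (0 : ℝ) < Gc.card := by rw [← hθ]; positivity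
  have h1 : d * H.card * θ ^ 2 * Gc.card ≤ x ^ 13 * (100000 * V) * Gc.card := by
    calc d * H.card * θ ^ 2 * Gc.card = d * H.card * Gc.card * θ ^ 2 := by ring
      _ ≤ _ := hen
      _ ≤ x ^ 13 * ∑ w ∈ Gc, 100000 * V := by gcongr with w hw; exact hper w hw
      _ = _ := by rw [Finset.sum_const, nsmul_eq_mul]; ring
  have h2 := le_of_mul_le_mul_right h1 hg0
  have hθl : ρ / x ≤ θ := by
    refine le_of_pow_le_pow_left₀ (n := 3) (by norm_num) hθ0.le ?_
    rw [← hθ] at hgl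
    have h3 : ρ ^ 3 * H.card ≤ (4 * x * θ ^ 3) * H.card := by
      calc ρ ^ 3 * H.card ≤ ρ ^ 3 * (G.card * x) := by gcongr
        _ = (ρ ^ 3 * G.card) * x := by ring
        _ ≤ (4 * (H.card * θ ^ 3)) * x := by gcongr
        _ = _ := by ring
    have h4 := le_of_mul_le_mul_right h3 hh
    rw [div_pow, div_le_iff₀ (by positivity)]
    refine h4.trans ?_
    calc 4 * x * θ ^ 3 ≤ x ^ 2 * x * θ ^ 3 := by gcongr; nlinarith
      _ = _ := by ring
  have h5 : d * H.card * (B * d / x) ^ 2 ≤ x ^ 13 * (x * (X * H.card * d ^ 3)) := by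
    calc d * H.card * (B * d / x) ^ 2 ≤ d * H.card * θ ^ 2 := by
          gcongr
          exact (div_le_div_of_nonneg_right hρl hx0.le).trans hθl
      _ ≤ _ := h2
      _ ≤ _ := by gcongr
  have h6 : B ^ 2 * (d ^ 3 * H.card) ≤ (x ^ 16 * X) * (d ^ 3 * H.card) := by
    have : d * H.card * (B * d / x) ^ 2 * x ^ 2 = B ^ 2 * (d ^ 3 * H.card) := by field_simp
    rw [← this]
    calc _ ≤ x ^ 13 * (x * (X * H.card * d ^ 3)) * x ^ 2 := by gcongr
      _ = _ := by ring
  have h7 := le_of_mul_le_mul_right h6 (by positivity)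
  have h8 : x ^ 20 * X ≤ x ^ 16 * X := hB.trans h7
  have h9 : x ^ 20 ≤ x ^ 16 := le_of_mul_le_mul_right h8 (by linarith)
  have : x ^ 16 < x ^ 20 := pow_lt_pow_right₀ (by linarith) (by norm_num)
  linarith

theorem card_tangent_near_le (A : Finset E3) (w : E3) {a β e₁ e₂ τ V : ℝ} (hτ : 0 < τ)
    (hτ1 : τ ≤ 1 / 10) (he₂ : 0 < e₂) (ha : a ≤ τ * e₂) (hβ : β ≤ τ * e₂) (hV0 : 0 ≤ V)
    (hV : ∀ w' ∈ A, ((A.filter (fun w'' => ‖w' - w''‖ ≤ 26 * (τ * e₂))).card : ℝ) ≤ V) (r₁ : ℝ) :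
    ((A.filter (fun w' => ∃ r, (1 / 2 ≤ r ∧ r ≤ 1 ∧ Tangent a β e₁ e₂ (w - w') r)
      ∧ |r - r₁| < τ)).card : ℝ) ≤ V / τ := by
  set S := A.filter (fun w' => ∃ r, (1 / 2 ≤ r ∧ r ≤ 1 ∧ Tangent a β e₁ e₂ (w - w') r)
      ∧ |r - r₁| < τ) with hS
  rcases S.eq_empty_or_nonempty with he | ⟨w₀, hw₀⟩
  · rw [he]; simp only [Finset.card_empty, Nat.cast_zero]; positivity
  obtain ⟨-, r₀, ⟨h0, h1, -⟩, hr₀⟩ := Finset.mem_filter.1 hw₀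
  set κ := τ * e₂ with hκ
  have hκ0 : 0 < κ := by positivity
  have hT : ∀ w' ∈ S, Tangent (2 * κ) (3 * κ) e₁ e₂ (w - w') r₀ := by
    intro w' hw'
    obtain ⟨-, r, ⟨-, -, ht⟩, hr⟩ := Finset.mem_filter.1 hw'
    have hrr : |r - r₀| ≤ 2 * τ := by
      rw [abs_lt] at hr hr₀
      rw [abs_le]
      constructor <;> linarith [hr.1, hr.2, hr₀.1, hr₀.2]
    obtain ⟨t1, t2, t3, t4⟩ := Tangent.of_close (w - w') (by positivity) hrr ht
    refine ⟨t1.trans ?_, t2.trans (by linarith), t3, t4⟩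
    have : 2 * τ * (β + 2 * τ * e₂) ≤ 2 * (1 / 10) * (3 * κ) := by
      have h3 : β + 2 * τ * e₂ ≤ 3 * κ := by linarith
      calc 2 * τ * (β + 2 * τ * e₂) ≤ 2 * τ * (3 * κ) := by gcongr
        _ ≤ _ := by gcongr
    linarith
  have hfib := card_le_card_image_mul S (fun w' => ⌊(w - w') 2 / (4 * κ)⌋) (V := V) ?_
  · have hq : (S.image (fun w' => ⌊(w - w') 2 / (4 * κ)⌋)) ⊆
        Finset.Icc ⌊-(1 / (4 * τ))⌋ ⌊1 / (4 * τ)⌋ := by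
      intro c hc
      obtain ⟨w', hw', rfl⟩ := Finset.mem_image.1 hc
      have := (abs_le.1 ((abs_coord_le (w - w') 2).trans (hT w' hw').2.2.2))
      have e : 1 / (4 * τ) = e₂ / (4 * κ) := by rw [hκ]; field_simp
      rw [Finset.mem_Icc, e, ← neg_div]
      constructor
      · exact Int.floor_le_floor (by gcongr; exact this.1)
      · exact Int.floor_le_floor (by gcongr; exact this.2)
    have hcard := Finset.card_le_card hq
    rw [Int.card_Icc] at hcard
    have f1 := Int.floor_le (1 / (4 * τ))
    have f2 := Int.lt_floor_add_one (-(1 / (4 * τ)))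
    have hq0 : 0 ≤ 1 / (4 * τ) := by positivity
    have f3 : 0 ≤ ⌊1 / (4 * τ)⌋ := Int.floor_nonneg.2 hq0
    have f4 : ⌊-(1 / (4 * τ))⌋ ≤ 0 := by
      rw [← Int.floor_zero (R := ℝ)]
      exact Int.floor_le_floor (by linarith)
    have hcard' : (((S.image (fun w' => ⌊(w - w') 2 / (4 * κ)⌋)).card : ℤ)) ≤
        ⌊1 / (4 * τ)⌋ + 1 - ⌊-(1 / (4 * τ))⌋ := by omega
    have hcard'' : (((S.image (fun w' => ⌊(w - w') 2 / (4 * κ)⌋)).card : ℝ)) ≤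
        ⌊1 / (4 * τ)⌋ + 1 - ⌊-(1 / (4 * τ))⌋ := by exact_mod_cast hcard'
    have h5 : 10 ≤ 1 / τ := by rw [le_div_iff₀ hτ]; linarith
    have e : 1 / (4 * τ) = 1 / τ / 4 := by field_simp
    have h6 : (((S.image (fun w' => ⌊(w - w') 2 / (4 * κ)⌋)).card : ℝ)) ≤ 1 / τ := by
      rw [e] at hcard'' f1 f2
      linarith
    calc (S.card : ℝ) ≤ _ := hfib
      _ ≤ 1 / τ * V := by gcongr
      _ = V / τ := by ring
  · intro w' hw'
    refine le_trans (Nat.cast_le.2 (Finset.card_le_card ?_)) (hV w' (Finset.mem_filter.1 hw').1)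
    intro w'' hw''
    obtain ⟨hw'', e⟩ := Finset.mem_filter.1 hw''
    refine Finset.mem_filter.2 ⟨(Finset.mem_filter.1 hw'').1, ?_⟩
    have t' := hT w' hw'
    have t'' := hT w'' hw''
    have e' : w' - w'' = (w - w'') - (w - w') := by abel
    have h3 := Int.abs_sub_lt_one_of_floor_eq_floor e
    rw [← sub_div, abs_div, abs_of_pos (by positivity : 0 < 4 * κ),
      div_lt_one (by positivity)] at h3
    have h4 := norm_le_of_tangent (w' - w'') (r := r₀) (a := 4 * κ) (β := 6 * κ)
      (by linarith) h1 ?_ ?_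
    · have : |(w' - w'') 2| ≤ 4 * κ := by rw [e']; exact h3.le
      linarith
    · rw [e', quadEval_sub]
      exact (abs_sub _ _).trans (by linarith [t'.1, t''.1])
    · rw [e', quadDeriv_sub]
      exact (abs_sub _ _).trans (by linarith [t'.2.1, t''.2.1])

theorem sq_le_of_energy_sum {x h d θ g D : ℝ} (hx : 100000 ≤ x)
    (hd : 0 < d) (hθ : 0 < θ) (hA : h * θ ^ 3 = g) (hD0 : 0 ≤ D)
    (h1 : d * h * g * θ ^ 2 ≤ x ^ 13 * (g * (560 * x * h * d * (θ ^ 2 / x ^ 18)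
      + 99 * (d / (x ^ 16 * θ)) * g) + 98 * x ^ 9 * d / θ * D)) :
    g ^ 2 ≤ x ^ 24 * D := by
  have hx0 : 0 < x := by linarith
  have h2 : g ^ 2 ≤ g ^ 2 * (659 / x ^ 3) + 98 * x ^ 22 * D := by
    have h3 := mul_le_mul_of_nonneg_right h1 (by positivity : 0 ≤ θ / d)
    have e1 : d * h * g * θ ^ 2 * (θ / d) = g ^ 2 := by
      rw [sq g]; nth_rewrite 2 [← hA]; field_simp
    have e2 : x ^ 13 * (g * (560 * x * h * d * (θ ^ 2 / x ^ 18)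
        + 99 * (d / (x ^ 16 * θ)) * g) + 98 * x ^ 9 * d / θ * D) * (θ / d)
        = (560 / x ^ 4) * g * (h * θ ^ 3) + 99 / x ^ 3 * g ^ 2 + 98 * x ^ 22 * D := by
      field_simp
    rw [e1, e2, hA] at h3
    have h4 : 560 / x ^ 4 ≤ 560 / x ^ 3 := by gcongr <;> linarith
    have h5 : 560 / x ^ 4 * (g * g) ≤ 560 / x ^ 3 * (g * g) :=
      mul_le_mul_of_nonneg_right h4 (mul_self_nonneg g)
    have e3 : g ^ 2 * (659 / x ^ 3) = 560 / x ^ 3 * (g * g) + 99 / x ^ 3 * g ^ 2 := by ring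
    linarith
  have h3 : 659 / x ^ 3 ≤ 1 / 2 := by
    rw [div_le_iff₀ (by positivity)]
    have : (100000 : ℝ) ^ 3 ≤ x ^ 3 := by gcongr
    linarith
  have h4 : g ^ 2 * (659 / x ^ 3) ≤ g ^ 2 * (1 / 2) := by gcongr
  calc g ^ 2 ≤ 196 * (x ^ 22 * D) := by linarith
    _ ≤ x ^ 2 * (x ^ 22 * D) := by gcongr; nlinarith
    _ = x ^ 24 * D := by ring

theorem card_sq_le_of_energy (A : Finset E3) {x h d θ a : ℝ} (hx : 100000 ≤ x) (hh : 0 < h)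
    (hd : 0 < d) (hθ : 0 < θ) (ha : 0 < a) (had : a ≤ 48 * d ^ 2) (hA : h * θ ^ 3 = A.card)
    (haθ : a ≤ θ ^ 2 / x ^ 18)
    (hball : ∀ w ∈ A, ∀ ρ, a ≤ ρ → ((A.filter (fun w' => ‖w - w'‖ ≤ ρ)).card : ℝ)
      ≤ x * h * ρ ^ (3 / 2 : ℝ))
    (hen : d * h * A.card * θ ^ 2 ≤ x ^ 13 * ∑ w ∈ A, ∑ w' ∈ A,
      len {r | |quadEval (w - w') r| ≤ a}) :
    (A.card : ℝ) ^ 2 ≤ x ^ 24 * ∑ w ∈ A, ((A.filter (fun w' => θ ^ 2 / x ^ 18 ≤ ‖w - w'‖ ∧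
      ‖w - w'‖ ≤ x ^ 32 * θ ^ 2 ∧ d / (x ^ 16 * θ) ≤ len {r | |quadEval (w - w') r| ≤ a})).card
        : ℝ) := by
  have hx0 : 0 < x := by linarith
  set g : ℝ := (A.card : ℝ) with hg
  set e₁ := θ ^ 2 / x ^ 18 with he₁
  set e₂ := x ^ 32 * θ ^ 2 with he₂
  set m := d / (x ^ 16 * θ) with hm
  set L : E3 → E3 → Prop := fun w w' => e₁ ≤ ‖w - w'‖ ∧
      ‖w - w'‖ ≤ e₂ ∧ m ≤ len {r | |quadEval (w - w') r| ≤ a} with hL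
  have he₁0 : 0 < e₁ := by positivity
  have he₂0 : 0 < e₂ := by positivity
  have hm0 : 0 < m := by positivity
  set K := 98 * x ^ 9 * d / θ with hK
  have hK0 : 0 < K := by positivity
  have hsq : √a ≤ 7 * d := by
    rw [Real.sqrt_le_left (by positivity)]
    nlinarith
  have hpt : ∀ w ∈ A, ∀ w' ∈ A, len {r | |quadEval (w - w') r| ≤ a} ≤
      (if ‖w - w'‖ ≤ e₁ then len {r | |quadEval (w - w') r| ≤ a} else 0) + 99 * m
        + (if L w w' then K else 0) := by
    intro w _ w' _
    have hl := len_nonneg {r | |quadEval (w - w') r| ≤ a}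
    rcases le_or_gt ‖w - w'‖ e₁ with h1 | h1
    · rw [if_pos h1]
      split_ifs <;> linarith
    rw [if_neg (not_le.2 h1)]
    have hu0 : 0 < ‖w - w'‖ := he₁0.trans h1
    rcases le_or_gt ‖w - w'‖ e₂ with h2 | h2
    · rcases le_or_gt m (len {r | |quadEval (w - w') r| ≤ a}) with h3 | h3
      · rw [if_pos ⟨h1.le, h2, h3⟩]
        have h4 : √(a / ‖w - w'‖) ≤ 7 * x ^ 9 * d / θ := by
          rw [Real.sqrt_le_left (by positivity)]
          calc a / ‖w - w'‖ ≤ 48 * d ^ 2 / e₁ := by gcongr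
            _ = 48 * (x ^ 18 * d ^ 2 / θ ^ 2) := by rw [he₁]; field_simp
            _ ≤ 49 * (x ^ 18 * d ^ 2 / θ ^ 2) := by gcongr; norm_num
            _ = (7 * x ^ 9 * d / θ) ^ 2 := by field_simp; norm_num
        have h5 := len_sublevel_le (w - w') ha hu0
        have h6 : K = 14 * (7 * x ^ 9 * d / θ) := by rw [hK]; ring
        linarith
      · split_ifs <;> linarith
    · have h4 : √(a / ‖w - w'‖) ≤ 7 * m := by
        rw [Real.sqrt_le_left (by positivity)]
        calc a / ‖w - w'‖ ≤ 48 * d ^ 2 / e₂ := by gcongr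
            _ = 48 * m ^ 2 := by rw [he₂, hm]; field_simp
            _ ≤ 49 * m ^ 2 := by gcongr; norm_num
            _ = (7 * m) ^ 2 := by ring
      have h5 := len_sublevel_le (w - w') ha hu0
      split_ifs <;> linarith
  set D := ∑ w ∈ A, ((A.filter (L w)).card : ℝ) with hD
  have hper : ∀ w ∈ A, ∑ w' ∈ A, len {r | |quadEval (w - w') r| ≤ a} ≤
      560 * x * h * d * e₁ + 99 * m * g + K * (A.filter (L w)).card := by
    intro w hw
    refine (Finset.sum_le_sum (hpt w hw)).trans ?_
    rw [Finset.sum_add_distrib, Finset.sum_add_distrib, ← Finset.sum_filter, ← Finset.sum_filter,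
      Finset.sum_const, Finset.sum_const, nsmul_eq_mul, nsmul_eq_mul]
    have h1 := sum_len_sublevel_le A w ha (Cn := x * h) (α := 3 / 2) (by positivity) (by norm_num)
      (hball w hw) haθ
    have h2 : e₁ ^ ((3 : ℝ) / 2 - 1 / 2) = e₁ := by norm_num
    rw [h2] at h1
    have h3 : 80 * (x * h) * √a * e₁ ≤ 80 * (x * h) * (7 * d) * e₁ := by gcongr
    linarith
  have h1 : d * h * g * θ ^ 2 ≤ x ^ 13 * (g * (560 * x * h * d * e₁ + 99 * m * g) + K * D) := by
    refine hen.trans (mul_le_mul_of_nonneg_left ((Finset.sum_le_sum hper).trans ?_) (by positivity))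
    rw [Finset.sum_add_distrib, Finset.sum_const, nsmul_eq_mul, ← Finset.mul_sum]
  have hD0 : 0 ≤ D := Finset.sum_nonneg fun _ _ => by positivity
  exact sq_le_of_energy_sum hx hd hθ hA hD0 h1

theorem heavy_scale_bounds {x d θ a : ℝ} (hx : 100000 ≤ x) (hd : 0 < d) (hθ : 0 < θ)
    (had : a ≤ 48 * d ^ 2) (hdθ : d * x ^ 560 ≤ θ) :
    a ≤ θ ^ 2 / x ^ 18 ∧
    a + 2 * (x ^ 17 * d * θ) ≤ θ ^ 2 / x ^ 18 / 2 ∧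
    300 * (2 * (θ ^ 2 / x ^ 320) + 2 * (x ^ 17 * d * θ) + a) ≤ (1 / x ^ 150) ^ 2 * (θ ^ 2 / x ^ 18) ∧
    a ≤ 1 / x ^ 150 * (x ^ 32 * θ ^ 2) ∧
    x ^ 17 * d * θ ≤ 1 / x ^ 150 * (x ^ 32 * θ ^ 2) ∧
    300 * ((x ^ 17 * d * θ) ^ 2 + 2 * (x ^ 32 * θ ^ 2) * a) / ((1 / x ^ 150) ^ 2 * (θ ^ 2 / x ^ 18))
      ≤ x ^ 354 * d ^ 2 ∧
    4 * a / (x ^ 17 * d * θ) < d / (x ^ 16 * θ) := by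
  have hx0 : 0 < x := by linarith
  have hx1 : 1 ≤ x := by linarith
  have hc : ∀ k l : ℕ, k ≤ l → θ ^ 2 / x ^ l ≤ θ ^ 2 / x ^ k := fun k l hkl =>
    div_le_div_of_nonneg_left (by positivity) (by positivity) (pow_le_pow_right₀ hx1 hkl)
  have hs : ∀ k : ℕ, 100000 * (θ ^ 2 / x ^ (k + 1)) ≤ θ ^ 2 / x ^ k := by
    intro k
    have : θ ^ 2 / x ^ k = x * (θ ^ 2 / x ^ (k + 1)) := by field_simp; ring
    rw [this]
    gcongr
  have hd' : d ≤ θ / x ^ 560 := by rw [le_div_iff₀ (by positivity)]; exact hdθ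
  have hβ : x ^ 17 * d * θ ≤ θ ^ 2 / x ^ 543 := by
    calc x ^ 17 * d * θ ≤ x ^ 17 * (θ / x ^ 560) * θ := by gcongr
      _ = θ ^ 2 / x ^ 543 := by field_simp
  have ha : a ≤ θ ^ 2 / x ^ 543 := by
    calc a ≤ 48 * d ^ 2 := had
      _ ≤ 48 * (θ / x ^ 560) ^ 2 := by gcongr
      _ = 48 * (θ ^ 2 / x ^ 1120) := by field_simp
      _ ≤ 100000 * (θ ^ 2 / x ^ (543 + 1)) := by
        gcongr ?_ * ?_
        · norm_num
        · exact hc _ _ (by norm_num)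
      _ ≤ _ := hs 543
  have e1 : (1 / x ^ 150) ^ 2 * (θ ^ 2 / x ^ 18) = θ ^ 2 / x ^ 318 := by field_simp
  have e2 : 1 / x ^ 150 * (x ^ 32 * θ ^ 2) = θ ^ 2 / x ^ 118 := by field_simp
  have c1 := hc 18 542 (by norm_num)
  have c2 := hc 319 542 (by norm_num)
  have c3 := hc 118 542 (by norm_num)
  have s1 := hs 542
  have s2 := hs 318
  have s3 := hs 319
  have hp : ∀ k : ℕ, 0 < θ ^ 2 / x ^ k := fun k => by positivity
  have p1 := hp 18
  have p2 := hp 318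
  have p3 := hp 542
  norm_num only at s1 s2 s3
  refine ⟨by linarith [hc 18 543 (by norm_num)], by linarith, ?_, ?_, ?_, ?_, ?_⟩
  · rw [e1]; linarith
  · rw [e2]; linarith
  · rw [e2]; linarith
  · rw [e1, div_le_iff₀ (by positivity)]
    have e3 : x ^ 354 * d ^ 2 * (θ ^ 2 / x ^ 318) = x ^ 36 * d ^ 2 * θ ^ 2 := by field_simp
    rw [e3]
    have h1 : 300 * ((x ^ 17 * d * θ) ^ 2 + 2 * (x ^ 32 * θ ^ 2) * a) ≤
        300 * ((x ^ 17 * d * θ) ^ 2 + 2 * (x ^ 32 * θ ^ 2) * (48 * d ^ 2)) := by gcongr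
    have h2 : 300 * ((x ^ 17 * d * θ) ^ 2 + 2 * (x ^ 32 * θ ^ 2) * (48 * d ^ 2))
        = 300 * (x ^ 34 * d ^ 2 * θ ^ 2) + 28800 * (x ^ 32 * d ^ 2 * θ ^ 2) := by ring
    have h3 : x ^ 32 * d ^ 2 * θ ^ 2 ≤ x ^ 34 * d ^ 2 * θ ^ 2 := by
      gcongr
      norm_num
    have h4 : x ^ 36 * d ^ 2 * θ ^ 2 = x ^ 2 * (x ^ 34 * d ^ 2 * θ ^ 2) := by ring
    have h5 : 30000 * (x ^ 34 * d ^ 2 * θ ^ 2) ≤ x ^ 2 * (x ^ 34 * d ^ 2 * θ ^ 2) := by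
      gcongr; nlinarith
    have h6 : 0 < x ^ 34 * d ^ 2 * θ ^ 2 := by positivity
    linarith
  · calc 4 * a / (x ^ 17 * d * θ) ≤ 4 * (48 * d ^ 2) / (x ^ 17 * d * θ) := by gcongr
      _ = 192 / x * (d / (x ^ 16 * θ)) := by field_simp; norm_num
      _ < 1 * (d / (x ^ 16 * θ)) := by
        gcongr
        rw [div_lt_one hx0]
        linarith
      _ = _ := one_mul _

theorem sq_rpow_three_halves {b : ℝ} (hb : 0 ≤ b) : (b ^ 2) ^ (3 / 2 : ℝ) = b ^ 3 := by
  rw [← Real.rpow_natCast, ← Real.rpow_natCast, ← Real.rpow_mul hb]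
  norm_num

theorem exists_common_neighbour (A : Finset E3) (L : E3 → E3 → Prop) {X : ℝ} (hX : 0 < X)
    (hA : 0 < A.card)
    (hL : (A.card : ℝ) ^ 2 ≤ X * ∑ w ∈ A, ((A.filter (L w)).card : ℝ)) :
    ∃ w₀ ∈ A, (A.card : ℝ) ≤ 2 * X * ((A.filter (fun w =>
      L w w₀ ∧ (A.card : ℝ) ≤ 2 * X * (A.filter (L w)).card)).card : ℝ) := by
  by_contra! hcon
  set g : ℝ := (A.card : ℝ) with hg
  have hg0 : 0 < g := by rw [hg]; exact_mod_cast hA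
  set W := A.filter (fun w => g ≤ 2 * X * (A.filter (L w)).card) with hW
  have h1 := Finset.sum_filter_add_sum_filter_not A
    (fun w => g ≤ 2 * X * (A.filter (L w)).card) (fun w => ((A.filter (L w)).card : ℝ))
  have h2 : ∑ w ∈ A.filter (fun w => ¬ g ≤ 2 * X * (A.filter (L w)).card),
      ((A.filter (L w)).card : ℝ) ≤ g * (g / (2 * X)) := by
    calc _ ≤ ∑ w ∈ A.filter (fun w => ¬ g ≤ 2 * X * (A.filter (L w)).card), g / (2 * X) := by
          refine Finset.sum_le_sum fun w hw => ?_
          have := not_le.1 (Finset.mem_filter.1 hw).2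
          rw [le_div_iff₀ (by positivity)]
          linarith
      _ ≤ ∑ w ∈ A, g / (2 * X) := Finset.sum_le_sum_of_subset_of_nonneg
          (Finset.filter_subset _ _) fun _ _ _ => by positivity
      _ = _ := by rw [Finset.sum_const, nsmul_eq_mul]
  have h3 : ∑ w ∈ W, ((A.filter (L w)).card : ℝ) = ∑ w₀ ∈ A, ((W.filter (fun w => L w w₀)).card : ℝ)
    := sum_card_filter_comm W A L
  have h4 : ∑ w₀ ∈ A, ((W.filter (fun w => L w w₀)).card : ℝ) < ∑ w₀ ∈ A, g / (2 * X) := by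
    refine Finset.sum_lt_sum_of_nonempty (Finset.card_pos.1 hA) fun w₀ hw₀ => ?_
    have := hcon w₀ hw₀
    rw [lt_div_iff₀ (by positivity)]
    have e : W.filter (fun w => L w w₀) = A.filter (fun w =>
      L w w₀ ∧ g ≤ 2 * X * (A.filter (L w)).card) := by
      rw [hW, Finset.filter_filter]
      exact Finset.filter_congr fun _ _ => and_comm
    rw [e]
    linarith
  rw [Finset.sum_const, nsmul_eq_mul, ← hg, ← h3] at h4
  have h5 : X * (g * (g / (2 * X))) = g ^ 2 / 2 := by field_simp
  have h6 : ∑ w ∈ A, ((A.filter (L w)).card : ℝ) < 2 * (g * (g / (2 * X))) := by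
    rw [← h1]; linarith
  have h7 : X * ∑ w ∈ A, ((A.filter (L w)).card : ℝ) < X * (2 * (g * (g / (2 * X)))) := by gcongr
  linarith

/-- The points of `A` tangent to `w`, at a parameter away from two given ones. -/
theorem card_tangent_sub_le (A : Finset E3) (w : E3) (R : Set ℝ) {a β e₁ e₂ τ V : ℝ}
    (hR : ∀ r ∈ R, 1 / 2 ≤ r ∧ r ≤ 1)
    (hV : ∀ r₁, ((A.filter (fun w' => ∃ r, (1 / 2 ≤ r ∧ r ≤ 1 ∧ Tangent a β e₁ e₂ (w - w') r)
      ∧ |r - r₁| < τ)).card : ℝ) ≤ V) (r₁ r₂ : ℝ) :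
    ((A.filter (fun w' => ∃ r ∈ R, Tangent a β e₁ e₂ (w - w') r)).card : ℝ) - 2 * V ≤
      (A.filter (fun w' => ∃ r, (r ∈ R ∧ 1 / 2 ≤ r ∧ r ≤ 1 ∧
        Tangent a β e₁ e₂ (w - w') r) ∧ τ ≤ |r - r₁| ∧ τ ≤ |r - r₂|)).card := by
  set N : ℝ → Finset E3 := fun r₁ => A.filter (fun w' => ∃ r, (1 / 2 ≤ r ∧ r ≤ 1 ∧
    Tangent a β e₁ e₂ (w - w') r) ∧ |r - r₁| < τ) with hN
  set Q := A.filter (fun w' => ∃ r, (r ∈ R ∧ 1 / 2 ≤ r ∧ r ≤ 1 ∧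
        Tangent a β e₁ e₂ (w - w') r) ∧ τ ≤ |r - r₁| ∧ τ ≤ |r - r₂|) with hQ
  have hsub : A.filter (fun w' => ∃ r ∈ R, Tangent a β e₁ e₂ (w - w') r) ⊆ (N r₁ ∪ N r₂) ∪ Q := by
    intro w' hw'
    obtain ⟨hA, r, hr, hT⟩ := Finset.mem_filter.1 hw'
    obtain ⟨h1, h2⟩ := hR r hr
    rw [Finset.mem_union, Finset.mem_union]
    by_cases c1 : |r - r₁| < τ
    · exact Or.inl (Or.inl (Finset.mem_filter.2 ⟨hA, r, ⟨h1, h2, hT⟩, c1⟩))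
    by_cases c2 : |r - r₂| < τ
    · exact Or.inl (Or.inr (Finset.mem_filter.2 ⟨hA, r, ⟨h1, h2, hT⟩, c2⟩))
    exact Or.inr (Finset.mem_filter.2 ⟨hA, r, ⟨hr, h1, h2, hT⟩, not_lt.1 c1, not_lt.1 c2⟩)
  have h1 : ((A.filter (fun w' => ∃ r ∈ R, Tangent a β e₁ e₂ (w - w') r)).card : ℝ)
      ≤ (N r₁).card + (N r₂).card + Q.card := by
    exact_mod_cast (Finset.card_le_card hsub).trans ((Finset.card_union_le _ _).trans
      (Nat.add_le_add_right (Finset.card_union_le _ _) _))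
  have h2 := hV r₁
  have h3 := hV r₂
  linarith

theorem heavy_cell_count {x θ : ℝ} (hx : 100000 ≤ x) (hθ : 0 < θ) :
    (2 * (x ^ 32 * θ ^ 2) / (θ ^ 2 / x ^ 320) + 2) ^ 3 ≤ x ^ 1059 := by
  have hx0 : 0 < x := by linarith
  have hx1 : 1 ≤ x := by linarith
  have e : 2 * (x ^ 32 * θ ^ 2) / (θ ^ 2 / x ^ 320) = 2 * x ^ 352 := by field_simp
  have h1 : 1 ≤ x ^ 352 := one_le_pow₀ hx1
  calc _ ≤ (x ^ 353) ^ 3 := by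
        rw [e]
        gcongr
        have : 4 * x ^ 352 ≤ x * x ^ 352 := by gcongr; linarith
        rw [show x ^ 353 = x * x ^ 352 by rw [← pow_succ']]
        linarith
    _ = _ := by rw [← pow_mul]

theorem heavy_count_final {x h d g W : ℝ} (hx : 100000 ≤ x) (hh : 0 < h) (hd : 0 < d) (hg : 0 < g)
    (hgW : g ≤ 2 * x ^ 24 * (x ^ 1059 * W))
    (hk : W * (g / (4 * x ^ 24)) ^ 3 ≤ x * h * (x ^ 531 * d ^ 3) * g ^ 3) :
    g ≤ x ^ 1690 * h * d ^ 3 := by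
  have hx0 : 0 < x := by linarith
  have h1 : W * g ^ 3 ≤ (64 * x ^ 604 * h * d ^ 3) * g ^ 3 := by
    have e : W * g ^ 3 = 64 * x ^ 72 * (W * (g / (4 * x ^ 24)) ^ 3) := by
      field_simp; ring
    rw [e]
    calc _ ≤ 64 * x ^ 72 * (x * h * (x ^ 531 * d ^ 3) * g ^ 3) := by gcongr
      _ = _ := by ring
  have h2 : W ≤ 64 * x ^ 604 * h * d ^ 3 := le_of_mul_le_mul_right h1 (by positivity)
  calc g ≤ 2 * x ^ 24 * (x ^ 1059 * W) := hgW
    _ ≤ 2 * x ^ 24 * (x ^ 1059 * (64 * x ^ 604 * h * d ^ 3)) := by gcongr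
    _ = 128 * (x ^ 1687 * h * d ^ 3) := by ring
    _ ≤ x ^ 3 * (x ^ 1687 * h * d ^ 3) := by
      gcongr
      calc (128 : ℝ) ≤ 100000 ^ 3 := by norm_num
        _ ≤ x ^ 3 := by gcongr
    _ = _ := by ring

theorem heavy_near_count {x h θ g : ℝ} (hx : 100000 ≤ x) (hθ : 0 < θ) (hg : 0 < g)
    (hA : h * θ ^ 3 = g) :
    x * h * ((6 * θ / x ^ 59) ^ 2) ^ (3 / 2 : ℝ) / (1 / x ^ 150) ≤ g / (8 * x ^ 24) := by
  have hx0 : 0 < x := by linarith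
  rw [sq_rpow_three_halves (by positivity)]
  have e : x * h * (6 * θ / x ^ 59) ^ 3 / (1 / x ^ 150) = 216 / x ^ 2 * ((h * θ ^ 3) / x ^ 24) := by
    field_simp; norm_num
  rw [e, hA]
  have e2 : g / (8 * x ^ 24) = 1 / 8 * (g / x ^ 24) := by field_simp
  rw [e2]
  gcongr ?_ * _
  rw [div_le_div_iff₀ (by positivity) (by norm_num)]
  nlinarith

theorem card_le_of_energy (A : Finset E3) {x h d θ a : ℝ} (hx : 100000 ≤ x) (hh : 0 < h)
    (hd : 0 < d) (hθ : 0 < θ) (hda : d ^ 2 ≤ a) (had : a ≤ 48 * d ^ 2) (hA : h * θ ^ 3 = A.card)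
    (hdθ : d * x ^ 560 ≤ θ)
    (hball : ∀ w ∈ A, ∀ ρ, d ^ 2 ≤ ρ → ((A.filter (fun w' => ‖w - w'‖ ≤ ρ)).card : ℝ)
      ≤ x * h * ρ ^ (3 / 2 : ℝ))
    (hen : d * h * A.card * θ ^ 2 ≤ x ^ 13 * ∑ w ∈ A, ∑ w' ∈ A,
      len {r | |quadEval (w - w') r| ≤ a}) :
    (A.card : ℝ) ≤ x ^ 1690 * h * d ^ 3 := by
  have hx0 : 0 < x := by linarith
  have hx1 : 1 ≤ x := by linarith
  have ha : 0 < a := (by positivity : 0 < d ^ 2).trans_le hda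
  obtain ⟨F1, F2, F3, F4, F5, F6, F7⟩ := heavy_scale_bounds hx hd hθ had hdθ
  have hen2 := card_sq_le_of_energy A hx hh hd hθ ha had hA F1
    (fun w hw ρ hρ => hball w hw ρ (hda.trans hρ)) hen
  have hcc := heavy_cell_count hx hθ
  have hfin := fun W => @heavy_count_final x h d A.card W hx hh hd
  have hg0 : (0 : ℝ) < A.card := by rw [← hA]; positivity
  have hnear := heavy_near_count hx hθ hg0 hA
  have he₁ : 0 < θ ^ 2 / x ^ 18 := by positivity
  have he₂ : 0 < x ^ 32 * θ ^ 2 := by positivity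
  have hβ : 0 < x ^ 17 * d * θ := by positivity
  have hτ : (0 : ℝ) < 1 / x ^ 150 := by positivity
  have hτ1 : 1 / x ^ 150 ≤ 1 / 10 := by
    refine one_div_le_one_div_of_le (by norm_num) ?_
    calc (10 : ℝ) ≤ x ^ 1 := by linarith
      _ ≤ x ^ 150 := pow_le_pow_right₀ hx1 (by norm_num)
  have hℓ : 0 < θ ^ 2 / x ^ 320 := by positivity
  have hnd : d ^ 2 ≤ (6 * θ / x ^ 59) ^ 2 := by
    have : d ≤ θ / x ^ 59 := by
      rw [le_div_iff₀ (by positivity)]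
      refine le_trans ?_ hdθ
      gcongr <;> norm_num [hx1]
    have h2 : θ / x ^ 59 ≤ 6 * θ / x ^ 59 := by gcongr; linarith
    gcongr
    exact this.trans h2
  have hnr : 26 * (1 / x ^ 150 * (x ^ 32 * θ ^ 2)) ≤ (6 * θ / x ^ 59) ^ 2 := by
    have : 26 * (1 / x ^ 150 * (x ^ 32 * θ ^ 2)) = 26 * (θ ^ 2 / x ^ 118) := by field_simp
    rw [this]
    have e : (6 * θ / x ^ 59) ^ 2 = 36 * (θ ^ 2 / x ^ 118) := by field_simp; norm_num
    rw [e]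
    gcongr
    norm_num
  have hrad : d ^ 2 ≤ (x ^ 177 * d) ^ 2 := by
    gcongr
    exact le_mul_of_one_le_left hd.le (one_le_pow₀ hx1)
  have hrad2 : (x ^ 177 * d) ^ 2 = x ^ 354 * d ^ 2 := by ring
  have hradv : x * h * ((x ^ 177 * d) ^ 2) ^ (3 / 2 : ℝ) = x * h * (x ^ 531 * d ^ 3) := by
    rw [sq_rpow_three_halves (by positivity)]; ring
  generalize hee₁ : θ ^ 2 / x ^ 18 = e₁ at *
  generalize hee₂ : x ^ 32 * θ ^ 2 = e₂ at *
  generalize hbb : x ^ 17 * d * θ = β at *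
  generalize htt : 1 / x ^ 150 = τ at *
  generalize hll : θ ^ 2 / x ^ 320 = ℓ at *
  generalize hmm : d / (x ^ 16 * θ) = m at *
  obtain ⟨L, hL⟩ : ∃ L : E3 → E3 → Prop, ∀ w w', L w w' ↔ (e₁ ≤ ‖w - w'‖ ∧ ‖w - w'‖ ≤ e₂ ∧
    m ≤ len {r | |quadEval (w - w') r| ≤ a}) := ⟨_, fun _ _ => Iff.rfl⟩
  simp only [← hL] at hen2
  have hx24 : (0 : ℝ) < x ^ 24 := by positivity
  obtain ⟨w₀, -, hw₀⟩ := exists_common_neighbour A L hx24 (by exact_mod_cast hg0) (by convert hen2)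
  set S := A.filter (fun w => L w w₀ ∧ (A.card : ℝ) ≤ 2 * x ^ 24 * (A.filter (L w)).card) with hS
  have hS0 : S.Nonempty := by
    rw [Finset.nonempty_iff_ne_empty]
    intro h0
    rw [h0] at hw₀
    simp only [Finset.card_empty, Nat.cast_zero, mul_zero] at hw₀
    linarith
  obtain ⟨w₁, hw₁, hfib⟩ := exists_card_le_mul_card_fiber hS0 (cell ℓ)
    ((card_image_cell_le S w₀ hℓ he₂.le fun w hw => ((hL _ _).1 (Finset.mem_filter.1 hw).2.1).2.1).trans hcc)
  set W := S.filter (fun w => cell ℓ w = cell ℓ w₁) with hW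
  have hWA : W ⊆ A := (Finset.filter_subset _ _).trans (Finset.filter_subset _ _)
  refine hfin W.card hg0 (hw₀.trans (by gcongr)) ?_
  have hk := sum_weight_mul_pow_three_le W A (fun _ => 1) (fun _ => A.card / (4 * x ^ 24))
    (fun _ => Set.Icc (1 / 2 : ℝ) 1) (a := a) (β := β) (d₁ := e₁) (d₂ := e₂) (τ := τ)
    (η := 2 * ℓ) (V := x * h * (x ^ 531 * d ^ 3)) (fun _ _ => zero_le_one)
    (fun _ _ => by positivity) (by positivity) he₁ hτ (by linarith) F2 F3 ?_ ?_ ?_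
  · simpa using hk
  · intro w hw w' hw'
    exact norm_sub_le_of_cell_eq hℓ
      ((Finset.mem_filter.1 hw').2.trans (Finset.mem_filter.1 hw).2.symm)
  · intro w hw r₁ r₂
    have hwS := (Finset.mem_filter.1 (Finset.mem_filter.1 hw).1).2.2
    have h1 := card_tangent_sub_le A w (Set.Icc (1 / 2 : ℝ) 1) (a := a) (β := β) (e₁ := e₁)
      (e₂ := e₂) (τ := τ) (V := A.card / (8 * x ^ 24)) (fun r hr => hr)
      (fun r₁ => (card_tangent_near_le A w hτ hτ1 he₂ F4 F5 (by positivity)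
        (fun w' hw' => (le_trans (by
          refine Nat.cast_le.2 (Finset.card_le_card ?_)
          refine Finset.monotone_filter_right _ fun w'' _ hw'' => ?_
          exact le_trans hw'' hnr) (hball w' hw' _ hnd))) r₁).trans hnear) r₁ r₂
    refine le_trans ?_ h1
    have h2 : ((A.filter (L w)).card : ℝ) ≤
        (A.filter (fun w' => ∃ r ∈ Set.Icc (1 / 2 : ℝ) 1, Tangent a β e₁ e₂ (w - w') r)).card := by
      refine Nat.cast_le.2 (Finset.card_le_card ?_)
      refine Finset.monotone_filter_right _ fun w' _ hw' => ?_
      obtain ⟨l1, l2, l3⟩ := (hL _ _).1 hw'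
      obtain ⟨r, h1, h2, h3, h4⟩ := exists_flat_of_len _ ha.le hβ (F7.trans_le l3)
      exact ⟨r, ⟨h1, h2⟩, h3, h4, l1, l2⟩
    have h3 : (A.card : ℝ) / (2 * x ^ 24) ≤ (A.filter (L w)).card := by
      rw [div_le_iff₀ (by positivity)]; linarith
    have e3 : (A.card : ℝ) / (2 * x ^ 24) = 2 * (A.card / (4 * x ^ 24)) := by field_simp; norm_num
    have e4 : 2 * ((A.card : ℝ) / (8 * x ^ 24)) = (A.card / (4 * x ^ 24)) := by field_simp; norm_num
    linarith
  · intro w hw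
    rw [Finset.sum_const, nsmul_eq_mul, mul_one, ← hradv]
    refine le_trans ?_ (hball w (hWA hw) _ hrad)
    refine Nat.cast_le.2 (Finset.card_le_card ?_)
    intro w' hw'
    obtain ⟨h1, h2⟩ := Finset.mem_filter.1 hw'
    refine Finset.mem_filter.2 ⟨hWA h1, ?_⟩
    rw [norm_sub_rev, hrad2]
    exact h2.trans F6

theorem false_of_heavy_cells (G H : Finset E3) (E : E3 → Set ℝ) {x y d ρ : ℝ} {M : ℕ} (hM : 0 < M)
    (hρ : ρ = 1 / (2 * M)) (hy : 100000 ≤ y) (hyx : y ≤ x) (hρy : ρ * y ^ 5 ≤ 1) (hd : 0 < d)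
    (hdρ : d ≤ ρ) (hρd : ρ ≤ 2 * d)
    (hG : ∀ w ∈ G, ∀ w' ∈ G, ‖w' - w‖ * y ^ 5 ≤ 1) (hH : H.Nonempty)
    (hGH : H.card ≤ G.card * x)
    (hcell : ∀ w ∈ G, x ^ 1700 * H.card * d ^ 3 <
      (G.filter (fun w' => cell ρ w' = cell ρ w)).card)
    (hball : ∀ w ∈ G, ∀ ρ, d ^ 2 ≤ ρ → ((G.filter (fun w' => ‖w - w'‖ ≤ ρ)).card : ℝ)
      ≤ x * H.card * ρ ^ (3 / 2 : ℝ))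
    (hEm : ∀ w ∈ G, MeasurableSet (E w)) (hEl : ∀ w ∈ G, 1 / y ≤ len (E w))
    (hEc : ∀ w ∈ G, ∀ r ∈ E w, 1 / 2 ≤ r → r ≤ 1 → H.card * d ^ 3 / x ≤
      (H.filter (fun w' => Tangent (d ^ 2) (d ^ 2) 1 2 (w - w') r)).card) : False := by
  have hx : 100000 ≤ x := hy.trans hyx
  have hx0 : 0 < x := by linarith
  have hx1 : 1 ≤ x := by linarith
  have hh : (0 : ℝ) < H.card := by exact_mod_cast hH.card_pos
  obtain ⟨w₀, hw₀, θ, hθ0, hθ, hgl, hen⟩ := exists_cell_energy G H E hM hρ hy hyx hρy hd hdρ hG hH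
    hGH hEm hEl hEc
  have hc := hcell w₀ hw₀
  set A := G.filter (fun w => cell ρ w = cell ρ w₀) with hA
  have hAG : A ⊆ G := Finset.filter_subset _ _
  have hdθ : d * x ^ 560 ≤ θ := by
    refine le_of_pow_le_pow_left₀ (n := 3) (by norm_num) hθ0.le ?_
    rw [← hθ] at hc
    have h1 : H.card * (d ^ 3 * x ^ 1700) ≤ H.card * θ ^ 3 := by
      calc (H.card : ℝ) * (d ^ 3 * x ^ 1700) = x ^ 1700 * H.card * d ^ 3 := by ring
        _ ≤ _ := hc.le
    calc (d * x ^ 560) ^ 3 = d ^ 3 * x ^ 1680 := by ring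
      _ ≤ d ^ 3 * x ^ 1700 := by gcongr <;> norm_num [hx1]
      _ ≤ θ ^ 3 := le_of_mul_le_mul_left h1 hh
  have := card_le_of_energy A hx hh hd hθ0 (a := 12 * ρ ^ 2) (by nlinarith) (by nlinarith) hθ hdθ
    (fun w hw σ hσ => le_trans (Nat.cast_le.2 (Finset.card_le_card
      (Finset.filter_subset_filter _ hAG))) (hball w (hAG hw) σ hσ)) hen
  have h2 : x ^ 1690 * H.card * d ^ 3 ≤ x ^ 1700 * H.card * d ^ 3 := by
    gcongr <;> norm_num [hx1]
  linarith

theorem false_of_many_tangencies (G H : Finset E3) (E : E3 → Set ℝ) {x y d : ℝ}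
    (hy : 100000 ≤ y) (hyx : y ≤ x) (hd : 0 < d) (hdx : d * x ^ 6880 ≤ 1)
    (hG : ∀ w ∈ G, ∀ w' ∈ G, ‖w' - w‖ * y ^ 5 ≤ 1) (hH : H.Nonempty)
    (hGH : 2 * H.card ≤ G.card * x)
    (hball : ∀ w ∈ G, ∀ ρ, d ^ 2 ≤ ρ → ((G.filter (fun w' => ‖w - w'‖ ≤ ρ)).card : ℝ)
      ≤ x * H.card * ρ ^ (3 / 2 : ℝ))
    (hEm : ∀ w ∈ G, MeasurableSet (E w)) (hEl : ∀ w ∈ G, 1 / y ≤ len (E w))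
    (hEc : ∀ w ∈ G, ∀ r ∈ E w, 1 / 2 ≤ r → r ≤ 1 → H.card * d ^ 3 / x ≤
      (H.filter (fun w' => Tangent (d ^ 2) (d ^ 2) 1 2 (w - w') r)).card) : False := by
  have hx : 100000 ≤ x := hy.trans hyx
  have hx0 : 0 < x := by linarith
  have hx1 : 1 ≤ x := by linarith
  have hdy : 2 * d * y ^ 5 ≤ 1 := by
    calc 2 * d * y ^ 5 ≤ x * d * x ^ 5 := by gcongr; linarith
      _ = d * x ^ 6 := by ring
      _ ≤ d * x ^ 6880 := by gcongr <;> norm_num [hx1]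
      _ ≤ 1 := hdx
  have hy5 : 1 ≤ y ^ 5 := one_le_pow₀ (by linarith)
  obtain ⟨M, hM, hρl, hρu⟩ := exists_scale hd (by nlinarith)
  obtain ⟨ρ, hρ⟩ : ∃ ρ : ℝ, ρ = 1 / (2 * M) := ⟨_, rfl⟩
  rw [← hρ] at hρl hρu
  set P : E3 → Prop := fun w => x ^ 1700 * H.card * d ^ 3 <
    (G.filter (fun w' => cell ρ w' = cell ρ w)).card with hP
  have hcard := Finset.card_filter_add_card_filter_not (s := G) P
  have hcard' : ((G.filter P).card : ℝ) + (G.filter (fun w => ¬ P w)).card = G.card := by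
    exact_mod_cast hcard
  rcases le_total ((G.filter P).card : ℝ) (G.filter (fun w => ¬ P w)).card with h | h
  · have hs : G.filter (fun w => ¬ P w) ⊆ G := Finset.filter_subset _ _
    refine false_of_light_cells (G.filter (fun w => ¬ P w)) H E (X := x ^ 1700) (B := x ^ 860)
      (ρ₁ := ρ) hy hyx hd (one_le_pow₀ hx1) (by positivity) (le_of_eq (by ring))
      (by rw [← pow_mul]; exact hdx) hρl
      (fun w hw w' hw' => hG w (hs hw) w' (hs hw')) hH (by nlinarith) ?_
      (fun w hw => hEm w (hs hw)) (fun w hw => hEl w (hs hw)) (fun w hw => hEc w (hs hw))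
    intro w hw
    refine le_trans ?_ (not_lt.1 (Finset.mem_filter.1 hw).2)
    exact Nat.cast_le.2 (Finset.card_le_card (Finset.filter_subset_filter _ hs))
  · have hs : G.filter P ⊆ G := Finset.filter_subset _ _
    refine false_of_heavy_cells (G.filter P) H E hM hρ hy hyx
      (le_trans (by gcongr) hdy) hd hρl hρu
      (fun w hw w' hw' => hG w (hs hw) w' (hs hw')) hH (by nlinarith) ?_
      (fun w hw σ hσ => le_trans (Nat.cast_le.2 (Finset.card_le_card
        (Finset.filter_subset_filter _ hs))) (hball w (hs hw) σ hσ))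
      (fun w hw => hEm w (hs hw)) (fun w hw => hEl w (hs hw)) (fun w hw => hEc w (hs hw))
    intro w hw
    have hPw := (Finset.mem_filter.1 hw).2
    refine hPw.trans_le (Nat.cast_le.2 (Finset.card_le_card ?_))
    intro w' hw'
    obtain ⟨h1, h2⟩ := Finset.mem_filter.1 hw'
    refine Finset.mem_filter.2 ⟨Finset.mem_filter.2 ⟨h1, ?_⟩, h2⟩
    change _ < _
    rw [h2]
    exact hPw

theorem Tangent.mono {a b β γ d₁ d₂ : ℝ} {u : E3} {r : ℝ} (h : Tangent a β d₁ d₂ u r) (hab : a ≤ b)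
    (hβγ : β ≤ γ) : Tangent b γ d₁ d₂ u r :=
  ⟨h.1.trans hab, h.2.1.trans hβγ, h.2.2⟩

theorem card_filter_tangent_mono (H : Finset E3) (w : E3) (r : ℝ) {a b β γ d₁ d₂ : ℝ} (hab : a ≤ b)
    (hβγ : β ≤ γ) : ((H.filter (fun w' => Tangent a β d₁ d₂ (w - w') r)).card : ℝ) ≤
      (H.filter (fun w' => Tangent b γ d₁ d₂ (w - w') r)).card :=
  Nat.cast_le.2 (Finset.card_le_card
    (Finset.monotone_filter_right _ fun _ _ h => Tangent.mono h hab hβγ))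

/-- Removing two short intervals of parameters from a set on which there are many tangencies still
leaves many tangent points. -/
theorem le_card_tangent_away (H : Finset E3) (w : E3) {R : Set ℝ} (hR : MeasurableSet R)
    {a β c τ : ℝ} (hβ : 0 < β) (hs : a + 2 * β ≤ 1 / 2) (hc0 : 0 ≤ c) (hτ : 0 ≤ τ)
    (hc : ∀ r ∈ R, 1 / 2 ≤ r → r ≤ 1 → c ≤ (H.filter (fun w' => Tangent a β 1 2 (w - w') r)).card)
    (r₁ r₂ : ℝ) :
    c * (len R - 4 * τ) / (10 * β) ≤ (H.filter (fun w' => ∃ r, (r ∈ R ∧ 1 / 2 ≤ r ∧ r ≤ 1 ∧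
        Tangent a β 1 2 (w - w') r) ∧ τ ≤ |r - r₁| ∧ τ ≤ |r - r₂|)).card := by
  have hball : ∀ r₁, MeasurableSet {r : ℝ | |r - r₁| < τ} := fun r₁ =>
    (isOpen_lt (continuous_id.sub continuous_const).abs continuous_const).measurableSet
  have hlen : ∀ r₁, len {r : ℝ | |r - r₁| < τ} ≤ 2 * τ := by
    intro r₁
    refine len_le_of_abs_sub_le (by positivity) ?_
    intro r hr r' hr' _ _ _ _
    have h1 := (abs_lt.1 (show |r - r₁| < τ from hr)).2
    have h2 := (abs_lt.1 (show |r' - r₁| < τ from hr')).1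
    linarith
  set R' := R \ ({r : ℝ | |r - r₁| < τ} ∪ {r : ℝ | |r - r₂| < τ}) with hR'
  have hR'm : MeasurableSet R' := hR.diff ((hball _).union (hball _))
  have hl : len R - 4 * τ ≤ len R' := by
    have h1 : len R ≤ len (R' ∪ ({r : ℝ | |r - r₁| < τ} ∪ {r : ℝ | |r - r₂| < τ})) := by
      refine len_mono fun r hr => ?_
      by_cases h : r ∈ {r : ℝ | |r - r₁| < τ} ∪ {r : ℝ | |r - r₂| < τ}
      · exact Or.inr h
      · exact Or.inl ⟨hr.1, h⟩
    have h2 := len_union_le R' ({r : ℝ | |r - r₁| < τ} ∪ {r : ℝ | |r - r₂| < τ})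
    have h3 := len_union_le {r : ℝ | |r - r₁| < τ} {r : ℝ | |r - r₂| < τ}
    have h4 := hlen r₁
    have h5 := hlen r₂
    linarith
  have hk := mul_len_le_card_mul H (fun w' => {r | Tangent a β 1 2 (w - w') r})
    (fun w' _ => measurableSet_tangent _ _ _ _ _) hR'm (c := c) (D := 10 * β / 1)
    (fun r hr h1 h2 => hc r hr.1 h1 h2) (fun w' _ => len_setOf_tangent_le one_pos hβ.le hs _)
  rw [div_one] at hk
  rw [div_le_iff₀ (by positivity)]
  refine (mul_le_mul_of_nonneg_left hl hc0).trans (hk.trans ?_)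
  refine mul_le_mul_of_nonneg_right (Nat.cast_le.2 (Finset.card_le_card ?_)) (by positivity)
  refine Finset.monotone_filter_right _ fun w' _ hw' => ?_
  obtain ⟨r, ⟨h1, h2⟩, h3, h4, h5⟩ := hw'
  have h6 := not_or.1 h2
  exact ⟨r, ⟨h1, h3, h4, h5⟩, not_lt.1 h6.1, not_lt.1 h6.2⟩

theorem unit_cell_arith {x d Q Cn g h p : ℝ} (hx : 100000 ≤ x) (hd : 0 < d) (hQ : 0 < Q)
    (hQ1 : Q ≤ 1) (hCn : 0 < Cn) (hh : 0 < h) (hgh : h ≤ g * x ^ 53) (hhC : h ≤ 8 * Cn)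
    (hp : d ^ 3 ≤ p)
    (hk : g * (Cn * Q ^ 3 * p / (d ^ 2 * x ^ 5)) ^ 3 ≤ Cn * (x ^ 14 * Q ^ 10 * p) * h ^ 3) :
    Cn ≤ x ^ 41 * h ∧ 1 ≤ x ^ 83 * Q ∧ p ≤ x ^ 42 * d ^ 3 := by
  have hx0 : 0 < x := by linarith
  have hp0 : 0 < p := (by positivity : 0 < d ^ 3).trans_le hp
  have h1 : (Cn ^ 2 * p ^ 2) * (h * Cn * Q ^ 9 * p) ≤
      (x ^ 82 * Q * h ^ 2 * d ^ 6) * (h * Cn * Q ^ 9 * p) := by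
    calc (Cn ^ 2 * p ^ 2) * (h * Cn * Q ^ 9 * p) = h * (Cn ^ 3 * Q ^ 9 * p ^ 3) := by ring
      _ ≤ g * x ^ 53 * (Cn ^ 3 * Q ^ 9 * p ^ 3) := by gcongr
      _ = g * (Cn * Q ^ 3 * p / (d ^ 2 * x ^ 5)) ^ 3 * (x ^ 68 * d ^ 6) := by field_simp
      _ ≤ Cn * (x ^ 14 * Q ^ 10 * p) * h ^ 3 * (x ^ 68 * d ^ 6) := by gcongr
      _ = _ := by ring
  have h2 : Cn ^ 2 * p ^ 2 ≤ x ^ 82 * Q * h ^ 2 * d ^ 6 :=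
    le_of_mul_le_mul_right h1 (by positivity)
  have hp2 : d ^ 6 ≤ p ^ 2 := by
    calc d ^ 6 = (d ^ 3) ^ 2 := by ring
      _ ≤ p ^ 2 := by gcongr
  have h3 : Cn ^ 2 ≤ x ^ 82 * Q * h ^ 2 := by
    refine le_of_mul_le_mul_right (a := d ^ 6) ?_ (by positivity)
    refine le_trans ?_ h2
    gcongr
  have hh2 : h ^ 2 ≤ 64 * Cn ^ 2 := by
    calc h ^ 2 ≤ (8 * Cn) ^ 2 := by gcongr
      _ = _ := by ring
  refine ⟨?_, ?_, ?_⟩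
  · refine le_of_sq_le_sq ?_ (by positivity)
    calc Cn ^ 2 ≤ x ^ 82 * Q * h ^ 2 := h3
      _ ≤ x ^ 82 * 1 * h ^ 2 := by gcongr
      _ = _ := by ring
  · refine le_of_mul_le_mul_right (a := Cn ^ 2) ?_ (by positivity)
    calc 1 * Cn ^ 2 ≤ x ^ 82 * Q * h ^ 2 := by linarith
      _ ≤ x ^ 82 * Q * (64 * Cn ^ 2) := by gcongr
      _ = 64 * (x ^ 82 * Q * Cn ^ 2) := by ring
      _ ≤ x * (x ^ 82 * Q * Cn ^ 2) := by gcongr; linarith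
      _ = _ := by ring
  · refine le_of_sq_le_sq ?_ (by positivity)
    refine le_of_mul_le_mul_left (a := Cn ^ 2) ?_ (by positivity)
    calc Cn ^ 2 * p ^ 2 ≤ x ^ 82 * Q * h ^ 2 * d ^ 6 := h2
      _ ≤ x ^ 82 * 1 * (64 * Cn ^ 2) * d ^ 6 := by gcongr
      _ = 64 * (Cn ^ 2 * (x ^ 82 * d ^ 6)) := by ring
      _ ≤ x ^ 2 * (Cn ^ 2 * (x ^ 82 * d ^ 6)) := by gcongr; nlinarith
      _ = _ := by ring

theorem rpow_mul_cube_le {d ρ α : ℝ} (hd : 0 < d) (hρ : d ^ 2 ≤ ρ) (hα : α ≤ 3 / 2) :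
    ρ ^ α * d ^ 3 ≤ (d ^ 2) ^ α * ρ ^ (3 / 2 : ℝ) := by
  have hD : 0 < d ^ 2 := by positivity
  have hρ0 : 0 < ρ := hD.trans_le hρ
  have h1 : (ρ / d ^ 2) ^ α ≤ (ρ / d ^ 2) ^ (3 / 2 : ℝ) :=
    Real.rpow_le_rpow_of_exponent_le ((one_le_div hD).2 hρ) hα
  rw [Real.div_rpow hρ0.le hD.le, Real.div_rpow hρ0.le hD.le, sq_rpow_three_halves hd.le,
    div_le_div_iff₀ (by positivity) (by positivity)] at h1
  linarith

theorem cube_le_sq_rpow {d α : ℝ} (hd : 0 < d) (hd1 : d ≤ 1) (hα : α ≤ 3 / 2) :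
    d ^ 3 ≤ (d ^ 2) ^ α := by
  rw [← sq_rpow_three_halves hd.le]
  exact Real.rpow_le_rpow_of_exponent_ge (by positivity) (pow_le_one₀ hd.le hd1) hα

theorem ball_radius_rpow_le {x Q D α : ℝ} (hx : 1 ≤ x) (hQ : 0 < Q) (hQ1 : Q ≤ 1) (hD : 0 < D)
    (hα : 1 ≤ α) (hα2 : α ≤ 3 / 2) : (x ^ 9 * Q ^ 10 * D) ^ α ≤ x ^ 14 * Q ^ 10 * D ^ α := by
  have hx0 : 0 < x := by linarith
  rw [Real.mul_rpow (by positivity) hD.le, Real.mul_rpow (by positivity) (by positivity)]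
  have h1 : (x ^ 9) ^ α ≤ x ^ 14 := by
    rw [← Real.rpow_natCast, ← Real.rpow_natCast, ← Real.rpow_mul hx0.le]
    refine Real.rpow_le_rpow_of_exponent_le hx ?_
    norm_num
    linarith
  have h2 : (Q ^ 10) ^ α ≤ Q ^ 10 := by
    calc (Q ^ 10) ^ α ≤ (Q ^ 10) ^ (1 : ℝ) :=
          Real.rpow_le_rpow_of_exponent_ge (by positivity) (pow_le_one₀ hQ.le hQ1) hα
      _ = _ := Real.rpow_one _
  gcongr

theorem false_of_unit_cell (G H : Finset E3) (E : E3 → Set ℝ) {x d Q Cn α : ℝ} (hx : 100000 ≤ x)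
    (hd : 0 < d) (hdx : d * x ^ 2064000 ≤ 1) (hQ : 0 < Q) (hQ1 : Q ≤ 1) (hdQ : d ^ 2 ≤ Q ^ 10)
    (hCn : 0 < Cn) (hα : 1 ≤ α) (hα2 : α ≤ 3 / 2)
    (hG : ∀ w ∈ G, ∀ w' ∈ G, ‖w' - w‖ * x ^ 16 ≤ 2) (hH : H.Nonempty)
    (hGH : H.card ≤ G.card * x ^ 53) (hHC : H.card ≤ 8 * Cn)
    (hball : ∀ w ∈ G, ∀ ρ, Q ^ 10 * d ^ 2 ≤ ρ → ((G.filter (fun w' => ‖w - w'‖ ≤ ρ)).card : ℝ)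
      ≤ Cn * ρ ^ α)
    (hEm : ∀ w ∈ G, MeasurableSet (E w)) (hEl : ∀ w ∈ G, 1 / x ^ 3 ≤ len (E w))
    (hEc : ∀ w ∈ G, ∀ r ∈ E w, 1 / 2 ≤ r → r ≤ 1 → Cn * Q ^ 3 * (d ^ 2) ^ α / x ≤
      (H.filter (fun w' => Tangent (Q ^ 10 * d ^ 2) (d ^ 2) 1 2 (w - w') r)).card) : False := by
  have hx0 : 0 < x := by linarith
  have hx1 : 1 ≤ x := by linarith
  have hh : (0 : ℝ) < H.card := by exact_mod_cast hH.card_pos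
  have hD : 0 < d ^ 2 := by positivity
  have hd20 : d * x ^ 20 ≤ 1 := by
    refine le_trans ?_ hdx
    exact mul_le_mul_of_nonneg_left (pow_le_pow_right₀ hx1 (by norm_num)) hd.le
  have hxk : ∀ k : ℕ, 1 ≤ x ^ k := fun k => one_le_pow₀ hx1
  have hd1 : d ≤ 1 := by nlinarith [hxk 20]
  have hQ10 : Q ^ 10 ≤ 1 := pow_le_one₀ hQ.le hQ1
  have hSD : Q ^ 10 * d ^ 2 ≤ d ^ 2 := mul_le_of_le_one_left hD.le hQ10
  have hdx20 : d ≤ 1 / x ^ 20 := by rw [le_div_iff₀ (by positivity)]; exact hd20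
  have hDx : d ^ 2 ≤ 1 / x ^ 20 := by nlinarith
  have hp := cube_le_sq_rpow (α := α) hd hd1 hα2
  have hVr := ball_radius_rpow_le (α := α) hx1 hQ hQ1 hD hα hα2
  have hρp := fun ρ hρ => rpow_mul_cube_le (ρ := ρ) (α := α) hd hρ hα2
  have hp0 : 0 < (d ^ 2) ^ α := by positivity
  obtain ⟨p, hpe⟩ : ∃ p, p = (d ^ 2) ^ α := ⟨_, rfl⟩
  rw [← hpe] at hp hVr hEc hp0
  simp only [← hpe] at hρp
  have hn0 : 0 ≤ Cn * Q ^ 3 * p / (d ^ 2 * x ^ 5) := by positivity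
  have hk := sum_weight_mul_pow_three_le G H (fun _ => 1)
    (fun _ => Cn * Q ^ 3 * p / (d ^ 2 * x ^ 5)) E (a := Q ^ 10 * d ^ 2) (β := d ^ 2) (d₁ := 1)
    (d₂ := 2) (τ := 1 / x ^ 4) (η := 2 / x ^ 16) (V := Cn * (x ^ 14 * Q ^ 10 * p))
    (fun _ _ => zero_le_one) (fun _ _ => hn0) (by positivity) one_pos (by positivity) ?_ ?_ ?_ ?_ ?_
    ?_
  · have hk' : (G.card : ℝ) * (Cn * Q ^ 3 * p / (d ^ 2 * x ^ 5)) ^ 3 ≤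
        Cn * (x ^ 14 * Q ^ 10 * p) * (H.card : ℝ) ^ 3 := by simpa using hk
    obtain ⟨a1, a2, a3⟩ := unit_cell_arith hx hd hQ hQ1 hCn hh hGH hHC hp hk'
    refine false_of_many_tangencies G H E (x := x ^ 300) (y := x ^ 3) (d := d) ?_ ?_ hd
      (by rw [← pow_mul]; exact hdx) ?_ hH ?_ ?_ hEm hEl ?_
    · exact hx.trans (le_self_pow₀ hx1 (by norm_num))
    · exact pow_le_pow_right₀ hx1 (by norm_num)
    · intro w hw w' hw'
      have h1 := hG w hw w' hw'
      have h2 : ‖w' - w‖ * (x ^ 3) ^ 5 * x ≤ 1 * x := by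
        calc _ = ‖w' - w‖ * x ^ 16 := by ring
          _ ≤ 1 * x := by linarith
      exact le_of_mul_le_mul_right h2 hx0
    · calc 2 * (H.card : ℝ) ≤ x * (G.card * x ^ 53) := by gcongr; linarith
        _ = G.card * x ^ 54 := by ring
        _ ≤ G.card * x ^ 300 := by gcongr <;> norm_num [hx1]
    · intro w hw ρ hρ
      refine (hball w hw ρ (hSD.trans hρ)).trans ?_
      have hρ0 : 0 < ρ := hD.trans_le hρ
      have h1 : ρ ^ α ≤ x ^ 42 * ρ ^ (3 / 2 : ℝ) := by
        refine le_of_mul_le_mul_right (a := d ^ 3) ?_ (by positivity)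
        calc ρ ^ α * d ^ 3 ≤ p * ρ ^ (3 / 2 : ℝ) := hρp ρ hρ
          _ ≤ x ^ 42 * d ^ 3 * ρ ^ (3 / 2 : ℝ) := by gcongr
          _ = _ := by ring
      calc Cn * ρ ^ α ≤ x ^ 41 * H.card * (x ^ 42 * ρ ^ (3 / 2 : ℝ)) := by gcongr
        _ = x ^ 83 * H.card * ρ ^ (3 / 2 : ℝ) := by ring
        _ ≤ x ^ 300 * H.card * ρ ^ (3 / 2 : ℝ) := by gcongr <;> norm_num [hx1]
    · intro w hw r hr h1 h2
      refine le_trans ?_ ((hEc w hw r hr h1 h2).trans (card_filter_tangent_mono H w r hSD le_rfl))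
      rw [div_le_div_iff₀ (by positivity) hx0]
      have h3 : 1 ≤ x ^ 249 * Q ^ 3 := by
        calc (1 : ℝ) ≤ (x ^ 83 * Q) ^ 3 := one_le_pow₀ a2
          _ = _ := by ring
      calc (H.card : ℝ) * d ^ 3 * x ≤ 8 * Cn * p * x * 1 := by rw [mul_one]; gcongr
        _ ≤ 8 * Cn * p * x * (x ^ 249 * Q ^ 3) := by gcongr
        _ = Cn * Q ^ 3 * p * (8 * x ^ 250) := by ring
        _ ≤ Cn * Q ^ 3 * p * x ^ 300 := by
          gcongr
          calc 8 * x ^ 250 ≤ x * x ^ 250 := by gcongr; linarith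
            _ = x ^ 251 := by ring
            _ ≤ _ := pow_le_pow_right₀ hx1 (by norm_num)
  · rw [div_le_one (by positivity)]; exact hxk 4
  · have : 1 / x ^ 20 ≤ 1 / 100000 := one_div_le_one_div_of_le (by norm_num)
      (hx.trans (le_self_pow₀ hx1 (by norm_num)))
    linarith
  · have e1 : 1 / x ^ 16 ≤ 1 / 100000 * (1 / x ^ 8) := by
      rw [div_mul_div_comm, one_mul]
      refine one_div_le_one_div_of_le (by positivity) ?_
      calc 100000 * x ^ 8 ≤ x ^ 8 * x ^ 8 := by
            gcongr; exact hx.trans (le_self_pow₀ hx1 (by norm_num))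
        _ = _ := by ring
    have e2 : 1 / x ^ 20 ≤ 1 / x ^ 16 :=
      one_div_le_one_div_of_le (by positivity) (pow_le_pow_right₀ hx1 (by norm_num))
    have e3 : (1 / x ^ 4) ^ 2 * 1 = 1 / x ^ 8 := by field_simp
    have e4 : 2 / x ^ 16 = 2 * (1 / x ^ 16) := by ring
    have e5 : 0 < 1 / x ^ 8 := by positivity
    rw [e3, e4]
    linarith
  · intro w hw w' hw'
    rw [le_div_iff₀ (by positivity)]
    exact hG w hw w' hw'
  · intro w hw r₁ r₂
    refine le_trans ?_ (le_card_tangent_away H w (hEm w hw) hD ?_ (by positivity) (by positivity)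
      (hEc w hw) r₁ r₂)
    · have h1 := hEl w hw
      have h2 : 4 * (1 / x ^ 4) ≤ 1 / 2 * (1 / x ^ 3) := by
        rw [mul_one_div, mul_one_div, div_le_div_iff₀ (by positivity) (by positivity)]
        have : x ^ 4 = x * x ^ 3 := by ring
        rw [this]
        have : 100000 * x ^ 3 ≤ x * x ^ 3 := by gcongr
        linarith [hxk 3]
      calc Cn * Q ^ 3 * p / (d ^ 2 * x ^ 5) =
            Cn * Q ^ 3 * p / x * (1 / x * (1 / x ^ 3)) / d ^ 2 := by field_simp
        _ ≤ Cn * Q ^ 3 * p / x * (1 / 20 * (1 / x ^ 3)) / d ^ 2 := by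
          gcongr
          linarith
        _ = Cn * Q ^ 3 * p / x * (1 / 2 * (1 / x ^ 3)) / (10 * d ^ 2) := by field_simp; norm_num
        _ ≤ _ := by gcongr; linarith
    · have : 1 / x ^ 20 ≤ 1 / 100000 := one_div_le_one_div_of_le (by norm_num)
        (hx.trans (le_self_pow₀ hx1 (by norm_num)))
      linarith
  · intro w hw
    rw [Finset.sum_const, nsmul_eq_mul, mul_one]
    refine le_trans ?_ ((hball w hw (x ^ 9 * Q ^ 10 * d ^ 2) ?_).trans
      (mul_le_mul_of_nonneg_left hVr hCn.le))
    · refine Nat.cast_le.2 (Finset.card_le_card ?_)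
      refine Finset.monotone_filter_right _ fun w' _ hw' => ?_
      rw [norm_sub_rev]
      refine le_trans hw' ?_
      rw [div_le_iff₀ (by positivity)]
      calc 300 * ((d ^ 2) ^ 2 + 2 * 2 * (Q ^ 10 * d ^ 2))
          ≤ 300 * (Q ^ 10 * d ^ 2 + 2 * 2 * (Q ^ 10 * d ^ 2)) := by rw [sq (d ^ 2)]; gcongr
        _ = 1500 * (Q ^ 10 * d ^ 2) := by ring
        _ ≤ x * (Q ^ 10 * d ^ 2) := by gcongr; linarith
        _ = x ^ 9 * Q ^ 10 * d ^ 2 * ((1 / x ^ 4) ^ 2 * 1) := by field_simp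
    · rw [mul_assoc]
      exact le_mul_of_one_le_left (by positivity) (hxk 9)

/-- A finite set with a large weighted sum has a unit cube where the weight is large compared with
the number of points near the cube. -/
theorem exists_unit_cell (F : Finset E3) (v : E3 → ℝ) {κ : ℝ} (hκ : 0 ≤ κ)
    (h : κ * F.card < ∑ w ∈ F, v w) :
    ∃ w₀ ∈ F, κ * (F.filter (fun w' => ∃ w ∈ F, cell 1 w = cell 1 w₀ ∧ ‖w - w'‖ ≤ 2)).card
      < 216 * ∑ w ∈ F.filter (fun w => cell 1 w = cell 1 w₀), v w := by
  by_contra! hcon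
  have h1 : ∑ c ∈ F.image (cell 1), ∑ w ∈ F.filter (fun w => cell 1 w = c), v w = ∑ w ∈ F, v w :=
    Finset.sum_fiberwise_of_maps_to (fun w hw => Finset.mem_image_of_mem _ hw) _
  have h2 := sum_card_filter_comm (F.image (cell 1)) F
    (fun c w' => ∃ w ∈ F, cell 1 w = c ∧ ‖w - w'‖ ≤ 2)
  have h3 : ∀ w' ∈ F, (((F.image (cell 1)).filter
      (fun c => ∃ w ∈ F, cell 1 w = c ∧ ‖w - w'‖ ≤ 2)).card : ℝ) ≤ 216 := by
    intro w' _
    have hc := card_image_cell_le (F.filter (fun w => ‖w - w'‖ ≤ 2)) w' (ℓ := 1) (D := 2) one_pos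
      (by norm_num) (fun w hw => (Finset.mem_filter.1 hw).2)
    refine le_trans (Nat.cast_le.2 (Finset.card_le_card ?_)) (hc.trans (by norm_num))
    intro c hc'
    obtain ⟨-, w, hw, rfl, hn⟩ := Finset.mem_filter.1 hc'
    exact Finset.mem_image_of_mem _ (Finset.mem_filter.2 ⟨hw, hn⟩)
  have h4 := Finset.sum_le_sum h3
  rw [Finset.sum_const, nsmul_eq_mul, ← h2] at h4
  have h5 : 216 * ∑ w ∈ F, v w ≤ κ * ∑ c ∈ F.image (cell 1),
      ((F.filter (fun w' => ∃ w ∈ F, cell 1 w = c ∧ ‖w - w'‖ ≤ 2)).card : ℝ) := by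
    rw [← h1, Finset.mul_sum, Finset.mul_sum]
    refine Finset.sum_le_sum fun c hc => ?_
    obtain ⟨w₀, hw₀, rfl⟩ := Finset.mem_image.1 hc
    exact hcon w₀ hw₀
  have h6 := mul_le_mul_of_nonneg_left h4 hκ
  linarith

theorem measurableSet_card_tangent_ge (F : Finset E3) (w : E3) (a β d₁ d₂ c : ℝ) :
    MeasurableSet {r | c ≤ ((F.filter (fun w' => Tangent a β d₁ d₂ (w - w') r)).card : ℝ)} :=
  measurableSet_le measurable_const (measurable_count F
    (fun w' => {r | Tangent a β d₁ d₂ (w - w') r}) fun _ _ => measurableSet_tangent _ _ _ _ _)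

theorem sum_len_tangent_le_of_le (F : Finset E3) {x d Q Cn α : ℝ} (hx : 100000 ≤ x)
    (hd : 0 < d) (hdx : d * x ^ 2064000 ≤ 1) (hQ : 0 < Q) (hQ1 : Q ≤ 1) (hdQ : d ^ 2 ≤ Q ^ 10)
    (hCn : 0 < Cn) (hα : 1 ≤ α) (hα2 : α ≤ 3 / 2)
    (hball : ∀ w ∈ F, ∀ ρ, Q ^ 10 * d ^ 2 ≤ ρ → ((F.filter (fun w' => ‖w - w'‖ ≤ ρ)).card : ℝ)
      ≤ Cn * ρ ^ α) :
    ∑ w ∈ F, len {r | Cn * Q ^ 3 * (d ^ 2) ^ α / x ≤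
      ((F.filter (fun w' => Tangent (Q ^ 10 * d ^ 2) (d ^ 2) 1 2 (w - w') r)).card : ℝ)}
      ≤ 1 / x * F.card := by
  by_contra! hcon
  have hx0 : 0 < x := by linarith
  have hx1 : 1 ≤ x := by linarith
  set E : E3 → Set ℝ := fun w => {r | Cn * Q ^ 3 * (d ^ 2) ^ α / x ≤
      ((F.filter (fun w' => Tangent (Q ^ 10 * d ^ 2) (d ^ 2) 1 2 (w - w') r)).card : ℝ)} with hE
  obtain ⟨w₀, hw₀, hq⟩ := exists_unit_cell F (fun w => len (E w)) (by positivity) hcon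
  set Fq := F.filter (fun w => cell 1 w = cell 1 w₀) with hFq
  set H := F.filter (fun w' => ∃ w ∈ F, cell 1 w = cell 1 w₀ ∧ ‖w - w'‖ ≤ 2) with hH
  have hFqH : Fq ⊆ H := by
    intro w hw
    obtain ⟨h1, h2⟩ := Finset.mem_filter.1 hw
    exact Finset.mem_filter.2 ⟨h1, w, h1, h2, by simp⟩
  have hw₀q : w₀ ∈ Fq := Finset.mem_filter.2 ⟨hw₀, rfl⟩
  have hHne : H.Nonempty := ⟨w₀, hFqH hw₀q⟩
  have hh : (0 : ℝ) < H.card := by exact_mod_cast hHne.card_pos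
  have hx3 : 0 < x ^ 3 := by positivity
  set G₁ := Fq.filter (fun w => 1 / x ^ 3 ≤ len (E w)) with hG₁
  have hG₁c : (H.card : ℝ) ≤ x ^ 2 * G₁.card := by
    have h1 := Finset.sum_filter_add_sum_filter_not Fq (fun w => 1 / x ^ 3 ≤ len (E w))
      (fun w => len (E w))
    have h2 : ∑ w ∈ G₁, len (E w) ≤ G₁.card * (1 / 2) := by
      refine (Finset.sum_le_sum fun w _ => len_le_half _).trans ?_
      rw [Finset.sum_const, nsmul_eq_mul]
    have h3 : ∑ w ∈ Fq.filter (fun w => ¬ 1 / x ^ 3 ≤ len (E w)), len (E w) ≤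
        H.card * (1 / x ^ 3) := by
      refine (Finset.sum_le_sum (g := fun _ => 1 / x ^ 3)
        fun w hw => (not_le.1 (Finset.mem_filter.1 hw).2).le).trans ?_
      rw [Finset.sum_const, nsmul_eq_mul]
      refine mul_le_mul_of_nonneg_right (Nat.cast_le.2 (Finset.card_le_card
        ((Finset.filter_subset _ _).trans hFqH))) (by positivity)
    rw [← h1] at hq
    have h4 : 1 / x * H.card < 216 * (G₁.card * (1 / 2) + H.card * (1 / x ^ 3)) := by
      refine hq.trans_le ?_
      gcongr
    have h5 : x ^ 2 * H.card < 108 * (x ^ 3 * G₁.card) + 216 * H.card := by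
      have := mul_lt_mul_of_pos_left h4 hx3
      have e1 : x ^ 3 * (1 / x * H.card) = x ^ 2 * H.card := by field_simp
      have e2 : x ^ 3 * (216 * (G₁.card * (1 / 2) + H.card * (1 / x ^ 3))) =
        108 * (x ^ 3 * G₁.card) + 216 * H.card := by field_simp; ring
      rwa [e1, e2] at this
    have hx2 : 432 * H.card ≤ x ^ 2 * H.card := by
      gcongr; nlinarith
    have h6 : x ^ 2 * H.card ≤ x ^ 2 * (216 * (x * G₁.card)) := by
      have : x ^ 2 * (216 * (x * G₁.card)) = 216 * (x ^ 3 * G₁.card) := by ring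
      linarith
    have h7 := le_of_mul_le_mul_left h6 (by positivity)
    calc (H.card : ℝ) ≤ 216 * (x * G₁.card) := h7
      _ ≤ x * (x * G₁.card) := by gcongr; linarith
      _ = _ := by ring
  have hG₁ne : G₁.Nonempty := by
    rw [Finset.nonempty_iff_ne_empty]
    intro h0
    rw [h0] at hG₁c
    simp only [Finset.card_empty, Nat.cast_zero, mul_zero] at hG₁c
    linarith
  have hℓ : 0 < 1 / x ^ 16 := by positivity
  have hN : (2 * (2 * 1) / (1 / x ^ 16) + 2) ^ 3 ≤ x ^ 51 := by
    calc (2 * (2 * 1) / (1 / x ^ 16) + 2) ^ 3 ≤ (x ^ 17) ^ 3 := by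
          gcongr
          have h1 : 1 ≤ x ^ 16 := one_le_pow₀ hx1
          have h2 : 6 * x ^ 16 ≤ x * x ^ 16 := by gcongr; linarith
          rw [show x ^ 17 = x * x ^ 16 by ring, div_div_eq_mul_div, div_one]
          linarith
      _ = _ := by ring
  obtain ⟨w₁, hw₁, hfib⟩ := exists_card_le_mul_card_fiber hG₁ne (cell (1 / x ^ 16))
    ((card_image_cell_le G₁ w₀ hℓ (D := 2 * 1) (by norm_num) (fun w hw =>
      norm_sub_le_of_cell_eq one_pos
        (Finset.mem_filter.1 (Finset.mem_filter.1 hw).1).2)).trans hN)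
  set G := G₁.filter (fun w => cell (1 / x ^ 16) w = cell (1 / x ^ 16) w₁) with hG
  have hGG₁ : G ⊆ G₁ := Finset.filter_subset _ _
  have hGF : G ⊆ F := hGG₁.trans ((Finset.filter_subset _ _).trans (Finset.filter_subset _ _))
  have hd1 : d ≤ 1 := by nlinarith [one_le_pow₀ hx1 (n := 2064000)]
  have hQD : Q ^ 10 * d ^ 2 ≤ 1 := by
    have := pow_le_one₀ (n := 10) hQ.le hQ1
    have := pow_le_one₀ (n := 2) hd.le hd1
    exact mul_le_one₀ ‹_› (by positivity) ‹_›
  refine false_of_unit_cell G H E hx hd hdx hQ hQ1 hdQ hCn hα hα2 ?_ hHne ?_ ?_ ?_ ?_ ?_ ?_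
  · intro w hw w' hw'
    have := norm_sub_le_of_cell_eq hℓ
      ((Finset.mem_filter.1 hw').2.trans (Finset.mem_filter.1 hw).2.symm)
    rw [mul_one_div, le_div_iff₀ (by positivity)] at this
    exact this
  · calc (H.card : ℝ) ≤ x ^ 2 * G₁.card := hG₁c
      _ ≤ x ^ 2 * (x ^ 51 * G.card) := by gcongr
      _ = _ := by ring
  · have h1 := hball w₀ hw₀ 4 (by linarith)
    have h2 : (4 : ℝ) ^ α ≤ 8 := by
      calc (4 : ℝ) ^ α ≤ 4 ^ (3 / 2 : ℝ) :=
            Real.rpow_le_rpow_of_exponent_le (by norm_num) hα2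
        _ = (2 ^ 2) ^ (3 / 2 : ℝ) := by norm_num
        _ = 8 := by rw [sq_rpow_three_halves (by norm_num)]; norm_num
    calc (H.card : ℝ) ≤ (F.filter (fun w' => ‖w₀ - w'‖ ≤ 4)).card := by
          refine Nat.cast_le.2 (Finset.card_le_card ?_)
          refine Finset.monotone_filter_right _ fun w' _ hw' => ?_
          obtain ⟨w, _, hw2, hw3⟩ := hw'
          have h3 := norm_sub_le_of_cell_eq one_pos hw2.symm
          calc ‖w₀ - w'‖ = ‖(w₀ - w) + (w - w')‖ := by rw [sub_add_sub_cancel]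
            _ ≤ ‖w₀ - w‖ + ‖w - w'‖ := norm_add_le _ _
            _ ≤ 4 := by linarith
      _ ≤ Cn * 4 ^ α := h1
      _ ≤ Cn * 8 := by gcongr
      _ = _ := mul_comm _ _
  · intro w hw ρ hρ
    exact le_trans (Nat.cast_le.2 (Finset.card_le_card (Finset.filter_subset_filter _ hGF)))
      (hball w (hGF hw) ρ hρ)
  · intro w _
    exact measurableSet_card_tangent_ge _ _ _ _ _ _ _
  · intro w hw
    exact (Finset.mem_filter.1 (hGG₁ hw)).2
  · intro w hw r hr _ _
    refine le_trans (show _ ≤ _ from hr) (Nat.cast_le.2 (Finset.card_le_card ?_))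
    intro w' hw'
    obtain ⟨h1, h2⟩ := Finset.mem_filter.1 hw'
    refine Finset.mem_filter.2 ⟨Finset.mem_filter.2 ⟨h1, w, hGF hw, ?_, h2.2.2.2⟩, h2⟩
    exact (Finset.mem_filter.1 (Finset.mem_filter.1 (hGG₁ hw)).1).2

theorem flat_scale_arith {x d σ : ℝ} (hx : 100000 ≤ x) (hd : 0 < d) (hdx : d * x ^ 10 ≤ 1)
    (hσ : 0 < σ) (h : σ ^ 10 ≤ d ^ 6) : 160 * x ^ 2 * σ ^ 4 ≤ d ^ 2 := by
  by_contra! hcon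
  have hx0 : 0 < x := by linarith
  have h1 : (d ^ 2) ^ 5 < (160 * x ^ 2 * σ ^ 4) ^ 5 := by gcongr
  have h2 : 160 ^ 5 ≤ x ^ 10 := by
    calc (160 : ℝ) ^ 5 ≤ 100000 ^ 10 := by norm_num
      _ ≤ _ := by gcongr
  have h3 : (160 * x ^ 2 * σ ^ 4) ^ 5 ≤ d ^ 10 * 1 := by
    calc (160 * x ^ 2 * σ ^ 4) ^ 5 = 160 ^ 5 * x ^ 10 * (σ ^ 10) ^ 2 := by ring
      _ ≤ x ^ 10 * x ^ 10 * (d ^ 6) ^ 2 := by gcongr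
      _ = d ^ 10 * (d * x ^ 10) ^ 2 := by ring
      _ ≤ d ^ 10 * 1 := by
        gcongr
        exact pow_le_one₀ (by positivity) hdx
  have : (d ^ 2) ^ 5 = d ^ 10 := by ring
  linarith

theorem len_tangent_ge_le (F : Finset E3) (w : E3) {x d σ Cn α : ℝ} (hx : 100000 ≤ x)
    (hd : 0 < d) (hdx : d * x ^ 10 ≤ 1) (hσ : 0 < σ) (hσ1 : σ ≤ 1) (hσd : σ ^ 10 ≤ d ^ 6)
    (hCn : 0 < Cn) (hα : 1 ≤ α) (hα2 : α ≤ 3 / 2)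
    (hball : ∀ ρ, σ ^ 10 * d ^ 2 ≤ ρ → ((F.filter (fun w' => ‖w - w'‖ ≤ ρ)).card : ℝ)
      ≤ Cn * ρ ^ α) :
    len {r | Cn * σ * (d ^ 2) ^ α / x ≤
      ((F.filter (fun w' => Tangent (σ ^ 10 * d ^ 2) (d ^ 2) 1 2 (w - w') r)).card : ℝ)} ≤ 1 / x := by
  have hx0 : 0 < x := by linarith
  have hd1 : d ≤ 1 := by nlinarith [one_le_pow₀ (by linarith : 1 ≤ x) (n := 10)]
  have hp := cube_le_sq_rpow hd hd1 hα2
  have hp0 : 0 < (d ^ 2) ^ α := by positivity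
  generalize (d ^ 2) ^ α = p at *
  have har := flat_scale_arith hx hd hdx hσ hσd
  have ha0 : 0 < σ ^ 10 * d ^ 2 := by positivity
  have ha1 : σ ^ 10 * d ^ 2 ≤ 2 := by
    have h1 := pow_le_one₀ (n := 10) hσ.le hσ1
    have h2 := pow_le_one₀ (n := 2) hd.le hd1
    nlinarith
  set E := {r | Cn * σ * p / x ≤
      ((F.filter (fun w' => Tangent (σ ^ 10 * d ^ 2) (d ^ 2) 1 2 (w - w') r)).card : ℝ)} with hE
  have h1 := mul_len_le_sum_len (F.filter (fun w' => ‖w - w'‖ ≤ 2))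
    (fun w' => {r | Tangent (σ ^ 10 * d ^ 2) (d ^ 2) 1 2 (w - w') r})
    (fun _ _ => measurableSet_tangent _ _ _ _ _)
    (measurableSet_card_tangent_ge F w (σ ^ 10 * d ^ 2) (d ^ 2) 1 2 (Cn * σ * p / x))
    (c := Cn * σ * p / x) (fun r hr _ _ => by
      refine le_trans (show _ ≤ _ from hr) (Nat.cast_le.2 (Finset.card_le_card ?_))
      intro w' hw'
      obtain ⟨h1, h2⟩ := Finset.mem_filter.1 hw'
      exact Finset.mem_filter.2 ⟨Finset.mem_filter.2 ⟨h1, h2.2.2.2⟩, h2⟩)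
  have h2 := sum_len_sublevel_le F w ha0 hCn.le hα hball ha1
  have h3 : Cn * σ * p / x * len E ≤ 80 * Cn * √(σ ^ 10 * d ^ 2) * 2 ^ (α - 1 / 2) := by
    refine h1.trans (le_trans (Finset.sum_le_sum fun w' _ => len_mono ?_) h2)
    intro r hr
    exact hr.1.2.1
  have h4 : √(σ ^ 10 * d ^ 2) = σ ^ 5 * d := by
    rw [show σ ^ 10 * d ^ 2 = (σ ^ 5 * d) ^ 2 by ring]
    exact Real.sqrt_sq (by positivity)
  have h5 : (2 : ℝ) ^ (α - 1 / 2) ≤ 2 := by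
    calc (2 : ℝ) ^ (α - 1 / 2) ≤ 2 ^ (1 : ℝ) :=
          Real.rpow_le_rpow_of_exponent_le (by norm_num) (by linarith)
      _ = 2 := Real.rpow_one _
  have h6 : (Cn * σ * p) * (x * len E) ≤ (Cn * σ * p) * 1 := by
    calc (Cn * σ * p) * (x * len E) = x ^ 2 * (Cn * σ * p / x * len E) := by field_simp
      _ ≤ x ^ 2 * (80 * Cn * √(σ ^ 10 * d ^ 2) * 2 ^ (α - 1 / 2)) := by gcongr
      _ ≤ x ^ 2 * (80 * Cn * (σ ^ 5 * d) * 2) := by rw [h4]; gcongr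
      _ = Cn * σ * (160 * x ^ 2 * σ ^ 4 * d) := by ring
      _ ≤ Cn * σ * (d ^ 2 * d) := by gcongr
      _ = Cn * σ * d ^ 3 := by ring
      _ ≤ (Cn * σ * p) * 1 := by rw [mul_one]; gcongr
  have h7 := le_of_mul_le_mul_left h6 (by positivity)
  rw [le_div_iff₀ hx0]
  linarith

/-- A power gain for the number of tangencies at unit scale. -/
theorem sum_len_tangent_le (F : Finset E3) {x d σ Cn α : ℝ} (hx : 100000 ≤ x)
    (hd : 0 < d) (hdx : d * x ^ 2064000 ≤ 1) (hσ : 0 < σ) (hσ1 : σ ≤ 1)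
    (hCn : 0 < Cn) (hα : 1 ≤ α) (hα2 : α ≤ 3 / 2)
    (hball : ∀ w ∈ F, ∀ ρ, σ ^ 10 * d ^ 2 ≤ ρ → ((F.filter (fun w' => ‖w - w'‖ ≤ ρ)).card : ℝ)
      ≤ Cn * ρ ^ α) :
    ∑ w ∈ F, len {r | Cn * σ * (d ^ 2) ^ α / x ≤
      ((F.filter (fun w' => Tangent (σ ^ 10 * d ^ 2) (d ^ 2) 1 2 (w - w') r)).card : ℝ)}
      ≤ 1 / x * F.card := by
  have hx0 : 0 < x := by linarith
  have hx1 : 1 ≤ x := by linarith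
  have hd10 : d * x ^ 10 ≤ 1 := le_trans
    (mul_le_mul_of_nonneg_left (pow_le_pow_right₀ hx1 (by norm_num)) hd.le) hdx
  have hd1 : d ≤ 1 := by nlinarith [one_le_pow₀ hx1 (n := 10)]
  rcases le_total (σ ^ 10) (d ^ 6) with h | h
  · refine (Finset.sum_le_sum fun w hw =>
      len_tangent_ge_le F w hx hd hd10 hσ hσ1 h hCn hα hα2 (hball w hw)).trans ?_
    rw [Finset.sum_const, nsmul_eq_mul, mul_comm]
  · obtain ⟨Q, hQ0, hQ1, hQσ, hdQ, hσQ⟩ : ∃ Q : ℝ, 0 < Q ∧ Q ≤ 1 ∧ Q ^ 3 ≤ σ ∧ d ^ 2 ≤ Q ^ 10 ∧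
        σ ^ 10 ≤ Q ^ 10 := by
      rcases le_total (d ^ 2) (σ ^ 10) with h2 | h2
      · exact ⟨σ, hσ, hσ1, pow_le_of_le_one hσ.le hσ1 (by norm_num), h2, le_rfl⟩
      · have e : (d ^ (1 / 5 : ℝ)) ^ 5 = d := by
          rw [← Real.rpow_natCast, ← Real.rpow_mul hd.le]; norm_num
        have e10 : (d ^ (1 / 5 : ℝ)) ^ 10 = d ^ 2 := by
          rw [show (d ^ (1 / 5 : ℝ)) ^ 10 = ((d ^ (1 / 5 : ℝ)) ^ 5) ^ 2 by ring, e]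
        refine ⟨d ^ (1 / 5 : ℝ), by positivity, Real.rpow_le_one hd.le hd1 (by norm_num), ?_,
          e10.ge, by rwa [e10]⟩
        refine le_of_pow_le_pow_left₀ (n := 10) (by norm_num) hσ.le ?_
        calc ((d ^ (1 / 5 : ℝ)) ^ 3) ^ 10 = ((d ^ (1 / 5 : ℝ)) ^ 5) ^ 6 := by ring
          _ = d ^ 6 := by rw [e]
          _ ≤ _ := h
    refine le_trans (Finset.sum_le_sum fun w _ => len_mono ?_)
      (sum_len_tangent_le_of_le F hx hd hdx hQ0 hQ1 hdQ hCn hα hα2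
        (fun w hw ρ hρ => hball w hw ρ (le_trans (by gcongr) hρ)))
    intro r hr
    refine le_trans ?_ (le_trans (show _ ≤ _ from hr.1)
      (card_filter_tangent_mono F w r (by gcongr) le_rfl))
    gcongr

theorem tangent_smul_iff {a β d₁ d₂ b : ℝ} (hb : 0 < b) (u : E3) (r : ℝ) :
    Tangent (a / b) (β / b) (d₁ / b) (d₂ / b) (b⁻¹ • u) r ↔ Tangent a β d₁ d₂ u r := by
  have e1 : quadEval (b⁻¹ • u) r = quadEval u r / b := by
    simp only [quadEval, PiLp.smul_apply, smul_eq_mul]; ring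
  have e2 : quadDeriv (b⁻¹ • u) r = quadDeriv u r / b := by
    simp only [quadDeriv, PiLp.smul_apply, smul_eq_mul]; ring
  have e3 : ‖b⁻¹ • u‖ = ‖u‖ / b := by
    rw [norm_smul, Real.norm_eq_abs, abs_of_pos (inv_pos.2 hb)]; ring
  unfold Tangent
  rw [e1, e2, e3, abs_div, abs_div, abs_of_pos hb]
  simp only [div_le_div_iff_of_pos_right hb]

theorem sum_len_tangent_scale_le (F : Finset E3) {x d b σ Cn α : ℝ} (hx : 100000 ≤ x)
    (hd : 0 < d) (hdx : d * x ^ 2064000 ≤ 1) (hb : 0 < b) (hσ : 0 < σ) (hσ1 : σ ≤ 1)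
    (hCn : 0 < Cn) (hα : 1 ≤ α) (hα2 : α ≤ 3 / 2)
    (hball : ∀ w ∈ F, ∀ ρ, σ ^ 10 * (d ^ 2 * b) ≤ ρ →
      ((F.filter (fun w' => ‖w - w'‖ ≤ ρ)).card : ℝ) ≤ Cn * ρ ^ α) :
    ∑ w ∈ F, len {r | Cn * σ * (d ^ 2 * b) ^ α / x ≤
      ((F.filter (fun w' => Tangent (σ ^ 10 * (d ^ 2 * b)) (d ^ 2 * b) b (2 * b) (w - w') r)).card
        : ℝ)} ≤ 1 / x * F.card := by
  have hinj : Function.Injective (fun w : E3 => b⁻¹ • w) :=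
    smul_right_injective E3 (inv_pos.2 hb).ne'
  have key := sum_len_tangent_le (F.image (fun w => b⁻¹ • w)) (Cn := Cn * b ^ α) hx hd hdx hσ hσ1
    (by positivity) hα hα2 ?_
  · rw [Finset.sum_image (fun _ _ _ _ h => hinj h), Finset.card_image_of_injective _ hinj] at key
    refine le_trans (Finset.sum_le_sum fun w _ => len_mono ?_) key
    intro r hr
    have hr1 : Cn * σ * (d ^ 2 * b) ^ α / x ≤ ((F.filter (fun w' =>
      Tangent (σ ^ 10 * (d ^ 2 * b)) (d ^ 2 * b) b (2 * b) (w - w') r)).card : ℝ) := hr.1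
    show Cn * b ^ α * σ * (d ^ 2) ^ α / x ≤ _
    refine le_trans (le_of_eq ?_) (hr1.trans (Nat.cast_le.2 ?_))
    · rw [Real.mul_rpow (by positivity) hb.le]; ring
    · rw [← Finset.card_image_of_injective _ hinj]
      refine Finset.card_le_card fun v hv => ?_
      obtain ⟨w', hw', rfl⟩ := Finset.mem_image.1 hv
      rw [Finset.mem_filter] at hw' ⊢
      refine ⟨Finset.mem_image_of_mem _ hw'.1, ?_⟩
      have h2 := (tangent_smul_iff hb _ r).2 hw'.2
      have e1 : σ ^ 10 * (d ^ 2 * b) / b = σ ^ 10 * d ^ 2 := by field_simp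
      have e2 : d ^ 2 * b / b = d ^ 2 := by field_simp
      have e3 : b / b = 1 := div_self hb.ne'
      have e4 : 2 * b / b = 2 := by field_simp
      rw [e1, e2, e3, e4, smul_sub] at h2
      exact h2
  · intro v hv ρ hρ
    obtain ⟨w, hw, rfl⟩ := Finset.mem_image.1 hv
    have hρ0 : 0 ≤ ρ := le_trans (by positivity) hρ
    rw [Finset.filter_image, Finset.card_image_of_injective _ hinj, mul_assoc,
      ← Real.mul_rpow hb.le hρ0]
    refine le_trans (Nat.cast_le.2 (Finset.card_le_card ?_)) (hball w hw (b * ρ) ?_)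
    · refine Finset.monotone_filter_right _ fun w' _ hw' => ?_
      simp only [← smul_sub, norm_smul, Real.norm_eq_abs, abs_of_pos (inv_pos.2 hb)] at hw'
      rwa [inv_mul_le_iff₀ hb] at hw'
    · calc σ ^ 10 * (d ^ 2 * b) = b * (σ ^ 10 * d ^ 2) := by ring
        _ ≤ b * ρ := by gcongr

/-- The set of parameters with many tangencies at very small distances is short. -/
theorem len_near_le (F : Finset E3) (w : E3) {σ δ K Cn α : ℝ} (hσ : 0 < σ) (hσ1 : σ ≤ 1)
    (hδ : 0 < δ) (hK : 1 ≤ K) (hCn : 0 < Cn) (hα : 1 ≤ α) (hα2 : α ≤ 3 / 2)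
    (hball : ∀ ρ, σ ^ 10 * δ ≤ ρ → ((F.filter (fun w' => ‖w - w'‖ ≤ ρ)).card : ℝ)
      ≤ Cn * ρ ^ α) :
    K ^ 15 * len {r | Cn * σ * δ ^ α * K ^ 18 / 3 ≤
      ((F.filter (fun w' => ‖w - w'‖ ≤ δ * K ^ 3 ∧ |quadEval (w - w') r| ≤ σ ^ 10 * δ)).card : ℝ)}
      ≤ 240 := by
  have hK0 : 0 < K := by linarith
  set E := {r | Cn * σ * δ ^ α * K ^ 18 / 3 ≤
      ((F.filter (fun w' => ‖w - w'‖ ≤ δ * K ^ 3 ∧ |quadEval (w - w') r| ≤ σ ^ 10 * δ)).card : ℝ)}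
    with hE
  have hEe : E = {r | Cn * σ * δ ^ α * K ^ 18 / 3 ≤ (((F.filter (fun w' => ‖w - w'‖ ≤ δ * K ^ 3)).filter
      (fun w' => r ∈ {r | |quadEval (w - w') r| ≤ σ ^ 10 * δ})).card : ℝ)} := by
    rw [hE]
    simp only [Finset.filter_filter]
    rfl
  have hEm : MeasurableSet E := by
    rw [hEe]
    exact measurableSet_le measurable_const
      (measurable_count _ _ fun w' _ => measurableSet_sublevel _ _)
  have h1 := mul_len_le_sum_len (F.filter (fun w' => ‖w - w'‖ ≤ δ * K ^ 3))
    (fun w' => {r | |quadEval (w - w') r| ≤ σ ^ 10 * δ})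
    (fun w' _ => measurableSet_sublevel _ _) hEm (c := Cn * σ * δ ^ α * K ^ 18 / 3)
    (fun r hr _ _ => by rw [hEe] at hr; exact hr)
  have hσ10 : σ ^ 10 ≤ 1 := pow_le_one₀ hσ.le hσ1
  have hK3 : 1 ≤ K ^ 3 := one_le_pow₀ hK
  have hle : σ ^ 10 * δ ≤ δ * K ^ 3 := by nlinarith
  have h2 := sum_len_sublevel_le F w (by positivity) hCn.le hα hball hle
  have h3 : Cn * σ * δ ^ α * K ^ 18 / 3 * len E ≤
      80 * Cn * √(σ ^ 10 * δ) * (δ * K ^ 3) ^ (α - 1 / 2) := by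
    refine h1.trans (le_trans (Finset.sum_le_sum fun w' _ => len_mono ?_) h2)
    intro r hr
    exact hr.1.2
  have h4 : √(σ ^ 10 * δ) = σ ^ 5 * √δ := by
    rw [Real.sqrt_mul (by positivity), show σ ^ 10 = (σ ^ 5) ^ 2 by ring,
      Real.sqrt_sq (by positivity)]
  have h5 : (δ * K ^ 3) ^ (α - 1 / 2) ≤ δ ^ (α - 1 / 2) * K ^ 3 := by
    rw [Real.mul_rpow hδ.le (by positivity)]
    gcongr
    calc (K ^ 3) ^ (α - 1 / 2) ≤ (K ^ 3) ^ (1 : ℝ) :=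
          Real.rpow_le_rpow_of_exponent_le hK3 (by linarith)
      _ = _ := Real.rpow_one _
  have h6 : √δ * δ ^ (α - 1 / 2) = δ ^ α := by
    rw [Real.sqrt_eq_rpow, ← Real.rpow_add hδ]; congr 1; ring
  have h7 : σ ^ 5 ≤ σ := pow_le_of_le_one hσ.le hσ1 (by norm_num)
  have h8 : (Cn * σ * δ ^ α * K ^ 3) * (K ^ 15 * len E) ≤ (Cn * σ * δ ^ α * K ^ 3) * 240 := by
    calc (Cn * σ * δ ^ α * K ^ 3) * (K ^ 15 * len E) =
          3 * (Cn * σ * δ ^ α * K ^ 18 / 3 * len E) := by ring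
      _ ≤ 3 * (80 * Cn * (σ ^ 5 * √δ) * (δ ^ (α - 1 / 2) * K ^ 3)) := by
        refine mul_le_mul_of_nonneg_left (h3.trans ?_) (by norm_num)
        rw [h4]
        exact mul_le_mul_of_nonneg_left h5 (by positivity)
      _ = 240 * Cn * σ ^ 5 * (√δ * δ ^ (α - 1 / 2)) * K ^ 3 := by ring
      _ = 240 * Cn * σ ^ 5 * δ ^ α * K ^ 3 := by rw [h6]
      _ ≤ 240 * Cn * σ * δ ^ α * K ^ 3 := by gcongr
      _ = _ := by ring
  exact le_of_mul_le_mul_left h8 (by positivity)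

/-- Dyadic pigeonholing: if the total count is often large, but the near part and the far scales
rarely contribute, then one of the first `J₀` scales is often large. -/
theorem exists_scale_of_count {ι : Type*} (F W : Finset ι) (hW : W ⊆ F) (total near : ι → ℝ → ℝ)
    (cnt : ℕ → ι → ℝ → ℝ) (q : ℕ → ℝ) {J₀ J : ℕ} {A B T ε ℓ : ℝ} (hJ₀ : 0 < J₀)
    (hdec : ∀ w ∈ W, ∀ r, 1 / 2 ≤ r → r ≤ 1 →
      total w r ≤ near w r + (∑ j ∈ Finset.range J₀, cnt j w r + ∑ j ∈ Finset.Ico J₀ J, cnt j w r))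
    (hA : 0 ≤ A) (hℓ : 0 < ℓ) (htot : ∀ w ∈ W, ℓ ≤ len {r | B ≤ total w r})
    (hWc : ℓ * F.card ≤ W.card)
    (hnear : ∀ w ∈ W, len {r | B / 3 ≤ near w r} ≤ ℓ / 4)
    (hfar : ∀ j ∈ Finset.Ico J₀ J, ∑ w ∈ F, len {r | A * q j ≤ cnt j w r} ≤ q j * F.card)
    (hq : ∑ j ∈ Finset.Ico J₀ J, q j ≤ ε) (hε : ε ≤ ℓ ^ 2 / 8) (hAε : A * ε ≤ B / 3)
    (hT : J₀ * T ≤ B / 3) :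
    ∃ j, ∃ F' ⊆ W, ℓ / (2 * J₀) * F.card ≤ F'.card ∧
      ∀ w ∈ F', ℓ / (2 * J₀) ≤ len {r | T ≤ cnt j w r} := by
  have hJ₀' : (0 : ℝ) < J₀ := by exact_mod_cast hJ₀
  set f : ι → ℝ := fun w => ∑ j ∈ Finset.Ico J₀ J, len {r | A * q j ≤ cnt j w r} with hf
  have hf0 : ∀ w, 0 ≤ f w := fun w => Finset.sum_nonneg fun j _ => len_nonneg _
  have hfs : ∑ w ∈ F, f w ≤ ℓ ^ 2 / 8 * F.card := by
    rw [hf, Finset.sum_comm]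
    calc _ ≤ ∑ j ∈ Finset.Ico J₀ J, q j * F.card := Finset.sum_le_sum hfar
      _ = (∑ j ∈ Finset.Ico J₀ J, q j) * F.card := by rw [Finset.sum_mul]
      _ ≤ _ := by gcongr; exact hq.trans hε
  set G := W.filter (fun w => f w ≤ ℓ / 4) with hG
  have hbad : ((W.filter (fun w => ¬ f w ≤ ℓ / 4)).card : ℝ) * (ℓ / 4) ≤ ℓ ^ 2 / 8 * F.card := by
    refine le_trans ?_ hfs
    rw [← nsmul_eq_mul, ← Finset.sum_const]
    calc _ ≤ ∑ w ∈ W.filter (fun w => ¬ f w ≤ ℓ / 4), f w :=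
          Finset.sum_le_sum fun w hw => (not_le.1 (Finset.mem_filter.1 hw).2).le
      _ ≤ _ := Finset.sum_le_sum_of_subset_of_nonneg ((Finset.filter_subset _ _).trans hW)
          fun w _ _ => hf0 w
  have hsplit : (G.card : ℝ) + (W.filter (fun w => ¬ f w ≤ ℓ / 4)).card = W.card := by
    exact_mod_cast Finset.card_filter_add_card_filter_not (s := W) (fun w => f w ≤ ℓ / 4)
  have hbad' : ((W.filter (fun w => ¬ f w ≤ ℓ / 4)).card : ℝ) ≤ ℓ / 2 * F.card := by
    have : ((W.filter (fun w => ¬ f w ≤ ℓ / 4)).card : ℝ) * (ℓ / 4) ≤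
      ℓ / 2 * F.card * (ℓ / 4) := by linarith
    exact le_of_mul_le_mul_right this (by positivity)
  have hGc : ℓ / 2 * F.card ≤ G.card := by linarith
  have hgood : ∀ w ∈ G, ∃ j ∈ Finset.range J₀, ℓ / (2 * J₀) ≤ len {r | T ≤ cnt j w r} := by
    intro w hw
    obtain ⟨hwW, hwf⟩ := Finset.mem_filter.1 hw
    have hcov : len {r | B ≤ total w r} ≤ len {r | B / 3 ≤ near w r} +
        (len (⋃ j ∈ Finset.range J₀, {r | T ≤ cnt j w r}) +
          len (⋃ j ∈ Finset.Ico J₀ J, {r | A * q j ≤ cnt j w r})) := by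
      refine le_trans (len_mono ?_) ((len_union_le _ _).trans (by gcongr; exact len_union_le _ _))
      rintro r ⟨hr, hr1, hr2⟩
      by_contra hcon
      simp only [Set.mem_union, Set.mem_iUnion, not_or, not_exists] at hcon
      obtain ⟨c1, c2, c3⟩ := hcon
      have c1' : near w r < B / 3 := not_le.1 c1
      have c2' : ∑ j ∈ Finset.range J₀, cnt j w r ≤ J₀ * T := by
        calc _ ≤ ∑ j ∈ Finset.range J₀, T := Finset.sum_le_sum fun j hj => (not_le.1 (c2 j hj)).le
          _ = _ := by simp
      have c3' : ∑ j ∈ Finset.Ico J₀ J, cnt j w r ≤ A * ε := by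
        calc _ ≤ ∑ j ∈ Finset.Ico J₀ J, A * q j :=
              Finset.sum_le_sum fun j hj => (not_le.1 (c3 j hj)).le
          _ = A * ∑ j ∈ Finset.Ico J₀ J, q j := by rw [Finset.mul_sum]
          _ ≤ _ := by gcongr
      have c4 : B ≤ total w r := hr
      have := hdec w hwW r hr1 hr2
      linarith
    have h1 := len_biUnion_le (Finset.Ico J₀ J) (fun j => {r | A * q j ≤ cnt j w r})
    have h2 := len_biUnion_le (Finset.range J₀) (fun j => {r | T ≤ cnt j w r})
    have h3 := htot w hwW
    have h4 := hnear w hwW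
    have h5 : ℓ / 2 ≤ ∑ j ∈ Finset.range J₀, len {r | T ≤ cnt j w r} := by
      have : f w = ∑ j ∈ Finset.Ico J₀ J, len {r | A * q j ≤ cnt j w r} := rfl
      linarith
    by_contra! hcon
    have h6 : ∑ j ∈ Finset.range J₀, len {r | T ≤ cnt j w r}
        < ∑ j ∈ Finset.range J₀, ℓ / (2 * J₀) :=
      Finset.sum_lt_sum_of_nonempty (Finset.nonempty_range_iff.2 hJ₀.ne') hcon
    rw [Finset.sum_const, Finset.card_range, nsmul_eq_mul] at h6
    have : (J₀ : ℝ) * (ℓ / (2 * J₀)) = ℓ / 2 := by field_simp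
    linarith
  by_contra! hcon
  have hlt : ∀ j ∈ Finset.range J₀,
      ((W.filter (fun w => ℓ / (2 * J₀) ≤ len {r | T ≤ cnt j w r})).card : ℝ)
        < ℓ / (2 * J₀) * F.card := by
    intro j _
    by_contra! h
    obtain ⟨w, hw, hw'⟩ := hcon j _ (Finset.filter_subset _ _) h
    exact absurd (Finset.mem_filter.1 hw).2 (not_le.2 hw')
  have hsub : G ⊆ (Finset.range J₀).biUnion
      (fun j => W.filter (fun w => ℓ / (2 * J₀) ≤ len {r | T ≤ cnt j w r})) := by
    intro w hw
    obtain ⟨j, hj, hj'⟩ := hgood w hw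
    exact Finset.mem_biUnion.2 ⟨j, hj, Finset.mem_filter.2 ⟨(Finset.mem_filter.1 hw).1, hj'⟩⟩
  have h1 : (G.card : ℝ) ≤ ∑ j ∈ Finset.range J₀,
      ((W.filter (fun w => ℓ / (2 * J₀) ≤ len {r | T ≤ cnt j w r})).card : ℝ) := by
    exact_mod_cast (Finset.card_le_card hsub).trans Finset.card_biUnion_le
  have h2 := Finset.sum_lt_sum_of_nonempty (Finset.nonempty_range_iff.2 hJ₀.ne') hlt
  rw [Finset.sum_const, Finset.card_range, nsmul_eq_mul] at h2
  have : (J₀ : ℝ) * (ℓ / (2 * J₀) * F.card) = ℓ / 2 * F.card := by field_simp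
  linarith

/-- Few points have many tangencies at distances comparable to `δ Y`. -/
theorem exists_sum_len_tangent_dyadic_le : ∃ c : ℝ, 0 < c ∧
    ∀ (F : Finset E3) (Y δ σ Cn α : ℝ), 1 ≤ Y → 100000 ≤ Y ^ c → 0 < δ → 0 < σ → σ ≤ 1 → 0 < Cn →
      1 ≤ α → α ≤ 3 / 2 →
      (∀ w ∈ F, ∀ ρ, σ ^ 10 * δ ≤ ρ →
        ((F.filter (fun w' => ‖w - w'‖ ≤ ρ)).card : ℝ) ≤ Cn * ρ ^ α) →
      ∑ w ∈ F, len {r | Cn * σ * δ ^ α * (1 / Y ^ c) ≤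
        ((F.filter (fun w' => Tangent (σ ^ 10 * δ) δ (δ * Y) (2 * (δ * Y)) (w - w') r)).card
          : ℝ)} ≤ 1 / Y ^ c * F.card := by
  have key := @sum_len_tangent_scale_le
  have hP0 : 0 < 2064000 := by norm_num
  generalize 2064000 = P at key hP0
  have hP0' : (0 : ℝ) < P := by exact_mod_cast hP0
  refine ⟨1 / (2 * P), by positivity, ?_⟩
  intro F Y δ σ Cn α hY hx hδ hσ hσ1 hCn hα hα2 hball
  have hY0 : 0 < Y := by linarith
  have e1 : Y ^ (-(1 / 2) : ℝ) * (Y ^ (1 / (2 * P) : ℝ)) ^ P = 1 := by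
    rw [← Real.rpow_natCast, ← Real.rpow_mul hY0.le, ← Real.rpow_add hY0]
    have : -(1 / 2) + 1 / (2 * P) * (P : ℝ) = 0 := by field_simp; norm_num
    rw [this, Real.rpow_zero]
  have e2 : (Y ^ (-(1 / 2) : ℝ)) ^ 2 * (δ * Y) = δ := by
    rw [← Real.rpow_natCast, ← Real.rpow_mul hY0.le]
    norm_num [Real.rpow_neg_one]
    field_simp
  have := key F (x := Y ^ (1 / (2 * P) : ℝ)) (d := Y ^ (-(1 / 2) : ℝ)) (b := δ * Y) hx
    (by positivity) e1.le (by positivity) hσ hσ1 hCn hα hα2 (by rw [e2]; exact hball)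
  rw [e2] at this
  simpa only [mul_one_div] using this

theorem exists_dyadic_index {b x : ℝ} (hbx : b < x) (J : ℕ) (hx : x ≤ 2 ^ J * b) :
    ∃ j ∈ Finset.range J, 2 ^ j * b ≤ x ∧ x ≤ 2 * (2 ^ j * b) := by
  induction J with
  | zero => simp at hx; linarith
  | succ J ih =>
    rcases le_total x (2 ^ J * b) with h | h
    · obtain ⟨j, hj, h1⟩ := ih h
      exact ⟨j, Finset.mem_range.2 ((Finset.mem_range.1 hj).trans (Nat.lt_succ_self _)), h1⟩
    · exact ⟨J, Finset.mem_range.2 (Nat.lt_succ_self _), h, by rw [pow_succ] at hx; linarith⟩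

/-- Dyadic decomposition of a count according to the distance to `w`. -/
theorem card_filter_le_dyadic (F : Finset E3) (w : E3) (P : E3 → Prop) {b : ℝ} {J₀ J : ℕ}
    (hJ : J₀ ≤ J) (hdiam : ∀ w' ∈ F, ‖w - w'‖ ≤ 2 ^ J * b) :
    ((F.filter P).card : ℝ) ≤ ((F.filter (fun w' => ‖w - w'‖ ≤ b ∧ P w')).card : ℝ) +
      (∑ j ∈ Finset.range J₀, ((F.filter (fun w' =>
          2 ^ j * b ≤ ‖w - w'‖ ∧ ‖w - w'‖ ≤ 2 * (2 ^ j * b) ∧ P w')).card : ℝ) +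
        ∑ j ∈ Finset.Ico J₀ J, ((F.filter (fun w' =>
          2 ^ j * b ≤ ‖w - w'‖ ∧ ‖w - w'‖ ≤ 2 * (2 ^ j * b) ∧ P w')).card : ℝ)) := by
  rw [Finset.sum_range_add_sum_Ico _ hJ]
  have hsub : F.filter P ⊆ F.filter (fun w' => ‖w - w'‖ ≤ b ∧ P w') ∪
      (Finset.range J).biUnion (fun j => F.filter (fun w' =>
          2 ^ j * b ≤ ‖w - w'‖ ∧ ‖w - w'‖ ≤ 2 * (2 ^ j * b) ∧ P w')) := by
    intro w' hw'
    obtain ⟨hF, hP⟩ := Finset.mem_filter.1 hw'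
    rcases le_or_gt ‖w - w'‖ b with h | h
    · exact Finset.mem_union_left _ (Finset.mem_filter.2 ⟨hF, h, hP⟩)
    · obtain ⟨j, hj, h1, h2⟩ := exists_dyadic_index h J (hdiam w' hF)
      exact Finset.mem_union_right _ (Finset.mem_biUnion.2
        ⟨j, hj, Finset.mem_filter.2 ⟨hF, h1, h2, hP⟩⟩)
  exact_mod_cast (Finset.card_le_card hsub).trans ((Finset.card_union_le _ _).trans
    (Nat.add_le_add_left Finset.card_biUnion_le _))

theorem sum_Ico_geometric_le {l : ℝ} (h0 : 0 ≤ l) (h1 : l < 1) (m n : ℕ) :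
    ∑ j ∈ Finset.Ico m n, l ^ j ≤ l ^ m / (1 - l) := by
  have h : 0 < 1 - l := by linarith
  rcases le_total m n with hmn | hmn
  · rw [geom_sum_Ico' h1.ne hmn]
    gcongr
    linarith [pow_nonneg h0 n]
  · rw [Finset.Ico_eq_empty_of_le hmn, Finset.sum_empty]
    positivity

theorem inv_rpow_dyadic_le {c y : ℝ} (hc : 0 < c) (hy : 1 ≤ y) (j : ℕ) :
    1 / (2 ^ j * y) ^ c ≤ ((2 : ℝ) ^ (-c)) ^ j := by
  have h : (2 ^ j : ℝ) ^ c ≤ (2 ^ j * y) ^ c := by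
    gcongr
    exact le_mul_of_one_le_right (by positivity) hy
  have e : ((2 : ℝ) ^ (-c)) ^ j = 1 / (2 ^ j : ℝ) ^ c := by
    rw [Real.rpow_neg (by norm_num), inv_pow, one_div, ← Real.rpow_natCast,
      ← Real.rpow_natCast, ← Real.rpow_mul (by norm_num), ← Real.rpow_mul (by norm_num), mul_comm]
  rw [e]
  exact one_div_le_one_div_of_le (by positivity) h

/-- Eventual smallness of geometric tails started at a linear index. -/
theorem exists_scale_threshold {c : ℝ} (hc : 0 < c) : ∃ k₀ : ℝ, 1000 ≤ k₀ ∧ ∀ k, k₀ ≤ k →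
    0 < ⌊k / 2⌋₊ ∧ 100000 ≤ (k ^ 6) ^ c ∧
      ((2 : ℝ) ^ (-c)) ^ ⌊k / 2⌋₊ / (1 - (2 : ℝ) ^ (-c)) ≤ 1 / (8 * k ^ 4) := by
  set l : ℝ := (2 : ℝ) ^ (-c) with hl
  have hl0 : 0 < l := by positivity
  have hl1 : l < 1 := Real.rpow_lt_one_of_one_lt_of_neg (by norm_num) (by linarith)
  have hl2 : 0 < 1 - l := by linarith
  have h1 := tendsto_pow_const_mul_const_pow_of_abs_lt_one 4 (r := l) (by rwa [abs_of_pos hl0])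
  have h2 : ∀ᶠ n : ℕ in Filter.atTop, (n : ℝ) ^ 4 * l ^ n < (1 - l) / (8 * 4 ^ 4) :=
    h1.eventually_lt_const (by positivity)
  obtain ⟨n₀, hn₀⟩ := Filter.eventually_atTop.1 h2
  have h3 : Filter.Tendsto (fun k : ℝ => (k ^ 6) ^ c) Filter.atTop Filter.atTop :=
    (tendsto_rpow_atTop hc).comp (Filter.tendsto_pow_atTop (by norm_num))
  obtain ⟨k₁, hk₁⟩ := Filter.eventually_atTop.1 (h3.eventually_ge_atTop 100000)
  refine ⟨max 1000 (max k₁ (2 * n₀)), le_max_left _ _, fun k hk => ?_⟩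
  have a1 : 1000 ≤ k := (le_max_left _ _).trans hk
  have a2 : k₁ ≤ k := (le_max_left _ _).trans ((le_max_right _ _).trans hk)
  have a3 : 2 * (n₀ : ℝ) ≤ k := (le_max_right _ _).trans ((le_max_right _ _).trans hk)
  have b1 : n₀ ≤ ⌊k / 2⌋₊ := Nat.le_floor (by linarith)
  have b2 : k / 2 < ⌊k / 2⌋₊ + 1 := Nat.lt_floor_add_one _
  have b3 : k / 4 ≤ ⌊k / 2⌋₊ := by linarith
  have b4 : (0 : ℝ) < ⌊k / 2⌋₊ := by linarith
  refine ⟨by exact_mod_cast b4, hk₁ k a2, ?_⟩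
  have b5 := hn₀ _ b1
  generalize (⌊k / 2⌋₊) = n at *
  rw [div_le_iff₀ hl2, div_mul_eq_mul_div, one_mul, le_div_iff₀ (by positivity)]
  have b6 : k ^ 4 ≤ 4 ^ 4 * (n : ℝ) ^ 4 := by
    rw [← mul_pow]
    gcongr
    linarith
  have b7 : l ^ n * k ^ 4 ≤ l ^ n * (4 ^ 4 * (n : ℝ) ^ 4) := by gcongr
  rw [lt_div_iff₀ (by positivity)] at b5
  linarith

theorem exists_rich_scale : ∃ k₀ : ℝ, 1 ≤ k₀ ∧
    ∀ (F W : Finset E3) (T : E3 → E3 → ℝ → Prop) (σ δ Cn α k : ℝ), k₀ ≤ k → W ⊆ F → 0 < δ → 0 < σ →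
      σ ≤ 1 → 0 < Cn → 1 ≤ α → α ≤ 3 / 2 →
      (∀ w ∈ F, ∀ ρ, σ ^ 10 * δ ≤ ρ →
        ((F.filter (fun w' => ‖w - w'‖ ≤ ρ)).card : ℝ) ≤ Cn * ρ ^ α) →
      (∀ w w' r, T w w' r → |quadEval (w - w') r| ≤ σ ^ 10 * δ ∧ |quadDeriv (w - w') r| ≤ δ) →
      (∀ w ∈ F, ∀ w' ∈ F, ‖w - w'‖ ≤ 2) →
      (∀ w ∈ W, 1 / k ^ 2 ≤
        len {r | Cn * σ * δ ^ α * k ^ 36 ≤ ((F.filter (fun w' => T w w' r)).card : ℝ)}) →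
      1 / k ^ 2 * F.card ≤ W.card →
      ∃ b, δ * k ^ 6 ≤ b ∧ ∃ F' ⊆ W, 1 / k ^ 3 * (F.card : ℝ) ≤ F'.card ∧
        ∀ w ∈ F', 1 / k ^ 3 ≤ len {r | Cn * σ * δ ^ α * k ^ 14 ≤
          ((F.filter (fun w' => b ≤ ‖w - w'‖ ∧ ‖w - w'‖ ≤ 2 * b ∧ T w w' r)).card : ℝ)} := by
  obtain ⟨c, hc, hdy⟩ := exists_sum_len_tangent_dyadic_le
  obtain ⟨k₀, hk₀, hthr⟩ := exists_scale_threshold hc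
  refine ⟨k₀, by linarith, ?_⟩
  intro F W T σ δ Cn α k hk hWF hδ hσ hσ1 hCn hα hα2 hball hT hdiam hWl hWc
  obtain ⟨hJ₀, hx, hgeo⟩ := hthr k hk
  have hk1000 : 1000 ≤ k := hk₀.trans hk
  have hk0 : 0 < k := by linarith
  have hk1 : 1 ≤ k := by linarith
  have hJ₀k : ((⌊k / 2⌋₊ : ℕ) : ℝ) ≤ k / 2 := Nat.floor_le (by positivity)
  generalize (⌊k / 2⌋₊) = J₀ at hJ₀ hgeo hJ₀k
  have hJ₀' : (0 : ℝ) < J₀ := by exact_mod_cast hJ₀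
  have hk6 : 1 ≤ k ^ 6 := one_le_pow₀ hk1
  have hb0 : 0 < δ * k ^ 6 := by positivity
  have hnear : ∀ w ∈ W, len {r | Cn * σ * δ ^ α * k ^ 36 / 3 ≤ ((F.filter (fun w' =>
      ‖w - w'‖ ≤ δ * k ^ 6 ∧ T w w' r)).card : ℝ)} ≤ 1 / k ^ 2 / 4 := by
    intro w hw
    have h := len_near_le F w hσ hσ1 hδ (one_le_pow₀ hk1 (n := 2)) hCn hα hα2
      (hball w (hWF hw))
    rw [← pow_mul, ← pow_mul, ← pow_mul] at h
    norm_num at h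
    have h2 : len {r | Cn * σ * δ ^ α * k ^ 36 / 3 ≤ ((F.filter (fun w' =>
        ‖w - w'‖ ≤ δ * k ^ 6 ∧ T w w' r)).card : ℝ)} ≤ 240 / k ^ 30 := by
      rw [le_div_iff₀ (by positivity), mul_comm]
      refine le_trans (mul_le_mul_of_nonneg_left (len_mono ?_) (by positivity)) h
      rintro r ⟨hr, -⟩
      change (_ : ℝ) ≤ _ at hr
      refine hr.trans (Nat.cast_le.2 (Finset.card_le_card ?_))
      exact Finset.monotone_filter_right _ fun w' _ hw' => ⟨hw'.1, (hT _ _ _ hw'.2).1⟩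
    refine h2.trans ?_
    rw [div_div, div_le_div_iff₀ (by positivity) (by positivity)]
    have : k ^ 2 * 1000 ≤ k ^ 30 := by
      calc k ^ 2 * 1000 ≤ k ^ 2 * k ^ 28 := by
            gcongr
            exact hk1000.trans (le_self_pow₀ hk1 (by norm_num))
        _ = _ := by ring
    have h3 : 0 ≤ k ^ 2 := by positivity
    linarith only [this, h3]
  obtain ⟨J₁, hJ₁⟩ := pow_unbounded_of_one_lt (2 / (δ * k ^ 6)) (one_lt_two (α := ℝ))
  set J := max J₀ J₁ with hJ
  have hJ2 : (2 : ℝ) ≤ 2 ^ J * (δ * k ^ 6) := by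
    rw [div_lt_iff₀ hb0] at hJ₁
    refine hJ₁.le.trans ?_
    gcongr
    · norm_num
    · exact le_max_right _ _
  have hA0 : 0 ≤ Cn * σ * δ ^ α := by positivity
  generalize hAe : Cn * σ * δ ^ α = A at *
  obtain ⟨j, F', hF', hc', hl'⟩ := exists_scale_of_count F W hWF
    (fun w r => ((F.filter (fun w' => T w w' r)).card : ℝ))
    (fun w r => ((F.filter (fun w' => ‖w - w'‖ ≤ δ * k ^ 6 ∧ T w w' r)).card : ℝ))
    (fun j w r => ((F.filter (fun w' => 2 ^ j * (δ * k ^ 6) ≤ ‖w - w'‖ ∧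
      ‖w - w'‖ ≤ 2 * (2 ^ j * (δ * k ^ 6)) ∧ T w w' r)).card : ℝ))
    (fun j => 1 / (2 ^ j * k ^ 6) ^ c) (J₀ := J₀) (J := J) (A := A) (B := A * k ^ 36)
    (T := A * k ^ 14) (ε := 1 / (8 * k ^ 4)) (ℓ := 1 / k ^ 2) hJ₀
    (fun w hw r _ _ => card_filter_le_dyadic F w _ (le_max_left _ _)
      fun w' hw' => (hdiam w (hWF hw) w' hw').trans hJ2)
    hA0 (by positivity) hWl hWc hnear
    (fun j _ => by
      have hY : 1 ≤ 2 ^ j * k ^ 6 := one_le_mul_of_one_le_of_one_le (one_le_pow₀ one_le_two) hk6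
      have hYc : 100000 ≤ (2 ^ j * k ^ 6) ^ c := by
        refine hx.trans ?_
        gcongr
        exact le_mul_of_one_le_left (by positivity) (one_le_pow₀ one_le_two)
      refine le_trans (Finset.sum_le_sum fun w _ => len_mono ?_)
        (hdy F (2 ^ j * k ^ 6) δ σ Cn α hY hYc hδ hσ hσ1 hCn hα hα2 hball)
      rintro r ⟨hr, -⟩
      rw [hAe]
      change (_ : ℝ) ≤ _ at hr
      refine hr.trans (Nat.cast_le.2 (Finset.card_le_card ?_))
      refine Finset.monotone_filter_right _ fun w' _ hw' => ?_
      have e : δ * (2 ^ j * k ^ 6) = 2 ^ j * (δ * k ^ 6) := by ring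
      rw [e]
      exact ⟨(hT _ _ _ hw'.2.2).1, (hT _ _ _ hw'.2.2).2, hw'.1, hw'.2.1⟩)
    (le_trans (Finset.sum_le_sum fun j _ => inv_rpow_dyadic_le hc hk6 j)
      ((sum_Ico_geometric_le (by positivity)
        (Real.rpow_lt_one_of_one_lt_of_neg (by norm_num) (by linarith)) _ _).trans hgeo))
    (le_of_eq (by field_simp))
    (by
      rw [mul_div_assoc]
      refine mul_le_mul_of_nonneg_left ?_ hA0
      have : 1 ≤ k ^ 36 := one_le_pow₀ hk1
      have : 1 ≤ k ^ 4 := one_le_pow₀ hk1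
      rw [div_le_div_iff₀ (by positivity) (by norm_num)]
      nlinarith)
    (by
      have h1 : k ^ 15 ≤ k ^ 36 := pow_le_pow_right₀ hk1 (by norm_num)
      have h15 : 0 ≤ k ^ 15 := by positivity
      have h16 : k ^ 15 * 1000 ≤ k ^ 36 := by
        calc k ^ 15 * 1000 ≤ k ^ 15 * k ^ 21 := by
              gcongr
              exact hk1000.trans (le_self_pow₀ hk1 (by norm_num))
          _ = _ := by ring
      calc J₀ * (A * k ^ 14) ≤ k / 2 * (A * k ^ 14) := by gcongr
        _ = A * (k ^ 15 / 2) := by ring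
        _ ≤ A * (k ^ 36 / 3) := mul_le_mul_of_nonneg_left (by linarith) hA0
        _ = _ := by ring)
  have hfin : 1 / k ^ 3 ≤ 1 / k ^ 2 / (2 * J₀) := by
    rw [div_div]
    apply one_div_le_one_div_of_le (by positivity)
    calc k ^ 2 * (2 * J₀) ≤ k ^ 2 * (2 * (k / 2)) := by gcongr
      _ = _ := by ring
  refine ⟨2 ^ j * (δ * k ^ 6), le_mul_of_one_le_left hb0.le (one_le_pow₀ one_le_two), F', hF',
    le_trans (by gcongr) hc', fun w hw => hfin.trans (hl' w hw)⟩

theorem mass_eq_card_filter_div {V : Type*} (F : Finset V) (A : Set V)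
    [DecidablePred fun w => w ∈ A] :
    mass F A = ((F.filter (fun w => w ∈ A)).card : ℝ) / F.card := by
  unfold mass
  have : A ∩ (F : Set V) = ((F.filter (fun w => w ∈ A) : Finset V) : Set V) := by
    ext w; simp [and_comm]
  rw [this, Nat.card_coe_set_eq, Set.ncard_coe_finset]

theorem mass_le_one {V : Type*} (F : Finset V) (A : Set V) : mass F A ≤ 1 := by
  rw [mass_eq_card_filter_div]
  exact div_le_one_of_le₀ (Nat.cast_le.2 (Finset.card_filter_le _ _)) (Nat.cast_nonneg _)

theorem ofReal_le_volume_iff {c : ℝ} (P : ℝ → Prop) :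
    ENNReal.ofReal c ≤ volume {r ∈ Set.Icc (1 / 2 : ℝ) 1 | P r} ↔ c ≤ len {r | P r} := by
  have e : {r ∈ Set.Icc (1 / 2 : ℝ) 1 | P r} = {r | P r} ∩ Set.Icc (1 / 2 : ℝ) 1 := by
    ext r; exact and_comm
  rw [e]
  exact ENNReal.ofReal_le_iff_le_toReal (volume_inter_Icc_lt_top _).ne

theorem abs_quad_le_of_norm_piProj_sub_le {t r δ : ℝ} {w w' : E3}
    (h : ‖piProj t r w - piProj t r w'‖ ≤ δ) :
    Real.exp t * |quadEval (w - w') r| ≤ δ ∧ |quadDeriv (w - w') r| ≤ δ := by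
  have h0 := (PiLp.norm_apply_le (piProj t r w - piProj t r w') 0).trans h
  have h1 := (PiLp.norm_apply_le (piProj t r w - piProj t r w') 1).trans h
  have e0 : (piProj t r w - piProj t r w') 0 = Real.exp t * quadEval (w - w') r := by
    simp [piProj, quadEval]; ring
  have e1 : (piProj t r w - piProj t r w') 1 = quadDeriv (w - w') r := by
    simp [piProj, quadDeriv]; ring
  rw [e0, Real.norm_eq_abs, abs_mul, abs_of_pos (Real.exp_pos t)] at h0
  rw [e1, Real.norm_eq_abs] at h1
  exact ⟨h0, h1⟩

theorem rpow_sub_mul_eq {δ η : ℝ} (hδ : 0 < δ) (a : ℝ) (n : ℕ) :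
    δ ^ (a - n * η) = δ ^ a * (δ ^ (-(η / 2))) ^ (2 * n) := by
  rw [← Real.rpow_natCast, ← Real.rpow_mul hδ.le, ← Real.rpow_add hδ]
  congr 1
  push_cast
  ring

theorem le_div_card_iff {a b c d m N : ℝ} (hN : 0 < N) :
    a * b * (c * d) ≤ m / N ↔ a * N * b * c * d ≤ m := by
  rw [le_div_iff₀ hN]
  constructor <;> intro h <;> linarith

end

theorem stmt4 :
    ∃ η₀ C₁ : ℝ, 0 < η₀ ∧ 1 ≤ C₁ ∧
      ∀ (α δ₀ C₀ : ℝ) (F : Finset E3),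
        1 ≤ α → α ≤ 3 / 2 → 0 < δ₀ → δ₀ ≤ 1 → 1 ≤ C₀ → F.Nonempty →
        (F : Set E3) ⊆ closedBall 0 1 →
        (∀ (w : E3) (δ : ℝ), δ₀ ≤ δ → mass F (closedBall w δ) ≤ C₀ * δ ^ α) →
        ∀ t δ : ℝ, 0 ≤ t → Real.exp t * δ₀ ≤ δ → δ ≤ 1 →
        ∀ η C : ℝ, 0 < η → η ≤ η₀ → C₁ ≤ C →
          ∀ Fhm : Set E3,
            Fhm = {w | w ∈ F ∧
              ENNReal.ofReal (C * δ ^ η) ≤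
                volume {r ∈ Set.Icc (1/2 : ℝ) 1 |
                  C₀ * Real.exp (-t / 10) * δ ^ (α - 18 * η) ≤ mDelta F t r δ w}} →
            C * δ ^ η ≤ mass F Fhm →
            ∃ b : ℝ, δ ^ (1 - 3 * η) ≤ b ∧
              ∃ F' : Set E3, F' ⊆ Fhm ∧ δ ^ (3 * η / 2) ≤ mass F F' ∧
                ∀ w ∈ F',
                  ENNReal.ofReal (δ ^ (3 * η / 2)) ≤
                    volume {r ∈ Set.Icc (1/2 : ℝ) 1 |
                      C₀ * Real.exp (-t / 10) * δ ^ (α - 7 * η) ≤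
                        mDeltaRes F t r δ w (annulus w b)} := by
  classical
  obtain ⟨k₀, hk₀, hmain⟩ := exists_rich_scale
  refine ⟨1, k₀ ^ 2, one_pos, one_le_pow₀ hk₀, ?_⟩
  intro α δ₀ C₀ F hα hα2 hδ₀ _ hC₀ hF hF1 hball t δ ht hδt _ η C _ _ hC Fhm hFhm hmass
  have hδ : 0 < δ := lt_of_lt_of_le (by positivity) hδt
  have hC1 : 1 ≤ C := (one_le_pow₀ hk₀).trans hC
  have hN : (0 : ℝ) < F.card := by exact_mod_cast hF.card_pos
  have e18 := rpow_sub_mul_eq (η := η) hδ α 18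
  have e7 := rpow_sub_mul_eq (η := η) hδ α 7
  have e3 := rpow_sub_mul_eq (η := η) hδ 1 3
  have hk0 : 0 < δ ^ (-(η / 2)) := by positivity
  have e1 : δ ^ η = 1 / (δ ^ (-(η / 2))) ^ 2 := by
    rw [eq_div_iff (by positivity), ← Real.rpow_natCast, ← Real.rpow_mul hδ.le,
      ← Real.rpow_add hδ]
    convert Real.rpow_zero δ using 2
    push_cast; ring
  have e32 : δ ^ (3 * η / 2) = 1 / (δ ^ (-(η / 2))) ^ 3 := by
    rw [eq_div_iff (by positivity), ← Real.rpow_natCast, ← Real.rpow_mul hδ.le,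
      ← Real.rpow_add hδ]
    convert Real.rpow_zero δ using 2
    push_cast; ring
  norm_num at e18 e7 e3
  rw [e18] at hFhm
  rw [e1] at hFhm hmass
  rw [e7, e3, e32]
  clear e18 e7 e3 e1 e32
  generalize δ ^ (-(η / 2)) = k at *
  have hkk : k₀ ≤ k := by
    have h1 := hmass.trans (mass_le_one _ _)
    rw [mul_one_div, div_le_one (by positivity)] at h1
    exact le_of_sq_le_sq (hC.trans h1) hk0.le
  have hCk : 1 / k ^ 2 ≤ C * (1 / k ^ 2) := le_mul_of_one_le_left (by positivity) hC1
  have hσ10 : Real.exp (-t / 10) ^ 10 = (Real.exp t)⁻¹ := by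
    rw [← Real.exp_nat_mul, ← Real.exp_neg]
    congr 1
    push_cast; ring
  obtain ⟨b, hb, F', hF', hc, hl⟩ := hmain F (F.filter (fun w => w ∈ Fhm))
    (fun w w' r => ‖piProj t r w - piProj t r w'‖ ≤ δ) (Real.exp (-t / 10)) δ (C₀ * F.card) α k
    hkk (Finset.filter_subset _ _) hδ (Real.exp_pos _) (Real.exp_le_one_iff.2 (by linarith))
    (by positivity) hα hα2
    (fun w _ ρ hρ => by
      rw [hσ10, inv_mul_le_iff₀ (Real.exp_pos t)] at hρ
      have h := hball w ρ (le_of_mul_le_mul_left (hδt.trans hρ) (Real.exp_pos t))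
      rw [mass_eq_card_filter_div, div_le_iff₀ hN] at h
      refine le_trans (Nat.cast_le.2 (Finset.card_le_card ?_)) (h.trans (le_of_eq (by ring)))
      refine Finset.monotone_filter_right _ fun w' _ hw' => ?_
      rwa [mem_closedBall, dist_comm, dist_eq_norm])
    (fun w w' r h => by
      obtain ⟨h1, h2⟩ := abs_quad_le_of_norm_piProj_sub_le h
      exact ⟨by rwa [hσ10, le_inv_mul_iff₀ (Real.exp_pos t)], h2⟩)
    (fun w hw w' hw' => by
      have h1 := mem_closedBall_zero_iff.1 (hF1 hw)
      have h2 := mem_closedBall_zero_iff.1 (hF1 hw')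
      exact (norm_sub_le _ _).trans (by linarith))
    (fun w hw => by
      have h := (Finset.mem_filter.1 hw).2
      rw [hFhm] at h
      refine hCk.trans (((ofReal_le_volume_iff _).1 h.2).trans (len_mono ?_))
      rintro r ⟨hr, -⟩
      change (_ : ℝ) ≤ mDelta F t r δ w at hr
      rw [mDelta, mass_eq_card_filter_div, le_div_card_iff hN] at hr
      exact hr)
    (by
      rw [mass_eq_card_filter_div, le_div_iff₀ hN] at hmass
      exact le_trans (by gcongr) hmass)
  refine ⟨b, hb, F', fun w hw => (Finset.mem_filter.1 (hF' hw)).2, ?_, fun w hw => ?_⟩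
  · rw [mass_eq_card_filter_div, le_div_iff₀ hN]
    refine hc.trans (Nat.cast_le.2 (Finset.card_le_card fun w hw => ?_))
    exact Finset.mem_filter.2 ⟨(Finset.mem_filter.1 (hF' hw)).1, hw⟩
  · rw [ofReal_le_volume_iff]
    refine (hl w hw).trans (len_mono ?_)
    rintro r ⟨hr, -⟩
    change (_ : ℝ) ≤ _ at hr
    change (_ : ℝ) ≤ mDeltaRes F t r δ w (annulus w b)
    rw [mDeltaRes, mass_eq_card_filter_div, le_div_card_iff hN]
    refine hr.trans (Nat.cast_le.2 (Finset.card_le_card ?_))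
    exact Finset.monotone_filter_right _ fun w' _ hw' => ⟨⟨hw'.1, hw'.2.1⟩, hw'.2.2⟩
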